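/- arXiv:1609.08477 — 8 statements merged into one kernel-verified Lean document; each statement's English description precedes it below -/
import Mathlib

section
/- For every integer n ≥ 1 there exists a C² solution Q : ℝ → ℝ of the harmonic map ODE satisfying lim_{r→-∞} Q(r) = 0, lim_{r→+∞} Q(r) = nπ, and the symmetry Q(r) + Q(-r) = nπ for all r ∈ ℝ. -/
open Real Filter MeasureTheory

/-- `F` is a (global, C²) solution of the harmonic map ODE
`F'' + (2r/(r²+1)) F' - sin(2F)/(r²+1) = 0` on the wormhole. -/
def IsHarmonicMapSol (F : ℝ → ℝ) : Prop :=
  ContDiff ℝ 2 F ∧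
    ∀ r : ℝ, deriv (deriv F) r + (2 * r / (r ^ 2 + 1)) * deriv F r
      - Real.sin (2 * F r) / (r ^ 2 + 1) = 0

open scoped NNReal

lemma global_exists {E : Type*} [NormedAddCommGroup E] [NormedSpace ℝ E] [CompleteSpace E]
    (v : ℝ → E → E) (K L : ℝ≥0) (hK : ∀ t, LipschitzWith K (v t))
    (hc : ∀ x, Continuous (fun t => v t x)) (hL : ∀ t x, ‖v t x‖ ≤ L) (x₀ : E) :
    ∃ α : ℝ → E, α 0 = x₀ ∧ ∀ t, HasDerivAt α (v t (α t)) t := by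
  have key : ∀ T : ℝ≥0, ∃ α : ℝ → E, α 0 = x₀ ∧
      ∀ t ∈ Set.Ioo (-(T : ℝ)) T, HasDerivAt α (v t (α t)) t := by
    intro T
    have hT : (0 : ℝ) ∈ Set.Icc (-(T : ℝ)) T := ⟨by simp, by simp⟩
    have hPL : IsPicardLindelof v (⟨0, hT⟩ : Set.Icc (-(T : ℝ)) T) x₀ (L * T) 0 L K :=
      { lipschitzOnWith := fun t _ => (hK t).lipschitzOnWith
        continuousOn := fun x _ => (hc x).continuousOn
        norm_le := fun t _ x _ => hL t x
        mul_max_le := by simp }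
    obtain ⟨α, h0, hα⟩ := hPL.exists_eq_forall_mem_Icc_hasDerivWithinAt₀
    exact ⟨α, h0, fun t ht => (hα t (Set.Ioo_subset_Icc_self ht)).hasDerivAt
      (Icc_mem_nhds ht.1 ht.2)⟩
  choose α h0 hα using key
  have huniq : ∀ T S : ℝ≥0, 0 < T → T ≤ S → Set.EqOn (α T) (α S) (Set.Ioo (-(T : ℝ)) T) := by
    intro T S hT hTS
    have hTS' : (T : ℝ) ≤ S := by exact_mod_cast hTS
    have hT' : (0 : ℝ) < T := by exact_mod_cast hT
    exact ODE_solution_unique_of_mem_Ioo (v := v) (s := fun _ => Set.univ) (K := K) (t₀ := 0)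
      (fun t _ => (hK t).lipschitzOnWith) ⟨by linarith, hT'⟩
      (fun t ht => ⟨hα T t ht, trivial⟩)
      (fun t ht => ⟨hα S t ⟨by linarith [ht.1], by linarith [ht.2]⟩, trivial⟩)
      (by rw [h0, h0])
  refine ⟨fun t => α (‖t‖₊ + 1) t, h0 _, fun t => ?_⟩
  set S : ℝ≥0 := ‖t‖₊ + 2 with hS
  have hSr : (S : ℝ) = |t| + 2 := by simp [hS]
  have hmem : t ∈ Set.Ioo (-(S : ℝ)) S := by
    rw [hSr]; exact ⟨by linarith [neg_abs_le t], by linarith [le_abs_self t]⟩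
  have hev : (fun s => α (‖s‖₊ + 1) s) =ᶠ[nhds t] α S := by
    filter_upwards [Metric.ball_mem_nhds t one_pos] with s hs
    have hs' : |s - t| < 1 := by simpa [Real.dist_eq] using hs
    have h1 : |s| ≤ |t| + 1 := by
      have := abs_sub_abs_le_abs_sub s t; linarith
    refine huniq _ _ (by positivity) ?_ ?_
    · rw [← NNReal.coe_le_coe, hSr]; simp; linarith
    · simp only [NNReal.coe_add, coe_nnnorm, Real.norm_eq_abs, NNReal.coe_one]
      exact ⟨by linarith [neg_abs_le s], by linarith [le_abs_self s]⟩
  have := (hα S t hmem).congr_of_eventuallyEq hev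
  have he : α (‖t‖₊ + 1) t = α S t := hev.self_of_nhds
  simpa [he] using this

/-- First order form of the ODE. -/
structure Sol (F p : ℝ → ℝ) : Prop where
  hF : ∀ r, HasDerivAt F (p r / (r ^ 2 + 1)) r
  hp : ∀ r, HasDerivAt p (Real.sin (2 * F r)) r

lemma abs_sin_sub (x y : ℝ) : |Real.sin x - Real.sin y| ≤ |x - y| := by
  have h : LipschitzWith 1 Real.sin := by
    apply lipschitzWith_of_nnnorm_deriv_le Real.differentiable_sin
    intro x
    rw [← NNReal.coe_le_coe]
    simpa using Real.abs_cos_le_one x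
  simpa [Real.dist_eq] using h.dist_le_mul x y

lemma div_le_aux (x r : ℝ) : |x / (r ^ 2 + 1)| ≤ |x| := by
  rw [abs_div, abs_of_pos (by positivity : r ^ 2 + 1 > 0)]
  exact div_le_self (abs_nonneg _) (by nlinarith [sq_nonneg r])

noncomputable def vf (t : ℝ) (x : ℝ × ℝ) : ℝ × ℝ := (x.2 / (t ^ 2 + 1), Real.sin (2 * x.1))

lemma vf_lip (t : ℝ) : LipschitzWith 2 (vf t) := by
  refine LipschitzWith.of_dist_le_mul fun x y => ?_
  have h1 : |x.1 - y.1| ≤ dist x y := by rw [← Real.dist_eq]; exact le_max_left _ _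
  have h2 : |x.2 - y.2| ≤ dist x y := by rw [← Real.dist_eq]; exact le_max_right _ _
  have hd : 0 ≤ dist x y := dist_nonneg
  simp only [vf, Prod.dist_eq, Real.dist_eq, NNReal.coe_ofNat] at h1 h2 hd ⊢
  apply max_le
  · rw [← sub_div]
    have := div_le_aux (x.2 - y.2) t
    linarith
  · have := abs_sin_sub (2 * x.1) (2 * y.1)
    rw [← mul_sub, abs_mul, abs_two] at this
    linarith

lemma Sol.vf {F p : ℝ → ℝ} (h : Sol F p) (t : ℝ) :
    HasDerivAt (fun r => (F r, p r)) (vf t (F t, p t)) t := (h.hF t).prodMk (h.hp t)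

lemma Sol.unique {F p G q : ℝ → ℝ} (h : Sol F p) (h' : Sol G q) (t : ℝ) (h1 : F t = G t)
    (h2 : p t = q t) : F = G ∧ p = q := by
  have := ODE_solution_unique_univ (v := _root_.vf) (s := fun _ => Set.univ) (K := 2) (t₀ := t)
    (f := fun r => (F r, p r)) (g := fun r => (G r, q r))
    (fun t => (vf_lip t).lipschitzOnWith) (fun t => ⟨h.vf t, trivial⟩)
    (fun t => ⟨h'.vf t, trivial⟩) (by simp [h1, h2])
  constructor <;> ext s
  · exact congrArg Prod.fst (congrFun this s)
  · exact congrArg Prod.snd (congrFun this s)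

lemma Sol.dist {F p G q : ℝ → ℝ} (h : Sol F p) (h' : Sol G q) (h1 : F 0 = G 0)
    {t T : ℝ} (ht : 0 ≤ t) (htT : t ≤ T) :
    |F t - G t| ≤ |p 0 - q 0| * Real.exp (2 * T) ∧
    |p t - q t| ≤ |p 0 - q 0| * Real.exp (2 * T) := by
  have := dist_le_of_trajectories_ODE (v := _root_.vf) (K := 2)
    (f := fun r => (F r, p r)) (g := fun r => (G r, q r)) (a := 0) (b := t) (δ := |p 0 - q 0|)
    vf_lip (fun s _ => (h.vf s).continuousAt.continuousWithinAt)
    (fun s _ => (h.vf s).hasDerivWithinAt)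
    (fun s _ => (h'.vf s).continuousAt.continuousWithinAt)
    (fun s _ => (h'.vf s).hasDerivWithinAt) (by simp [Prod.dist_eq, h1, Real.dist_eq]) t ⟨ht, le_rfl⟩
  simp only [Prod.dist_eq, Real.dist_eq, NNReal.coe_ofNat, sub_zero] at this
  have h3 : |p 0 - q 0| * Real.exp (2 * t) ≤ |p 0 - q 0| * Real.exp (2 * T) := by gcongr
  exact ⟨(le_max_left _ _).trans (this.trans h3), (le_max_right _ _).trans (this.trans h3)⟩

lemma p_bound {F p : ℝ → ℝ} (hp : ∀ r, HasDerivAt p (Real.sin (2 * F r)) r) (r : ℝ) :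
    |p r - p 0| ≤ |r| := by
  have := Convex.norm_image_sub_le_of_norm_hasDerivWithin_le (f := p) (C := 1) (s := Set.univ)
    (x := 0) (y := r)
    (fun x _ => (hp x).hasDerivWithinAt) (fun x _ => by simpa using Real.abs_sin_le_one _)
    convex_univ trivial trivial
  simpa using this

lemma sol_exists (a b : ℝ) : ∃ F p, Sol F p ∧ F 0 = a ∧ p 0 = b := by
  set c : ℝ → ℝ → ℝ := fun t y => max (-(|b| + |t|)) (min (|b| + |t|) y) with hc
  have hcl : ∀ t y z, |c t y - c t z| ≤ |y - z| := by
    intro t y z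
    have : LipschitzWith 1 (c t) := (LipschitzWith.id.const_min _).const_max _
    simpa [Real.dist_eq] using this.dist_le_mul y z
  have hcb : ∀ t y, |c t y| ≤ |b| + |t| := by
    intro t y
    have : 0 ≤ |b| + |t| := by positivity
    rw [abs_le]
    exact ⟨le_max_left _ _, max_le (by linarith) (min_le_left _ _)⟩
  have hcc : ∀ y, Continuous fun t => c t y := by intro y; simp only [hc]; fun_prop
  have key : ∃ α : ℝ → ℝ × ℝ, α 0 = (a, b) ∧ ∀ t, HasDerivAt α
      ((fun t (x : ℝ × ℝ) => (c t x.2 / (t ^ 2 + 1), Real.sin (2 * x.1))) t (α t)) t := by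
    refine global_exists
      (fun t (x : ℝ × ℝ) => (c t x.2 / (t ^ 2 + 1), Real.sin (2 * x.1))) 2 (‖b‖₊ + 1)
      ?_ ?_ ?_ (a, b)
    · intro t
      refine LipschitzWith.of_dist_le_mul fun x y => ?_
      have h1 : |x.1 - y.1| ≤ dist x y := by rw [← Real.dist_eq]; exact le_max_left _ _
      have h2 : |x.2 - y.2| ≤ dist x y := by rw [← Real.dist_eq]; exact le_max_right _ _
      have hd : 0 ≤ dist x y := dist_nonneg
      simp only [Prod.dist_eq, Real.dist_eq, NNReal.coe_ofNat] at h1 h2 hd ⊢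
      apply max_le
      · rw [← sub_div]
        have := div_le_aux (c t x.2 - c t y.2) t
        linarith [hcl t x.2 y.2]
      · have := abs_sin_sub (2 * x.1) (2 * y.1)
        rw [← mul_sub, abs_mul, abs_two] at this
        linarith
    · intro x
      refine Continuous.prodMk ?_ continuous_const
      exact (hcc x.2).div (by fun_prop) (fun t => by positivity)
    · intro t x
      simp only [Prod.norm_def, Real.norm_eq_abs, NNReal.coe_add, coe_nnnorm, NNReal.coe_one]
      apply max_le
      · rw [abs_div, abs_of_pos (by positivity : t ^ 2 + 1 > 0), div_le_iff₀ (by positivity)]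
        have := hcb t x.2
        have h3 := sq_abs t
        nlinarith [abs_nonneg b, abs_nonneg t, sq_nonneg (|t| - 1), mul_nonneg (abs_nonneg b) (sq_nonneg t)]
      · linarith [Real.abs_sin_le_one (2 * x.1), abs_nonneg b]
  obtain ⟨α, h0, hα⟩ := key
  have hF : ∀ t, HasDerivAt (fun t => (α t).1) (c t (α t).2 / (t ^ 2 + 1)) t :=
    fun t => (hα t).fst
  have hp : ∀ t, HasDerivAt (fun t => (α t).2) (Real.sin (2 * (α t).1)) t :=
    fun t => (hα t).snd
  refine ⟨_, _, ⟨fun t => ?_, hp⟩, by simp [h0], by simp [h0]⟩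
  have hb := p_bound hp t
  simp only [h0] at hb
  have h1 : |(α t).2| ≤ |b| + |t| := by
    have := abs_sub_abs_le_abs_sub (α t).2 b; linarith
  have h2 : c t (α t).2 = (α t).2 := by
    rw [abs_le] at h1
    simp only [hc]
    rw [min_eq_right h1.2, max_eq_right h1.1]
  rw [← h2]; exact hF t

noncomputable def En (F p : ℝ → ℝ) (r : ℝ) : ℝ := p r ^ 2 / (2 * (r ^ 2 + 1)) - Real.sin (F r) ^ 2

lemma Sol.En_deriv {F p : ℝ → ℝ} (h : Sol F p) (r : ℝ) :
    HasDerivAt (En F p) (-(r * p r ^ 2 / (r ^ 2 + 1) ^ 2)) r := by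
  have hd : HasDerivAt (fun r : ℝ => 2 * (r ^ 2 + 1)) (2 * (2 * r)) r := by
    simpa using (((hasDerivAt_id r).pow 2).add_const (1 : ℝ)).const_mul (2 : ℝ)
  have h1 := (((h.hp r).pow 2).div hd (by positivity)).sub ((h.hF r).sin.pow 2)
  refine h1.congr_deriv ?_
  rw [Real.sin_two_mul]
  have : r ^ 2 + 1 ≠ 0 := by positivity
  simp
  field_simp
  ring

lemma Sol.En_anti {F p : ℝ → ℝ} (h : Sol F p) : AntitoneOn (En F p) (Set.Ici 0) := by
  refine antitoneOn_of_hasDerivWithinAt_nonpos (convex_Ici 0)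
    (fun r _ => (h.En_deriv r).continuousAt.continuousWithinAt)
    (fun r _ => (h.En_deriv r).hasDerivWithinAt) ?_
  intro r hr
  rw [interior_Ici, Set.mem_Ioi] at hr
  have : 0 ≤ r * p r ^ 2 / (r ^ 2 + 1) ^ 2 := by positivity
  linarith

lemma Sol.contF {F p : ℝ → ℝ} (h : Sol F p) : Continuous F :=
  continuous_iff_continuousAt.2 fun r => (h.hF r).continuousAt

lemma Sol.contp {F p : ℝ → ℝ} (h : Sol F p) : Continuous p :=
  continuous_iff_continuousAt.2 fun r => (h.hp r).continuousAt

lemma sol_const {a : ℝ} (ha : Real.sin (2 * a) = 0) : Sol (fun _ => a) (fun _ => 0) :=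
  ⟨fun r => by simpa using hasDerivAt_const r a, fun r => by
    simpa [ha] using hasDerivAt_const r (0 : ℝ)⟩

lemma Sol.p_pos {F p : ℝ → ℝ} (h : Sol F p) (h0 : 0 < p 0) {R : ℝ} (hE : 0 ≤ En F p R)
    {r : ℝ} (hr : 0 ≤ r) (hrR : r ≤ R) : 0 < p r := by
  by_contra! hneg
  obtain ⟨s, hs, hps⟩ := intermediate_value_Icc' hr h.contp.continuousOn ⟨hneg, h0.le⟩
  have hEs : 0 ≤ En F p s :=
    hE.trans (h.En_anti (Set.mem_Ici.2 hs.1) (Set.mem_Ici.2 (hr.trans hrR)) (hs.2.trans hrR))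
  have hsin : Real.sin (F s) = 0 := by
    simp only [En, hps] at hEs
    have : Real.sin (F s) ^ 2 ≤ 0 := by simpa using hEs
    exact pow_eq_zero_iff (two_ne_zero) |>.1 (le_antisymm this (sq_nonneg _))
  have hc : Sol (fun _ => F s) (fun _ => 0) := sol_const (by rw [Real.sin_two_mul, hsin]; ring)
  have := (h.unique hc s rfl hps).2
  rw [this] at h0
  exact lt_irrefl _ h0

lemma sin_sub_sq (x : ℝ) (k : ℤ) : Real.sin (x - k * π) ^ 2 = Real.sin x ^ 2 := by
  rw [Real.sin_sub_int_mul_pi, mul_pow]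
  rcases Int.even_or_odd k with hk | hk <;> simp [hk.neg_one_zpow]

lemma Sol.trap {F p : ℝ → ℝ} (h : Sol F p) (h0 : 0 < p 0) {x : ℝ} (hx : 1 ≤ x) (k : ℤ)
    (hF : F x < (k + 1) * π) (hE : En F p x < 1 + Real.cos (F x - k * π)) {r : ℝ} (hr : x ≤ r) :
    F r < (k + 1) * π := by
  by_contra! hge
  obtain ⟨s, hs, hFs⟩ := intermediate_value_Icc hr h.contF.continuousOn ⟨hF.le, hge⟩
  have hsin : Real.sin (F s) = 0 := by
    rw [hFs]; exact_mod_cast Real.sin_int_mul_pi (k + 1)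
  have hEs : 0 ≤ En F p s := by simp only [En, hsin]; simp; positivity
  have hW : AntitoneOn (fun r => En F p r - Real.cos (F r - k * π)) (Set.Icc x s) := by
    have hd : ∀ r, HasDerivAt (fun r => En F p r - Real.cos (F r - k * π))
        (-(r * p r ^ 2 / (r ^ 2 + 1) ^ 2) - -Real.sin (F r - k * π) * (p r / (r ^ 2 + 1))) r :=
      fun r => (h.En_deriv r).sub ((h.hF r).sub_const _).cos
    refine antitoneOn_of_hasDerivWithinAt_nonpos (convex_Icc x s)
      (fun r _ => (hd r).continuousAt.continuousWithinAt)
      (fun r _ => (hd r).hasDerivWithinAt) ?_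
    intro r hr
    have hr := interior_subset hr
    have hr1 : 1 ≤ r := hx.trans hr.1
    have hp := h.p_pos h0 hEs (by linarith) hr.2
    have hEr : 0 ≤ En F p r := hEs.trans
      (h.En_anti (Set.mem_Ici.2 (by linarith)) (Set.mem_Ici.2 (by linarith [hr.2])) hr.2)
    have hpos : 0 < r ^ 2 + 1 := by positivity
    rw [En, ← sin_sub_sq _ k, sub_nonneg, le_div_iff₀ (by positivity)] at hEr
    set S := Real.sin (F r - k * π)
    have key : S * (r ^ 2 + 1) ≤ r * p r := by
      apply le_of_abs_le
      apply abs_le_of_sq_le_sq _ (by positivity)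
      have h3 : (r ^ 2 + 1) * S ^ 2 ≤ (2 * r ^ 2) * S ^ 2 :=
        mul_le_mul_of_nonneg_right (by nlinarith) (sq_nonneg _)
      have h4 := mul_le_mul_of_nonneg_left h3 hpos.le
      have h5 := mul_le_mul_of_nonneg_left hEr (sq_nonneg r)
      nlinarith
    have : -(r * p r ^ 2 / (r ^ 2 + 1) ^ 2) - -S * (p r / (r ^ 2 + 1)) =
        (p r / (r ^ 2 + 1) ^ 2) * (S * (r ^ 2 + 1) - r * p r) := by
      field_simp; ring
    rw [this]
    exact mul_nonpos_of_nonneg_of_nonpos (by positivity) (by linarith)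
  have := hW ⟨le_rfl, hs.1⟩ ⟨hs.1, le_rfl⟩ hs.1
  simp only at this
  have hcs : Real.cos (F s - k * π) = -1 := by
    rw [hFs, show ((k : ℝ) + 1) * π - k * π = π by ring, Real.cos_pi]
  linarith

lemma Sol.perturb {F p : ℝ → ℝ} (h : Sol F p) {x : ℝ} (hx : 1 ≤ x) (k : ℤ) {N : ℝ}
    (hk : (k + 1) * π ≤ N) (hN : ∀ r, 0 ≤ r → r ≤ x → F r < N)
    (hF : F x < (k + 1) * π) (hE : En F p x < 1 + Real.cos (F x - k * π)) :
    ∃ ε > 0, ∀ G q, Sol G q → G 0 = F 0 → 0 < q 0 → |q 0 - p 0| < ε → ∀ r, 0 ≤ r → G r < N := by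
  obtain ⟨m, hm, hmax⟩ := isCompact_Icc.exists_isMaxOn (s := Set.Icc 0 x)
    ⟨0, le_rfl, by linarith⟩ h.contF.continuousOn
  have hmN := hN m hm.1 hm.2
  have hcont : Continuous (fun z : ℝ × ℝ =>
      z.2 ^ 2 / (2 * (x ^ 2 + 1)) - Real.sin z.1 ^ 2 - (1 + Real.cos (z.1 - k * π))) := by fun_prop
  have hopen : IsOpen {z : ℝ × ℝ | z.1 < (k + 1) * π ∧
      z.2 ^ 2 / (2 * (x ^ 2 + 1)) - Real.sin z.1 ^ 2 - (1 + Real.cos (z.1 - k * π)) < 0} :=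
    (isOpen_lt continuous_fst continuous_const).inter (isOpen_lt hcont continuous_const)
  obtain ⟨δ, hδ, hball⟩ := Metric.isOpen_iff.1 hopen (F x, p x) ⟨hF, by
    simp only [En] at hE; linarith⟩
  have hexp : 0 < Real.exp (2 * x) := Real.exp_pos _
  refine ⟨min δ (N - F m) / Real.exp (2 * x), div_pos (lt_min hδ (by linarith)) hexp, ?_⟩
  intro G q hG hG0 hq0 hq r hr
  rw [lt_div_iff₀ hexp, lt_min_iff] at hq
  rcases le_total r x with hrx | hrx
  · have h1 := (hG.dist h hG0 hr hrx).1
    have h2 : F r ≤ F m := hmax ⟨hr, hrx⟩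
    have h3 := le_abs_self (G r - F r)
    linarith [hq.2]
  · have h1 := hG.dist h hG0 (by linarith : 0 ≤ x) le_rfl
    have hmem : ((G x, q x) : ℝ × ℝ) ∈ Metric.ball (F x, p x) δ := by
      rw [Metric.mem_ball, Prod.dist_eq, Real.dist_eq, Real.dist_eq]
      exact max_lt (by linarith [h1.1, hq.1]) (by linarith [h1.2, hq.1])
    obtain ⟨h2, h3⟩ := hball hmem
    refine (hG.trap hq0 hx k h2 ?_ hrx).trans_le hk
    simp only [En]
    simp only at h3
    linarith

lemma Sol.harmonic {F p : ℝ → ℝ} (h : Sol F p) : IsHarmonicMapSol F := by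
  have hdF : deriv F = fun r => p r / (r ^ 2 + 1) := funext fun r => (h.hF r).deriv
  have hdp : deriv p = fun r => Real.sin (2 * F r) := funext fun r => (h.hp r).deriv
  have hp1 : ContDiff ℝ 1 p := by
    rw [contDiff_one_iff_deriv]
    refine ⟨fun r => (h.hp r).differentiableAt, ?_⟩
    rw [hdp]
    have := h.contF
    fun_prop
  refine ⟨?_, fun r => ?_⟩
  · rw [show (2 : WithTop ℕ∞) = 1 + 1 by norm_num, contDiff_succ_iff_deriv]
    refine ⟨fun r => (h.hF r).differentiableAt, by simp, ?_⟩
    rw [hdF]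
    exact hp1.div (by fun_prop) (fun r => by positivity)
  · rw [hdF]
    have hd : HasDerivAt (fun r : ℝ => r ^ 2 + 1) (2 * r) r := by
      simpa using ((hasDerivAt_id r).pow 2).add_const (1 : ℝ)
    have := ((h.hp r).div hd (by positivity)).deriv
    have h2 : r ^ 2 + 1 ≠ 0 := by positivity
    have h3 : deriv (fun r => p r / (r ^ 2 + 1)) r =
      (Real.sin (2 * F r) * (r ^ 2 + 1) - p r * (2 * r)) / (r ^ 2 + 1) ^ 2 := this
    rw [h3]
    field_simp
    ring

lemma Sol.symm {F p : ℝ → ℝ} (h : Sol F p) (n : ℕ) (h0 : F 0 = n * π / 2) (r : ℝ) :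
    F r + F (-r) = n * π := by
  have h' : Sol (fun r => n * π - F (-r)) (fun r => p (-r)) := by
    constructor
    · intro r
      have := ((h.hF (-r)).scomp r (hasDerivAt_neg r)).const_sub (n * π)
      refine this.congr_deriv ?_
      simp
    · intro r
      have := (h.hp (-r)).scomp r (hasDerivAt_neg r)
      refine this.congr_deriv ?_
      rw [show 2 * (n * π - F (-r)) = n * (2 * π) - 2 * F (-r) by ring,
        Real.sin_nat_mul_two_pi_sub]
      simp
  have := (h.unique h' 0 (by simp [h0]; ring) (by simp)).1
  have := congrFun this r
  linarith

/-- Limit analysis for a bounded positive-energy solution. -/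
lemma Sol.limit {F p : ℝ → ℝ} (h : Sol F p) (hp0 : ∀ r, 0 ≤ r → 0 < p r) {N : ℝ}
    (hN : ∀ r, 0 ≤ r → F r ≤ N) (hE : ∀ r, 0 ≤ r → 0 ≤ En F p r) :
    ∃ k : ℤ, k * π ≤ N ∧ (∀ r, 0 ≤ r → F r ≤ k * π) ∧ Tendsto F atTop (nhds (k * π)) ∧
      Tendsto (En F p) atTop (nhds 0) := by
  have hmono : MonotoneOn F (Set.Ici 0) := by
    refine monotoneOn_of_hasDerivWithinAt_nonneg (convex_Ici 0)
      (fun r _ => (h.hF r).continuousAt.continuousWithinAt)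
      (fun r _ => (h.hF r).hasDerivWithinAt) ?_
    intro r hr
    have := hp0 r (interior_subset hr)
    positivity
  have hmax : ∀ r : ℝ, max r 0 ∈ Set.Ici (0 : ℝ) := fun r => Set.mem_Ici.2 (le_max_right _ _)
  have hev : ∀ f : ℝ → ℝ, (fun r => f (max r 0)) =ᶠ[atTop] f := fun f => by
    filter_upwards [eventually_ge_atTop 0] with r hr
    rw [max_eq_left hr]
  obtain ⟨L, hL⟩ : ∃ L, Tendsto F atTop (nhds L) := by
    have hm : Monotone (fun r => F (max r 0)) := fun a b hab =>
      hmono (hmax a) (hmax b) (max_le_max_right 0 hab)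
    exact ⟨_, (tendsto_atTop_ciSup hm ⟨N, by rintro _ ⟨r, rfl⟩; exact hN _ (hmax r)⟩).congr'
      (hev F)⟩
  obtain ⟨e, he⟩ : ∃ e, Tendsto (En F p) atTop (nhds e) := by
    have hm : Antitone (fun r => En F p (max r 0)) := fun a b hab =>
      h.En_anti (hmax a) (hmax b) (max_le_max_right 0 hab)
    exact ⟨_, (tendsto_atTop_ciInf hm ⟨0, by rintro _ ⟨r, rfl⟩; exact hE _ (hmax r)⟩).congr'
      (hev _)⟩
  have he0 : 0 ≤ e := ge_of_tendsto he (by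
    filter_upwards [eventually_ge_atTop 0] with r hr using hE r hr)
  have hFL : ∀ r, 0 ≤ r → F r ≤ L := fun r hr => ge_of_tendsto hL (by
    filter_upwards [eventually_ge_atTop r] with s hs using hmono hr (hr.trans hs) hs)
  have hLN : L ≤ N := le_of_tendsto hL (by
    filter_upwards [eventually_ge_atTop 0] with r hr using hN r hr)
  have hlim : Tendsto (fun r => En F p r + Real.sin (F r) ^ 2) atTop
      (nhds (e + Real.sin L ^ 2)) :=
    he.add (((Real.continuous_sin.tendsto L).comp hL).pow 2)
  have hl0 : e + Real.sin L ^ 2 ≤ 0 := by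
    by_contra! hpos
    set l := e + Real.sin L ^ 2
    obtain ⟨R, hR⟩ := eventually_atTop.1
      ((hlim.eventually (lt_mem_nhds (half_lt_self hpos))).and (eventually_ge_atTop 0))
    have hR0 : 0 ≤ R := (hR R le_rfl).2
    have hpl : ∀ r, R ≤ r → √l * r ≤ p r := by
      intro r hr
      have h1 := (hR r hr).1
      have h2 : 0 ≤ r := hR0.trans hr
      simp only [En, sub_add_cancel] at h1
      rw [lt_div_iff₀ (by positivity)] at h1
      apply le_of_abs_le
      apply abs_le_of_sq_le_sq _ (hp0 r h2).le
      rw [mul_pow, Real.sq_sqrt hpos.le]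
      nlinarith
    have hd : ∀ r, HasDerivAt (fun r => F r - √l / 2 * Real.log (r ^ 2 + 1))
        (p r / (r ^ 2 + 1) - √l / 2 * (2 * r / (r ^ 2 + 1))) r := by
      intro r
      have hd : HasDerivAt (fun r : ℝ => r ^ 2 + 1) (2 * r) r := by
        simpa using ((hasDerivAt_id r).pow 2).add_const (1 : ℝ)
      exact (h.hF r).sub ((hd.log (by positivity)).const_mul _)
    have hmon : MonotoneOn (fun r => F r - √l / 2 * Real.log (r ^ 2 + 1)) (Set.Ici R) := by
      refine monotoneOn_of_hasDerivWithinAt_nonneg (convex_Ici R)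
        (fun r _ => (hd r).continuousAt.continuousWithinAt)
        (fun r _ => (hd r).hasDerivWithinAt) ?_
      intro r hr
      have h1 := hpl r (interior_subset hr)
      have : p r / (r ^ 2 + 1) - √l / 2 * (2 * r / (r ^ 2 + 1)) = (p r - √l * r) / (r ^ 2 + 1) := by
        ring
      rw [this]
      exact div_nonneg (by linarith) (by positivity)
    have hlog : Tendsto (fun r : ℝ => √l / 2 * Real.log (r ^ 2 + 1)) atTop atTop := by
      refine Tendsto.const_mul_atTop (by positivity) (Real.tendsto_log_atTop.comp ?_)
      exact tendsto_atTop_add_const_right _ _ (tendsto_pow_atTop two_ne_zero)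
    obtain ⟨r, hr1, hr2⟩ := ((hlog.eventually_gt_atTop
      (N - (F R - √l / 2 * Real.log (R ^ 2 + 1)))).and (eventually_ge_atTop R)).exists
    have := hmon (Set.mem_Ici.2 le_rfl) (Set.mem_Ici.2 hr2) hr2
    simp only at this
    linarith [hN r (hR0.trans hr2)]
  have hs : Real.sin L = 0 := by
    have : Real.sin L ^ 2 = 0 := le_antisymm (by linarith) (sq_nonneg _)
    exact pow_eq_zero_iff two_ne_zero |>.1 this
  have he' : e = 0 := by
    rw [hs] at hl0; linarith
  obtain ⟨k, hk⟩ := Real.sin_eq_zero_iff.1 hs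
  subst he'
  exact ⟨k, hk ▸ hLN, hk ▸ hFL, hk ▸ hL, he⟩

theorem stmt5 (n : ℕ) (hn : 1 ≤ n) :
    ∃ Q : ℝ → ℝ, IsHarmonicMapSol Q ∧ Tendsto Q atBot (nhds 0) ∧
      Tendsto Q atTop (nhds ((n : ℝ) * Real.pi)) ∧
      ∀ r : ℝ, Q r + Q (-r) = (n : ℝ) * Real.pi := by
  have hpi := Real.pi_pos
  have hn' : (1 : ℝ) ≤ n := by exact_mod_cast hn
  have hnpi : 0 < (n : ℝ) * π := by positivity
  choose F p hS hF0 hp0 using fun b : ℝ => sol_exists (n * π / 2) b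
  set A : Set ℝ := {b | 0 < b ∧ ∃ r, 0 ≤ r ∧ n * π < F b r} with hA
  have hAne : A.Nonempty := by
    refine ⟨n * π + 2, by positivity, 1, zero_le_one, ?_⟩
    set b := n * π + 2 with hb
    have hd : ∀ r, HasDerivAt (fun r => F b r - (b - 1) / 2 * r)
        (p b r / (r ^ 2 + 1) - (b - 1) / 2 * 1) r :=
      fun r => ((hS b).hF r).sub ((hasDerivAt_id r).const_mul _)
    have hmon : MonotoneOn (fun r => F b r - (b - 1) / 2 * r) (Set.Icc 0 1) := by
      refine monotoneOn_of_hasDerivWithinAt_nonneg (convex_Icc 0 1)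
        (fun r _ => (hd r).continuousAt.continuousWithinAt)
        (fun r _ => (hd r).hasDerivWithinAt) ?_
      intro r hr
      have hr := interior_subset hr
      have h1 := p_bound (hS b).hp r
      rw [hp0, abs_of_nonneg hr.1, abs_le] at h1
      rw [sub_nonneg, mul_one, div_le_div_iff₀ (by positivity) (by positivity)]
      have : r ^ 2 ≤ 1 := by nlinarith [hr.1, hr.2]
      nlinarith [hr.1, hr.2]
    have := hmon ⟨le_rfl, zero_le_one⟩ ⟨zero_le_one, le_rfl⟩ zero_le_one
    simp only [hF0] at this
    linarith
  have hAbdd : BddBelow A := ⟨0, fun b hb => hb.1.le⟩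
  set c := sInf A with hc
  have hc0 : 0 ≤ c := le_csInf hAne fun b hb => hb.1.le
  have claim : ∀ x, 1 ≤ x → ∀ k : ℤ, k + 1 ≤ (n : ℤ) → (∀ r, 0 ≤ r → r ≤ x → F c r < n * π) →
      F c x < (k + 1) * π → 1 + Real.cos (F c x - k * π) ≤ En (F c) (p c) x := by
    intro x hx k hk hlt hFx
    by_contra! hE
    have hk' : ((k : ℝ) + 1) * π ≤ n * π := by
      apply mul_le_mul_of_nonneg_right _ hpi.le
      exact_mod_cast hk
    obtain ⟨ε, hε, hP⟩ := (hS c).perturb hx k hk' hlt hFx hE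
    obtain ⟨b, hb, hbc⟩ := exists_lt_of_csInf_lt hAne (show sInf A < c + ε by linarith)
    have hcb : c ≤ b := csInf_le hAbdd hb
    obtain ⟨hb0, r, hr, hFr⟩ := hb
    have := hP (F b) (p b) (hS b) (by rw [hF0, hF0]) (by rw [hp0]; exact hb0)
      (by rw [hp0, hp0, abs_of_nonneg (by linarith)]; linarith) r hr
    linarith
  have hcpos : 0 < c := by
    rcases hc0.lt_or_eq with h | h
    · exact h
    exfalso
    have hs : Real.sin (2 * (n * π / 2)) = 0 := by
      rw [show 2 * (n * π / 2) = n * π by ring]; exact Real.sin_nat_mul_pi n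
    obtain ⟨h1, h2⟩ := (hS c).unique (sol_const hs) 0 (hF0 c) (by rw [hp0, ← h])
    have hE : En (F c) (p c) 1 ≤ 0 := by simp [En, h1, h2]; positivity
    have hdm : n % 2 + 2 * (n / 2) = n := Nat.mod_add_div n 2
    set m := n / 2 with hm
    have hmod : n % 2 < 2 := Nat.mod_lt _ (by norm_num)
    have hnm : (n : ℝ) = (n % 2 : ℕ) + 2 * m := by exact_mod_cast hdm.symm
    have hcl := claim 1 le_rfl m (by omega) (by
      intro r _ _; rw [h1]; simp only; linarith) (by
      rw [h1]
      have : (n : ℝ) < 2 * (m + 1) := by exact_mod_cast (by omega : n < 2 * (m + 1))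
      push_cast
      nlinarith)
    have hcos : 0 ≤ Real.cos (F c 1 - (m : ℤ) * π) := by
      have h3 : ((n % 2 : ℕ) : ℝ) ≤ 1 := by exact_mod_cast (by omega : n % 2 ≤ 1)
      have h4 : (0 : ℝ) ≤ ((n % 2 : ℕ) : ℝ) := Nat.cast_nonneg _
      have : F c 1 - (m : ℤ) * π = ((n % 2 : ℕ) : ℝ) * (π / 2) := by
        rw [h1]; simp only; push_cast; rw [hnm]; ring
      rw [this]
      apply Real.cos_nonneg_of_neg_pi_div_two_le_of_le <;> nlinarith
    linarith
  have hpc0 : 0 < p c 0 := by rw [hp0]; exact hcpos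
  have hle : ∀ r, 0 ≤ r → F c r ≤ n * π := by
    intro r hr
    by_contra! hgt
    have hexp := Real.exp_pos (2 * r)
    set η := min (c / 2) ((F c r - n * π) / (2 * Real.exp (2 * r))) with hη
    have hη0 : 0 < η := lt_min (by linarith) (div_pos (by linarith) (by positivity))
    have hη1 : η ≤ c / 2 := min_le_left _ _
    have hη2 : η * (2 * Real.exp (2 * r)) ≤ F c r - n * π := by
      rw [← le_div_iff₀ (by positivity)]; exact min_le_right _ _
    have hd := ((hS c).dist (hS (c - η)) (by rw [hF0, hF0]) hr le_rfl).1
    rw [hp0, hp0, show c - (c - η) = η by ring, abs_of_pos hη0] at hd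
    have h3 := le_abs_self (F c r - F (c - η) r)
    have : c ≤ c - η := csInf_le hAbdd ⟨by linarith, r, hr, by nlinarith⟩
    linarith
  have hlt : ∀ r, 0 ≤ r → F c r < n * π := by
    intro r hr
    refine lt_of_le_of_ne (hle r hr) fun heq => ?_
    have hrpos : 0 < r := by
      rcases hr.lt_or_eq with h | h
      · exact h
      · rw [← h, hF0] at heq; linarith
    have hE : 0 ≤ En (F c) (p c) r := by
      simp only [En, heq, Real.sin_nat_mul_pi]; simp; positivity
    have hpp := (hS c).p_pos hpc0 hE hr le_rfl
    have hmax : IsLocalMax (F c) r := by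
      filter_upwards [Ioi_mem_nhds hrpos] with s hs
      rw [heq]; exact hle s (le_of_lt hs)
    have := hmax.hasDerivAt_eq_zero ((hS c).hF r)
    have h2 : 0 < p c r / (r ^ 2 + 1) := by positivity
    linarith
  have hE1 : ∀ r, 1 ≤ r → 0 ≤ En (F c) (p c) r := by
    intro r hr
    set k := ⌊F c r / π⌋ with hk
    have h1 : (k : ℝ) * π ≤ F c r := by
      rw [← le_div_iff₀ hpi]; exact Int.floor_le _
    have h2 : F c r < (k + 1) * π := by
      rw [← div_lt_iff₀ hpi]; exact Int.lt_floor_add_one _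
    have h3 : k < (n : ℤ) := by
      have : (k : ℝ) < n := by
        have := hlt r (by linarith)
        exact lt_of_mul_lt_mul_right (h1.trans_lt this) hpi.le
      exact_mod_cast this
    have := claim r hr k (by omega) (fun s hs _ => hlt s hs) h2
    linarith [Real.neg_one_le_cos (F c r - k * π)]
  have hE : ∀ r, 0 ≤ r → 0 ≤ En (F c) (p c) r := fun r hr =>
    (hE1 (max r 1) (le_max_right _ _)).trans ((hS c).En_anti (Set.mem_Ici.2 hr)
      (Set.mem_Ici.2 (hr.trans (le_max_left _ _))) (le_max_left _ _))
  obtain ⟨k, hkN, hkF, hkT, hkE⟩ := (hS c).limit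
    (fun r hr => (hS c).p_pos hpc0 (hE r hr) hr le_rfl) hle hE
  have hkn : k ≤ (n : ℤ) := by
    have : (k : ℝ) ≤ n := le_of_mul_le_mul_right hkN hpi
    exact_mod_cast this
  have hkeq : k = (n : ℤ) := by
    by_contra hne
    have hk1 : k + 1 ≤ (n : ℤ) := by omega
    have h1 : Tendsto (fun r => 1 + Real.cos (F c r - k * π)) atTop
        (nhds (1 + Real.cos (k * π - k * π))) :=
      ((Real.continuous_cos.tendsto _).comp (hkT.sub_const _)).const_add _
    have := le_of_tendsto_of_tendsto h1 hkE (by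
      filter_upwards [eventually_ge_atTop 1] with r hr
      refine claim r hr k hk1 (fun s hs _ => hlt s hs) ?_
      have := hkF r (by linarith)
      linarith)
    simp at this
    linarith
  have htop : Tendsto (F c) atTop (nhds ((n : ℝ) * π)) := by
    rw [hkeq] at hkT; exact_mod_cast hkT
  have hsymm := (hS c).symm n (hF0 c)
  refine ⟨F c, (hS c).harmonic, ?_, htop, hsymm⟩
  have h1 := (htop.comp tendsto_neg_atBot_atTop).const_sub ((n : ℝ) * π)
  rw [sub_self] at h1
  refine h1.congr fun r => ?_
  have := hsymm r
  simp only [Function.comp]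
  linarith
end

section
/- Fix an integer n ≥ 1. There exists α₀ > 0 such that for every α ∈ (0, α₀) the following holds: if F : ℝ → ℝ is a C² solution of the harmonic map ODE with F(0) = nπ/2 and F'(0) = α, then lim_{r→+∞} F(r) exists and lim_{r→+∞} F(r) < nπ. -/
open Real Filter MeasureTheory

section aux

variable {F G : ℝ → ℝ}

/-- The energy. -/
noncomputable def hmE (F G : ℝ → ℝ) (r : ℝ) : ℝ := (r ^ 2 + 1) * G r ^ 2 / 2 - Real.sin (F r) ^ 2

lemma hmE_deriv (hF : ∀ r, HasDerivAt F (G r) r)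
    (hG : ∀ r, HasDerivAt G ((Real.sin (2 * F r) - 2 * r * G r) / (r ^ 2 + 1)) r) (r : ℝ) :
    HasDerivAt (hmE F G) (-(r * G r ^ 2)) r := by
  have h1 : HasDerivAt (fun r : ℝ => r ^ 2 + 1) (2 * r) r := by
    simpa using (hasDerivAt_pow 2 r).add_const 1
  have h := ((h1.mul ((hG r).pow 2)).div_const 2).sub ((hF r).sin.pow 2)
  have hr : r ^ 2 + 1 ≠ 0 := by positivity
  refine h.congr_deriv ?_
  rw [Real.sin_two_mul]
  simp only [Pi.pow_apply]
  field_simp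
  push_cast
  ring

lemma hmE_anti (hF : ∀ r, HasDerivAt F (G r) r)
    (hG : ∀ r, HasDerivAt G ((Real.sin (2 * F r) - 2 * r * G r) / (r ^ 2 + 1)) r) :
    AntitoneOn (hmE F G) (Set.Ici 0) := by
  apply antitoneOn_of_deriv_nonpos (convex_Ici 0)
  · exact fun x _ => (hmE_deriv hF hG x).continuousAt.continuousWithinAt
  · exact fun x _ => (hmE_deriv hF hG x).differentiableAt.differentiableWithinAt
  · intro x hx
    rw [interior_Ici] at hx
    have hx : 0 < x := hx
    rw [(hmE_deriv hF hG x).deriv]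
    have := mul_nonneg hx.le (sq_nonneg (G x))
    linarith

lemma hm_q_tendsto (hF : ∀ r, HasDerivAt F (G r) r)
    (hG : ∀ r, HasDerivAt G ((Real.sin (2 * F r) - 2 * r * G r) / (r ^ 2 + 1)) r)
    {r1 : ℝ} (hr1 : 0 ≤ r1) (he : hmE F G r1 < 0) :
    ∃ l, Tendsto (hmE F G) atTop (nhds l) ∧
      Tendsto (fun r => hmE F G r + Real.sin (F r) ^ 2) atTop (nhds 0) := by
  have hanti := hmE_anti hF hG
  have hlow : ∀ r, -1 ≤ hmE F G r := by
    intro r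
    have : 0 ≤ (r ^ 2 + 1) * G r ^ 2 / 2 := by positivity
    have := Real.sin_sq_le_one (F r)
    unfold hmE; linarith
  have hneg : ∀ r, r1 ≤ r → hmE F G r < 0 := fun r hr =>
    (hanti hr1 (hr1.trans hr : (0:ℝ) ≤ r) hr).trans_lt he
  obtain ⟨l, hl⟩ : ∃ l, Tendsto (hmE F G) atTop (nhds l) := by
    have ha : Antitone (fun r => hmE F G (max r 0)) := fun a b hab =>
      hanti (le_max_right _ _ : (0:ℝ) ≤ _) (le_max_right _ _ : (0:ℝ) ≤ _) (max_le_max_right 0 hab)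
    refine ⟨_, (tendsto_atTop_ciInf ha ⟨-1, ?_⟩).congr' ?_⟩
    · rintro _ ⟨r, rfl⟩; exact hlow _
    · filter_upwards [eventually_ge_atTop (0:ℝ)] with r hr
      rw [max_eq_left hr]
  refine ⟨l, hl, ?_⟩
  have hk : ∀ r, hmE F G r + Real.sin (F r) ^ 2 = (r ^ 2 + 1) * G r ^ 2 / 2 := by
    intro r; unfold hmE; ring
  have hkd : ∀ r, HasDerivAt (fun r => hmE F G r + Real.sin (F r) ^ 2)
      (-(r * G r ^ 2) + Real.sin (2 * F r) * G r) r := by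
    intro r
    refine ((hmE_deriv hF hG r).add ((hF r).sin.pow 2)).congr_deriv ?_
    rw [Real.sin_two_mul]; simp; ring
  set k : ℝ → ℝ := fun r => hmE F G r + Real.sin (F r) ^ 2 with hkdef
  have hk0 : ∀ r, 0 ≤ k r := fun r => by rw [hkdef]; simp only; rw [hk]; positivity
  have hk1 : ∀ r, r1 ≤ r → k r ≤ 1 := fun r hr => by
    have := hneg r hr
    have := Real.sin_sq_le_one (F r)
    simp only [hkdef]; linarith
  have hGb : ∀ r, r1 ≤ r → 1 ≤ r → |G r| ≤ 2 / r := by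
    intro r h1 h2
    have := hk1 r h1
    simp only [hkdef] at this
    rw [hk] at this
    have hp : 0 < r := by linarith
    rw [le_div_iff₀ hp]
    have : (|G r| * r) ^ 2 ≤ 2 ^ 2 := by
      rw [mul_pow, sq_abs]; nlinarith [sq_nonneg (G r)]
    exact (abs_le_of_sq_le_sq' this (by norm_num)).2
  have hkdb : ∀ r, r1 ≤ r → 1 ≤ r →
      |-(r * G r ^ 2) + Real.sin (2 * F r) * G r| ≤ 6 / r := by
    intro r h1 h2
    have hp : 0 < r := by linarith
    have hg := hGb r h1 h2
    have hs := Real.abs_sin_le_one (2 * F r)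
    have a1 : |-(r * G r ^ 2)| ≤ 4 / r := by
      rw [abs_neg, abs_mul, abs_of_pos hp, abs_pow]
      calc r * |G r| ^ 2 ≤ r * (2 / r) ^ 2 := by gcongr
        _ = 4 / r := by field_simp; norm_num
    have a2 : |Real.sin (2 * F r) * G r| ≤ 2 / r := by
      rw [abs_mul]
      calc _ ≤ 1 * (2 / r) := by gcongr
        _ = _ := one_mul _
    calc _ ≤ 4 / r + 2 / r := (abs_add_le _ _).trans (add_le_add a1 a2)
      _ = 6 / r := by ring
  rw [Metric.tendsto_atTop]
  intro ε hε
  -- lam = 1 + d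
  set d : ℝ := min 1 (ε / 12) with hd
  have hd0 : 0 < d := lt_min one_pos (by positivity)
  have hd1 : d ≤ 1 := min_le_left _ _
  have hd2 : d ≤ ε / 12 := min_le_right _ _
  obtain ⟨N, hN⟩ := Metric.tendsto_atTop.1 hl (d * ε / 16) (by positivity)
  refine ⟨max N (max r1 1), fun r hr => ?_⟩
  have hrN : N ≤ r := (le_max_left _ _).trans hr
  have hrr1 : r1 ≤ r := (le_max_left _ _).trans ((le_max_right _ _).trans hr)
  have hr1' : 1 ≤ r := (le_max_right _ _).trans ((le_max_right _ _).trans hr)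
  have hrp : 0 < r := by linarith
  rw [Real.dist_eq, sub_zero, abs_of_nonneg (hk0 r)]
  by_contra! hcon
  have hlt : r < r + d * r := by nlinarith
  obtain ⟨ξ, ⟨hξ1, hξ2⟩, hξ⟩ := exists_hasDerivAt_eq_slope (hmE F G) (fun r => -(r * G r ^ 2)) hlt
    (fun x _ => (hmE_deriv hF hG x).continuousAt.continuousWithinAt)
    (fun x _ => hmE_deriv hF hG x)
  obtain ⟨η, ⟨hη1, hη2⟩, hη⟩ := exists_hasDerivAt_eq_slope k
    (fun r => -(r * G r ^ 2) + Real.sin (2 * F r) * G r) hξ1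
    (fun x _ => (hkd x).continuousAt.continuousWithinAt)
    (fun x _ => hkd x)
  have hξp : 0 < ξ := by linarith
  have hηp : 0 < η := by linarith
  have hb := hkdb η (by linarith) (by linarith)
  rw [hη] at hb
  have hkξ : ε / 2 ≤ k ξ := by
    have h3 : -(6 / η) ≤ (k ξ - k r) / (ξ - r) := (abs_le.1 hb).1
    have hpos : 0 < ξ - r := by linarith
    rw [le_div_iff₀ hpos] at h3
    have h4 : 6 / η * (ξ - r) ≤ 6 / r * (d * r) := by
      gcongr
      linarith
    have h5 : 6 / r * (d * r) = 6 * d := by field_simp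
    linarith
  have hGξ : ε / 2 / ξ ≤ ξ * G ξ ^ 2 * 1 := by
    have h6 : k ξ = (ξ ^ 2 + 1) * G ξ ^ 2 / 2 := hk ξ
    rw [h6] at hkξ
    rw [div_le_iff₀ hξp]
    have : 1 ≤ ξ ^ 2 := by nlinarith
    nlinarith [mul_le_mul_of_nonneg_right this (sq_nonneg (G ξ))]
  have e1 := hN r hrN
  have e2 := hN (r + d * r) (by linarith)
  rw [Real.dist_eq] at e1 e2
  have e1' := abs_lt.1 e1
  have e2' := abs_lt.1 e2
  have hdr : 0 < d * r := by positivity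
  rw [eq_div_iff (by linarith)] at hξ
  have h7 : d * ε / 4 ≤ (ε / 2 / ξ) * (d * r) := by
    rw [div_mul_eq_mul_div, le_div_iff₀ hξp]
    have : ξ ≤ 2 * r := by nlinarith
    nlinarith [mul_le_mul_of_nonneg_left this (mul_pos hd0 hε).le]
  have h8 : (ε / 2 / ξ) * (d * r) ≤ ξ * G ξ ^ 2 * (d * r) := by
    apply mul_le_mul_of_nonneg_right _ hdr.le
    linarith
  have : 0 < d * ε := by positivity
  linarith

lemma not_const_sin_sq {a b s : ℝ} (hab : a < b)
    (h : ∀ c ∈ Set.Ioo a b, Real.sin c ^ 2 = s) : False := by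
  have h1 : ∀ c ∈ Set.Ioo a b, Real.sin c * Real.cos c = 0 := by
    intro c hc
    have hd : HasDerivAt (fun c => Real.sin c ^ 2) (2 * Real.sin c * Real.cos c) c := by
      refine ((Real.hasDerivAt_sin c).pow 2).congr_deriv ?_
      simp
    have hd' : HasDerivAt (fun c => Real.sin c ^ 2) 0 c := by
      refine (hasDerivAt_const c s).congr_of_eventuallyEq ?_
      filter_upwards [isOpen_Ioo.mem_nhds hc] with x hx using h x hx
    have := hd.unique hd'
    linarith
  obtain ⟨c, hc⟩ := Set.nonempty_Ioo.2 hab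
  have hd : HasDerivAt (fun c => Real.sin c * Real.cos c)
      (Real.cos c * Real.cos c + Real.sin c * (-Real.sin c)) c :=
    (Real.hasDerivAt_sin c).mul (Real.hasDerivAt_cos c)
  have hd' : HasDerivAt (fun c => Real.sin c * Real.cos c) 0 c := by
    refine (hasDerivAt_const c (0:ℝ)).congr_of_eventuallyEq ?_
    filter_upwards [isOpen_Ioo.mem_nhds hc] with x hx using h1 x hx
  have e1 := hd.unique hd'
  have e2 := h1 c hc
  have e3 := Real.sin_sq_add_cos_sq c
  have e4 : Real.sin c ^ 2 = 1 / 2 := by linarith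
  have e5 : Real.cos c ^ 2 = 1 / 2 := by linarith
  have : (Real.sin c * Real.cos c) ^ 2 = 1 / 4 := by rw [mul_pow, e4, e5]; norm_num
  rw [e2] at this; norm_num at this

lemma hm_lt_of_lt (hc : Continuous F) {r1 : ℝ} (hs : ∀ r, r1 ≤ r → Real.sin (F r) ≠ 0)
    (j : ℤ) : (F r1 < j * π → ∀ r, r1 ≤ r → F r < j * π) ∧
      (j * π < F r1 → ∀ r, r1 ≤ r → j * π < F r) := by
  constructor
  · intro h r hr
    by_contra! hcon
    obtain ⟨x, hx, hx2⟩ := intermediate_value_Icc hr hc.continuousOn ⟨h.le, hcon⟩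
    exact hs x hx.1 (by rw [hx2]; exact Real.sin_int_mul_pi j)
  · intro h r hr
    by_contra! hcon
    obtain ⟨x, hx, hx2⟩ := intermediate_value_Icc' hr hc.continuousOn ⟨hcon, h.le⟩
    exact hs x hx.1 (by rw [hx2]; exact Real.sin_int_mul_pi j)

lemma hm_main (hF : ∀ r, HasDerivAt F (G r) r)
    (hG : ∀ r, HasDerivAt G ((Real.sin (2 * F r) - 2 * r * G r) / (r ^ 2 + 1)) r)
    {r1 : ℝ} (hr1 : 0 ≤ r1) (he : hmE F G r1 < 0) (n : ℕ) (hn : F r1 < n * π) :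
    ∃ L : ℝ, Tendsto F atTop (nhds L) ∧ L < n * π := by
  have hc : Continuous F := continuous_iff_continuousAt.2 fun x => (hF x).continuousAt
  have hsq : ∀ r, r1 ≤ r → -hmE F G r1 ≤ Real.sin (F r) ^ 2 := by
    intro r hr
    have h1 := hmE_anti hF hG hr1 (hr1.trans hr : (0:ℝ) ≤ r) hr
    have : 0 ≤ (r ^ 2 + 1) * G r ^ 2 / 2 := by positivity
    have h2 : hmE F G r = (r ^ 2 + 1) * G r ^ 2 / 2 - Real.sin (F r) ^ 2 := rfl
    linarith
  have hs : ∀ r, r1 ≤ r → Real.sin (F r) ≠ 0 := by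
    intro r hr h0
    have := hsq r hr
    rw [h0] at this
    norm_num at this; linarith
  have hup := (hm_lt_of_lt hc hs (n : ℤ)).1 (by exact_mod_cast hn)
  obtain ⟨j, hj⟩ : ∃ j : ℤ, j * π < F r1 := by
    obtain ⟨j, hj⟩ := exists_int_lt (F r1 / π)
    exact ⟨j, by rwa [lt_div_iff₀ Real.pi_pos] at hj⟩
  have hlo := (hm_lt_of_lt hc hs j).2 hj
  obtain ⟨l, hl, hk⟩ := hm_q_tendsto hF hG hr1 he
  have hsin : Tendsto (fun r => Real.sin (F r) ^ 2) atTop (nhds (-l)) := by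
    have := hk.sub hl
    simpa using this
  obtain ⟨L, hL⟩ : ∃ L, Tendsto F atTop (nhds L) := by
    refine tendsto_of_no_upcrossings (s := Set.univ) dense_univ ?_ ?_ ?_
    · rintro a - b - hab ⟨ha, hb⟩
      refine not_const_sin_sq (s := -l) hab fun c hcc => ?_
      have hfr : ∃ᶠ r in atTop, F r = c := by
        rw [frequently_atTop]
        intro R
        obtain ⟨x, hx, hxa⟩ := frequently_atTop.1 ha R
        obtain ⟨y, hy, hyb⟩ := frequently_atTop.1 hb x
        obtain ⟨z, hz, hz2⟩ := intermediate_value_Icc hy hc.continuousOn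
          (⟨by linarith [hcc.1], by linarith [hcc.2]⟩ : c ∈ Set.Icc (F x) (F y))
        exact ⟨z, le_trans hx hz.1, hz2⟩
      by_contra hne
      have := hsin.eventually_ne (Ne.symm hne)
      obtain ⟨z, hz1, hz2⟩ := (hfr.and_eventually this).exists
      exact hz2 (by rw [hz1])
    · exact ⟨n * π, by
        rw [eventually_map]
        filter_upwards [eventually_ge_atTop r1] with r hr
        exact_mod_cast (hup r hr).le⟩
    · exact ⟨j * π, by
        rw [eventually_map]
        filter_upwards [eventually_ge_atTop r1] with r hr
        exact (hlo r hr).le⟩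
  refine ⟨L, hL, lt_of_le_of_ne ?_ ?_⟩
  · refine le_of_tendsto hL ?_
    filter_upwards [eventually_ge_atTop r1] with r hr
    exact_mod_cast (hup r hr).le
  · intro h
    have h1 : Tendsto (fun r => Real.sin (F r) ^ 2) atTop (nhds (Real.sin L ^ 2)) :=
      ((Real.continuous_sin.tendsto L).comp hL).pow 2
    have h2 : -hmE F G r1 ≤ Real.sin L ^ 2 := by
      refine ge_of_tendsto h1 ?_
      filter_upwards [eventually_ge_atTop r1] with r hr using hsq r hr
    rw [h, Real.sin_nat_mul_pi] at h2
    norm_num at h2; linarith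

lemma hm_even (hF : ∀ r, HasDerivAt F (G r) r)
    (hG : ∀ r, HasDerivAt G ((Real.sin (2 * F r) - 2 * r * G r) / (r ^ 2 + 1)) r)
    (h0 : F 0 = 0) (hα : 0 < G 0) (hα1 : G 0 < 1 / 100) :
    hmE F G 2 < 0 ∧ F 2 ≤ 1 / 2 := by
  have hc : Continuous F := continuous_iff_continuousAt.2 fun x => (hF x).continuousAt
  have hb : ∀ r ∈ Set.Icc (0:ℝ) 2, |F r| ≤ 1 / 2 := by
    intro r hr
    have hg := norm_le_gronwallBound_of_norm_deriv_right_le (f := F) (f' := G) (δ := 0) (K := 2)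
      (ε := G 0) (a := 0) (b := 2) hc.continuousOn (fun x _ => (hF x).hasDerivWithinAt)
      (by simp [h0]) ?_ r hr
    · rw [gronwallBound_of_K_ne_0 (by norm_num)] at hg
      simp only [sub_zero, zero_mul, zero_add, Real.norm_eq_abs] at hg
      have h4 : Real.exp (2 * r) ≤ 81 := by
        calc Real.exp (2 * r) ≤ Real.exp ((4:ℕ) * 1) :=
              Real.exp_le_exp.2 (by push_cast; linarith [hr.2])
          _ = Real.exp 1 ^ 4 := Real.exp_nat_mul 1 4
          _ ≤ 3 ^ 4 := by gcongr; exact Real.exp_one_lt_three.le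
          _ = 81 := by norm_num
      nlinarith
    · intro x hx
      have he := hmE_anti hF hG (le_refl (0:ℝ)) hx.1 hx.1
      unfold hmE at he
      rw [h0] at he
      simp only [Real.sin_zero] at he
      have hs : Real.sin (F x) ^ 2 ≤ F x ^ 2 := sq_le_sq.2 Real.abs_sin_le_abs
      rw [Real.norm_eq_abs, Real.norm_eq_abs]
      refine abs_le_of_sq_le_sq ?_ (by positivity)
      have hp : 0 ≤ |F x| * G 0 := by positivity
      have : (2 * |F x| + G 0) ^ 2 = 4 * F x ^ 2 + 4 * (|F x| * G 0) + G 0 ^ 2 := by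
        rw [← sq_abs (F x)]; ring
      rw [this]
      nlinarith [mul_nonneg (sq_nonneg x) (sq_nonneg (G x)), sq_nonneg (F x)]
  have hpoly : ∀ r : ℝ, HasDerivAt (fun r : ℝ => r ^ 2 + 1) (2 * r) r := by
    intro r; simpa using (hasDerivAt_pow 2 r).add_const 1
  have hh : ∀ r, HasDerivAt (fun r => (r ^ 2 + 1) * G r * F r)
      (Real.sin (2 * F r) * F r + (r ^ 2 + 1) * G r ^ 2) r := by
    intro r
    refine (((hpoly r).mul (hG r)).mul (hF r)).congr_deriv ?_
    have hr : r ^ 2 + 1 ≠ 0 := by positivity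
    simp only [Pi.mul_apply]
    field_simp
    ring
  have hsn : ∀ r ∈ Set.Icc (0:ℝ) 2, 0 ≤ Real.sin (2 * F r) * F r := by
    intro r hr
    have := abs_le.1 (hb r hr)
    have hpi := Real.pi_gt_three
    rcases le_total 0 (F r) with h | h
    · exact mul_nonneg (Real.sin_nonneg_of_nonneg_of_le_pi (by linarith) (by linarith)) h
    · exact mul_nonneg_of_nonpos_of_nonpos
        (Real.sin_nonpos_of_nonpos_of_neg_pi_le (by linarith) (by linarith)) h
  have hmono : MonotoneOn (fun r => (r ^ 2 + 1) * G r * F r) (Set.Icc 0 2) := by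
    apply monotoneOn_of_deriv_nonneg (convex_Icc 0 2)
    · exact fun x _ => (hh x).continuousAt.continuousWithinAt
    · exact fun x _ => (hh x).differentiableAt.differentiableWithinAt
    · intro x hx
      have hx := interior_subset hx
      rw [(hh x).deriv]
      have := hsn x hx
      positivity
  have hGF : ∀ r ∈ Set.Icc (0:ℝ) 2, 0 ≤ G r * F r := by
    intro r hr
    have := hmono (⟨le_refl _, by norm_num⟩ : (0:ℝ) ∈ Set.Icc (0:ℝ) 2) hr hr.1
    simp only [h0, mul_zero] at this
    rw [mul_assoc] at this
    exact nonneg_of_mul_nonneg_right this (by positivity)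
  have hsqd : ∀ r, HasDerivAt (fun r => F r ^ 2) (2 * (G r * F r)) r := by
    intro r
    refine ((hF r).pow 2).congr_deriv ?_
    simp; ring
  have hsqm : MonotoneOn (fun r => F r ^ 2) (Set.Icc 0 2) := by
    apply monotoneOn_of_deriv_nonneg (convex_Icc 0 2)
    · exact fun x _ => (hsqd x).continuousAt.continuousWithinAt
    · exact fun x _ => (hsqd x).differentiableAt.differentiableWithinAt
    · intro x hx
      have hx := interior_subset hx
      rw [(hsqd x).deriv]
      have := hGF x hx
      positivity
  have hpos : ∀ r ∈ Set.Ioc (0:ℝ) 2, 0 < F r := by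
    intro r hr
    by_contra! hcon
    have hev : ∀ᶠ x in nhdsWithin (0:ℝ) (Set.Ioi 0), 0 < slope F 0 x :=
      ((hasDerivAt_iff_tendsto_slope.1 (hF 0)).mono_left
        (nhdsWithin_mono _ (fun x hx => ne_of_gt hx))).eventually_const_lt hα
    obtain ⟨x, hx1, hx2⟩ := (hev.and (Ioo_mem_nhdsGT hr.1)).exists
    have hFx : 0 < F x := by
      rw [slope_def_field, h0, sub_zero, sub_zero] at hx1
      have := mul_pos hx1 hx2.1
      rwa [div_mul_cancel₀ _ hx2.1.ne'] at this
    obtain ⟨z, hz, hz2⟩ := intermediate_value_Icc' hx2.2.le hc.continuousOn ⟨hcon, hFx.le⟩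
    have := hsqm (⟨hx2.1.le, by linarith [hx2.2, hr.2]⟩ : x ∈ Set.Icc (0:ℝ) 2)
      (⟨by linarith [hx2.1, hz.1], by linarith [hz.2, hr.2]⟩ : z ∈ Set.Icc (0:ℝ) 2) hz.1
    simp only [hz2] at this
    nlinarith
  have hw : ∀ r, HasDerivAt (fun r => (r ^ 2 + 1) * (r * G r - F r))
      (r * (Real.sin (2 * F r) - 2 * F r)) r := by
    intro r
    refine ((hpoly r).mul (((hasDerivAt_id r).mul (hG r)).sub (hF r))).congr_deriv ?_
    have hr : r ^ 2 + 1 ≠ 0 := by positivity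
    simp only [Pi.mul_apply, Pi.sub_apply, id]
    field_simp
    ring
  have hwa : AntitoneOn (fun r => (r ^ 2 + 1) * (r * G r - F r)) (Set.Icc 0 2) := by
    apply antitoneOn_of_deriv_nonpos (convex_Icc 0 2)
    · exact fun x _ => (hw x).continuousAt.continuousWithinAt
    · exact fun x _ => (hw x).differentiableAt.differentiableWithinAt
    · intro x hx
      rw [interior_Icc] at hx
      rw [(hw x).deriv]
      have h1 := hpos x ⟨hx.1, hx.2.le⟩
      have h2 := Real.sin_le (by linarith : 0 ≤ 2 * F x)
      exact mul_nonpos_of_nonneg_of_nonpos hx.1.le (by linarith)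
  have h2m : (2:ℝ) ∈ Set.Icc (0:ℝ) 2 := ⟨by norm_num, le_refl _⟩
  have hw2 := hwa (⟨le_refl _, by norm_num⟩ : (0:ℝ) ∈ Set.Icc (0:ℝ) 2) h2m (by norm_num)
  simp only [h0] at hw2
  have hF2 := hpos 2 ⟨by norm_num, le_refl _⟩
  have hF2b := (abs_le.1 (hb 2 h2m)).2
  have hG2 : 0 ≤ G 2 := nonneg_of_mul_nonneg_left (hGF 2 h2m) hF2
  have hG2' : 2 * G 2 ≤ F 2 := by linarith
  refine ⟨?_, hF2b⟩
  have hsl := Real.sin_gt_sub_cube hF2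
  have hs2 : 15 / 16 * F 2 ≤ Real.sin (F 2) := by
    have : F 2 ^ 3 ≤ F 2 * (1 / 4) := by
      have h9 : F 2 ^ 2 ≤ (1 / 2) ^ 2 := by gcongr
      nlinarith [mul_le_mul_of_nonneg_left h9 hF2.le]
    linarith
  unfold hmE
  have a1 : (15 / 16 * F 2) ^ 2 ≤ Real.sin (F 2) ^ 2 := by gcongr
  have a2 : (2 * G 2) ^ 2 ≤ F 2 ^ 2 := by gcongr
  have a3 : 0 < F 2 ^ 2 := by positivity
  nlinarith

end aux

theorem stmt6 (n : ℕ) (hn : 1 ≤ n) :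
    ∃ α₀ : ℝ, 0 < α₀ ∧ ∀ α : ℝ, 0 < α → α < α₀ →
      ∀ F : ℝ → ℝ, IsHarmonicMapSol F → F 0 = (n : ℝ) * Real.pi / 2 → deriv F 0 = α →
        ∃ L : ℝ, Tendsto F atTop (nhds L) ∧ L < (n : ℝ) * Real.pi := by
  refine ⟨1 / 100, by norm_num, fun α hα hα1 F hsol hF0 hF1 => ?_⟩
  obtain ⟨hC, hode⟩ := hsol
  have hF : ∀ r, HasDerivAt F (deriv F r) r := fun r =>
    (hC.differentiable (by norm_num) r).hasDerivAt
  have hC1 : ContDiff ℝ 1 (deriv F) := ((contDiff_succ_iff_deriv (n := 1)).1 hC).2.2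
  have hG : ∀ r, HasDerivAt (deriv F)
      ((Real.sin (2 * F r) - 2 * r * deriv F r) / (r ^ 2 + 1)) r := by
    intro r
    refine (hC1.differentiable (by norm_num) r).hasDerivAt.congr_deriv ?_
    have := hode r
    have h1 : (Real.sin (2 * F r) - 2 * r * deriv F r) / (r ^ 2 + 1)
      = Real.sin (2 * F r) / (r ^ 2 + 1) - 2 * r / (r ^ 2 + 1) * deriv F r := by ring
    rw [h1]; linarith
  have hn' : (1:ℝ) ≤ n := by exact_mod_cast hn
  have hpi := Real.pi_gt_three
  rcases Nat.even_or_odd' n with ⟨m, hm | hm⟩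
  · have hnm : (n:ℝ) = 2 * m := by rw [hm]; push_cast; ring
    have hV : ∀ r, HasDerivAt (fun r => F r - m * π) (deriv F r) r := fun r =>
      (hF r).sub_const _
    have hsin2 : ∀ r, Real.sin (2 * (F r - m * π)) = Real.sin (2 * F r) := by
      intro r
      rw [show 2 * (F r - m * π) = 2 * F r - m * (2 * π) by ring, Real.sin_sub_nat_mul_two_pi]
    have hsq : ∀ r, Real.sin (F r - m * π) ^ 2 = Real.sin (F r) ^ 2 := by
      intro r
      rw [Real.sin_sub_nat_mul_pi, mul_pow, ← pow_mul, mul_comm m 2, pow_mul]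
      norm_num
    have hev := hm_even hV (fun r => by simp only [hsin2]; exact hG r)
      (by simp only [hF0, hnm]; ring) (by rw [hF1]; exact hα) (by rw [hF1]; exact hα1)
    refine hm_main hF hG (r1 := 2) (by norm_num) ?_ n ?_
    · have := hev.1
      unfold hmE at this ⊢
      rwa [hsq] at this
    · have := hev.2
      have hm1 : (1:ℝ) ≤ m := by
        have : 1 ≤ m := by omega
        exact_mod_cast this
      rw [hnm]; nlinarith
  · refine hm_main hF hG (r1 := 0) (le_refl _) ?_ n ?_
    · unfold hmE
      rw [hF0, hF1]
      have hnm : (n:ℝ) * π / 2 = π / 2 + m * π := by rw [hm]; push_cast; ring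
      have : Real.sin (n * π / 2) ^ 2 = 1 := by
        rw [hnm, Real.sin_add_nat_mul_pi, mul_pow, ← pow_mul, mul_comm m 2, pow_mul]
        norm_num
      rw [this]; nlinarith
    · rw [hF0]; nlinarith
end

section
/- Fix an integer n ≥ 1. For α > 0 let F(·, α) denote the unique global C² solution of the harmonic map ODE with F(0, α) = nπ/2 and F'(0, α) = α. Then the set A := {α ∈ (0, ∞) : lim_{r→+∞} F(r, α) < nπ} is an open subset of ℝ. -/
open Real Filter MeasureTheory

/-- First-order form of the ODE, with momentum (r²+1) times the derivative. -/
def HMSys (x p : ℝ → ℝ) : Prop :=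
  ∀ r : ℝ, HasDerivAt x (p r / (r ^ 2 + 1)) r ∧ HasDerivAt p (Real.sin (2 * x r)) r

lemma HMSys.of_sol {F : ℝ → ℝ} (hF : IsHarmonicMapSol F) :
    HMSys F (fun r => (r ^ 2 + 1) * deriv F r) := by
  intro r
  obtain ⟨h2, hode⟩ := hF
  have hd : Differentiable ℝ F := h2.differentiable (by norm_num)
  have hd1 : ContDiff ℝ 1 (deriv F) := by
    have : ContDiff ℝ (1 + 1) F := by norm_num; exact h2
    exact (contDiff_succ_iff_deriv.1 this).2.2
  have hd2 : Differentiable ℝ (deriv F) := hd1.differentiable (by norm_num)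
  have hpos : r ^ 2 + 1 ≠ 0 := by positivity
  constructor
  · have := (hd r).hasDerivAt
    refine this.congr_deriv ?_
    simp only
    rw [mul_div_cancel_left₀ _ hpos]
  · have h1 : HasDerivAt (fun r : ℝ => r ^ 2 + 1) (2 * r) r := by
      simpa using (hasDerivAt_pow 2 r).add_const (1 : ℝ)
    have := h1.mul (hd2 r).hasDerivAt
    refine this.congr_deriv ?_
    have h := hode r
    field_simp at h
    linear_combination h

lemma HMSys.deriv_eq {x p : ℝ → ℝ} (h : HMSys x p) :
    deriv x = fun r => p r / (r ^ 2 + 1) := funext fun r => (h r).1.deriv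

lemma hasDerivAt_quad (r : ℝ) : HasDerivAt (fun r : ℝ => r ^ 2 + 1) (2 * r) r := by
  simpa using (hasDerivAt_pow 2 r).add_const (1 : ℝ)

lemma HMSys.cont_x {x p : ℝ → ℝ} (h : HMSys x p) : Continuous x :=
  continuous_iff_continuousAt.2 fun r => (h r).1.continuousAt

lemma HMSys.cont_p {x p : ℝ → ℝ} (h : HMSys x p) : Continuous p :=
  continuous_iff_continuousAt.2 fun r => (h r).2.continuousAt

lemma HMSys.to_sol {x p : ℝ → ℝ} (h : HMSys x p) : IsHarmonicMapSol x := by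
  have hx := h.deriv_eq
  have hdd : ∀ r, HasDerivAt (deriv x)
      ((Real.sin (2 * x r) * (r ^ 2 + 1) - p r * (2 * r)) / (r ^ 2 + 1) ^ 2) r := by
    intro r
    rw [hx]
    exact (h r).2.div (hasDerivAt_quad r) (by positivity)
  have hcx := h.cont_x
  have hcp := h.cont_p
  constructor
  · have : ContDiff ℝ (1 + 1) x := by
      rw [contDiff_succ_iff_deriv]
      refine ⟨fun r => (h r).1.differentiableAt, by simp, ?_⟩
      rw [contDiff_one_iff_deriv]
      refine ⟨fun r => (hdd r).differentiableAt, ?_⟩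
      rw [show deriv (deriv x) = _ from funext fun r => (hdd r).deriv]
      refine Continuous.div (by fun_prop) (by fun_prop) (fun r => by positivity)
    norm_num at this
    exact this
  · intro r
    rw [(hdd r).deriv, hx]
    have hpos : r ^ 2 + 1 ≠ 0 := by positivity
    field_simp
    ring

/-- The energy. -/
noncomputable def HMW (x p : ℝ → ℝ) (r : ℝ) : ℝ := p r ^ 2 / (r ^ 2 + 1) / 2 - Real.sin (x r) ^ 2

lemma HMSys.hasDerivAt_g {x p : ℝ → ℝ} (h : HMSys x p) (r : ℝ) :
    HasDerivAt (fun r => p r ^ 2 / (r ^ 2 + 1))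
      (2 * p r * Real.sin (2 * x r) / (r ^ 2 + 1) - 2 * r * p r ^ 2 / (r ^ 2 + 1) ^ 2) r := by
  have hpos : r ^ 2 + 1 ≠ 0 := by positivity
  have := ((h r).2.pow 2).div (hasDerivAt_quad r) hpos
  refine this.congr_deriv ?_
  simp only [Pi.pow_apply]
  field_simp
  push_cast
  ring

lemma HMSys.hasDerivAt_W {x p : ℝ → ℝ} (h : HMSys x p) (r : ℝ) :
    HasDerivAt (HMW x p) (- (r * p r ^ 2 / (r ^ 2 + 1) ^ 2)) r := by
  have hpos : r ^ 2 + 1 ≠ 0 := by positivity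
  have := ((h.hasDerivAt_g r).div_const 2).sub ((h r).1.sin.pow 2)
  refine this.congr_deriv ?_
  rw [Real.sin_two_mul]
  field_simp
  push_cast
  ring

lemma HMSys.W_anti {x p : ℝ → ℝ} (h : HMSys x p) : AntitoneOn (HMW x p) (Set.Ici 0) := by
  refine antitoneOn_of_hasDerivWithinAt_nonpos (convex_Ici 0)
    (fun r _ => (h.hasDerivAt_W r).continuousAt.continuousWithinAt)
    (fun r _ => (h.hasDerivAt_W r).hasDerivWithinAt) ?_
  intro r hr
  rw [interior_Ici] at hr
  have : 0 < r := hr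
  have : 0 ≤ r * p r ^ 2 / (r ^ 2 + 1) ^ 2 := by positivity
  linarith

lemma HMW_ge (x p : ℝ → ℝ) (r : ℝ) : -1 ≤ HMW x p r := by
  unfold HMW
  have h1 : 0 ≤ p r ^ 2 / (r ^ 2 + 1) / 2 := by positivity
  have h2 := Real.sin_sq_le_one (x r)
  linarith

lemma HMSys.W_tendsto {x p : ℝ → ℝ} (h : HMSys x p) :
    ∃ w, Tendsto (HMW x p) atTop (nhds w) ∧ ∀ r, 0 ≤ r → w ≤ HMW x p r := by
  have hanti : Antitone (fun r => HMW x p (max r 0)) := by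
    intro a b hab
    exact h.W_anti (by simp) (by simp) (max_le_max_right 0 hab)
  have hb : BddBelow (Set.range fun r => HMW x p (max r 0)) :=
    ⟨-1, by rintro _ ⟨r, rfl⟩; exact HMW_ge _ _ _⟩
  have ht := tendsto_atTop_ciInf hanti hb
  refine ⟨_, ht.congr' ?_, ?_⟩
  · filter_upwards [eventually_ge_atTop 0] with r hr
    rw [max_eq_left hr]
  · intro r hr
    have := hanti.le_of_tendsto ht r
    rwa [max_eq_left hr] at this

/-- One-step estimate behind the convergence of the kinetic energy. -/
lemma HMSys.g_step {x p : ℝ → ℝ} (h : HMSys x p) {B : ℝ}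
    (hB : ∀ r, 0 ≤ r → p r ^ 2 / (r ^ 2 + 1) ≤ B) {δ r : ℝ} (hδ : 0 < δ) (hδ1 : δ ≤ 1)
    (hr : 1 ≤ r) :
    p r ^ 2 / (r ^ 2 + 1) ≤ (3 * B + 1) * δ
      + 4 / δ * (HMW x p r - HMW x p ((1 + δ) * r)) := by
  set g : ℝ → ℝ := fun r => p r ^ 2 / (r ^ 2 + 1) with hg
  have hB0 : 0 ≤ B := le_trans (by positivity) (hB 0 le_rfl)
  have hlt : r < (1 + δ) * r := by nlinarith
  obtain ⟨ξ, ⟨hξ1, hξ2⟩, hξ⟩ := exists_hasDerivAt_eq_slope (HMW x p) _ hlt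
    (fun s _ => (h.hasDerivAt_W s).continuousAt.continuousWithinAt)
    (fun s _ => h.hasDerivAt_W s)
  obtain ⟨c, ⟨hc1, hc2⟩, hc⟩ := exists_hasDerivAt_eq_slope g _ hξ1
    (fun s _ => (h.hasDerivAt_g s).continuousAt.continuousWithinAt)
    (fun s _ => h.hasDerivAt_g s)
  have hc0 : 0 < c := by linarith
  have hgc : -((3 * B + 1) / r) ≤ 2 * p c * Real.sin (2 * x c) / (c ^ 2 + 1)
      - 2 * c * p c ^ 2 / (c ^ 2 + 1) ^ 2 := by
    have hb := hB c hc0.le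
    rw [div_le_iff₀ (by positivity)] at hb
    have e1 : -((B + 1) / c) ≤ 2 * p c * Real.sin (2 * x c) / (c ^ 2 + 1) := by
      rw [← neg_div, div_le_div_iff₀ hc0 (by positivity)]
      have hs : (c * Real.sin (2 * x c)) ^ 2 ≤ c ^ 2 := by
        rw [mul_pow]
        have := Real.sin_sq_le_one (2 * x c)
        nlinarith [sq_nonneg c]
      nlinarith [sq_nonneg (p c + c * Real.sin (2 * x c))]
    have e2 : 2 * c * p c ^ 2 / (c ^ 2 + 1) ^ 2 ≤ 2 * B / c := by
      rw [div_le_div_iff₀ (by positivity) hc0]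
      have h1 : 2 * c * p c ^ 2 * c ≤ 2 * c ^ 2 * (B * (c ^ 2 + 1)) := by nlinarith [sq_nonneg c]
      have h2 : 0 ≤ 2 * B * (c ^ 2 + 1) := by positivity
      nlinarith
    have e3 : (3 * B + 1) / c ≤ (3 * B + 1) / r := by gcongr
    have e4 : (3 * B + 1) / c = (B + 1) / c + 2 * B / c := by ring
    linarith
  rw [hc] at hgc
  have hgξ : g r - (3 * B + 1) * δ ≤ g ξ := by
    rw [le_div_iff₀ (by linarith)] at hgc
    have h1 : (3 * B + 1) / r * (ξ - r) ≤ (3 * B + 1) / r * (δ * r) := by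
      gcongr; linarith
    have h2 : (3 * B + 1) / r * (δ * r) = (3 * B + 1) * δ := by field_simp
    linarith
  have hξ0 : 0 < ξ := by linarith
  have hW : g ξ * (δ / 4) ≤ HMW x p r - HMW x p ((1 + δ) * r) := by
    rw [eq_div_iff (by linarith)] at hξ
    have e : HMW x p r - HMW x p ((1 + δ) * r) = g ξ * δ * (ξ * r / (ξ ^ 2 + 1)) := by
      have : HMW x p r - HMW x p ((1 + δ) * r) = ξ * p ξ ^ 2 / (ξ ^ 2 + 1) ^ 2 * (δ * r) := by
        linarith
      rw [this, hg]
      field_simp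
    rw [e]
    have : 1 / 4 ≤ ξ * r / (ξ ^ 2 + 1) := by
      rw [div_le_div_iff₀ (by norm_num) (by positivity)]
      nlinarith
    have hgp : 0 ≤ g ξ * δ := by simp only [hg]; positivity
    nlinarith
  have : g ξ ≤ 4 / δ * (HMW x p r - HMW x p ((1 + δ) * r)) := by
    calc g ξ = 4 / δ * (g ξ * (δ / 4)) := by field_simp
      _ ≤ _ := by gcongr
  change g r ≤ _
  linarith

lemma HMSys.g_tendsto {x p : ℝ → ℝ} (h : HMSys x p) :
    Tendsto (fun r => p r ^ 2 / (r ^ 2 + 1)) atTop (nhds 0) := by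
  obtain ⟨w, hw, hwle⟩ := h.W_tendsto
  set B := 2 * (HMW x p 0 + 1) with hBdef
  have hB : ∀ r, 0 ≤ r → p r ^ 2 / (r ^ 2 + 1) ≤ B := by
    intro r hr
    have h1 := h.W_anti (by simp) (Set.mem_Ici.2 hr) hr
    have h2 := Real.sin_sq_le_one (x r)
    have h3 : HMW x p r = p r ^ 2 / (r ^ 2 + 1) / 2 - Real.sin (x r) ^ 2 := rfl
    rw [hBdef]
    linarith
  have hB0 : 0 ≤ B := le_trans (by positivity) (hB 0 le_rfl)
  rw [Metric.tendsto_atTop']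
  intro ε hε
  set δ := min 1 (ε / (2 * (3 * B + 1))) with hδdef
  have hδ : 0 < δ := by positivity
  have hδ1 : δ ≤ 1 := min_le_left _ _
  have hδ2 : (3 * B + 1) * δ ≤ ε / 2 := by
    have : δ ≤ ε / (2 * (3 * B + 1)) := min_le_right _ _
    rw [le_div_iff₀ (by positivity)] at this
    linarith
  have hev : ∀ᶠ r in atTop, HMW x p r < w + ε * δ / 8 ∧ 1 ≤ r :=
    (hw.eventually (gt_mem_nhds (by linarith [mul_pos hε hδ]))).and (eventually_ge_atTop 1)
  obtain ⟨N, hN⟩ := hev.exists_forall_of_atTop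
  refine ⟨N, fun r hr => ?_⟩
  obtain ⟨h1, h2⟩ := hN r (le_of_lt hr)
  have h3 := hwle ((1 + δ) * r) (by positivity)
  have h4 := h.g_step hB hδ hδ1 h2
  have h5 : 4 / δ * (HMW x p r - HMW x p ((1 + δ) * r)) < 4 / δ * (ε * δ / 8) := by
    gcongr; linarith
  have h6 : 4 / δ * (ε * δ / 8) = ε / 2 := by field_simp; norm_num
  have h7 : 0 ≤ p r ^ 2 / (r ^ 2 + 1) := by positivity
  rw [Real.dist_eq, sub_zero, abs_of_nonneg h7]
  linarith

lemma sin_sq_not_const {a b c : ℝ} (hab : a < b) (h : ∀ y ∈ Set.Ioo a b, Real.sin y ^ 2 = c) :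
    False := by
  have h1 : ∀ y ∈ Set.Ioo a b, Real.sin (2 * y) = 0 := by
    intro y hy
    have e : (fun y => Real.sin y ^ 2) =ᶠ[nhds y] fun _ => c := by
      filter_upwards [isOpen_Ioo.mem_nhds hy] with z hz using h z hz
    have d1 : HasDerivAt (fun y => Real.sin y ^ 2) 0 y :=
      (hasDerivAt_const y c).congr_of_eventuallyEq e
    have d2 := (Real.hasDerivAt_sin y).pow 2
    have := d1.unique d2
    rw [Real.sin_two_mul]
    push_cast at this
    linarith [this]
  have hm : (a + b) / 2 ∈ Set.Ioo a b := ⟨by linarith, by linarith⟩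
  have e : (fun y => Real.sin (2 * y)) =ᶠ[nhds ((a + b) / 2)] fun _ => 0 := by
    filter_upwards [isOpen_Ioo.mem_nhds hm] with z hz using h1 z hz
  have d1 : HasDerivAt (fun y => Real.sin (2 * y)) 0 ((a + b) / 2) :=
    (hasDerivAt_const _ _).congr_of_eventuallyEq e
  have d2 := ((hasDerivAt_id ((a + b) / 2)).const_mul 2).sin
  have h2 := d1.unique d2
  have h3 := h1 _ hm
  have h4 := Real.sin_sq_add_cos_sq (2 * ((a + b) / 2))
  simp only [id] at h2
  have h5 : Real.cos (2 * ((a + b) / 2)) = 0 := by linarith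
  rw [h3, h5] at h4
  norm_num at h4

/-- A continuous function whose squared sine converges is itself convergent. -/
lemma tendsto_of_sin_sq {x : ℝ → ℝ} (hx : Continuous x) {c : ℝ}
    (h : Tendsto (fun r => Real.sin (x r) ^ 2) atTop (nhds c)) :
    ∃ L, Tendsto x atTop (nhds L) := by
  -- boundedness
  obtain ⟨y0, hy0⟩ : ∃ y0 : ℝ, Real.sin y0 ^ 2 ≠ c := by
    by_contra! hh
    exact sin_sq_not_const zero_lt_one (fun y _ => hh y)
  obtain ⟨R, hR⟩ : ∃ R, ∀ r ≥ R, Real.sin (x r) ^ 2 ≠ Real.sin y0 ^ 2 :=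
    (h.eventually_ne hy0.symm).exists_forall_of_atTop
  have hper : ∀ z : ℝ, ∃ y ∈ Set.Ioc z (z + π), Real.sin y ^ 2 = Real.sin y0 ^ 2 := by
    intro z
    obtain ⟨k, hk, -⟩ := existsUnique_add_zsmul_mem_Ioc Real.pi_pos y0 z
    refine ⟨_, hk, ?_⟩
    rw [zsmul_eq_mul, Real.sin_add_int_mul_pi]
    rcases Int.even_or_odd k with hk | hk
    · simp [hk.neg_one_zpow]
    · simp [hk.neg_one_zpow]
  have hivt : ∀ r ≥ R, ∀ y ∈ Set.uIcc (x R) (x r), Real.sin y ^ 2 ≠ Real.sin y0 ^ 2 := by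
    intro r hr y hy
    obtain ⟨s, hs, rfl⟩ := intermediate_value_uIcc (hx.continuousOn (s := Set.uIcc R r)) hy
    rw [Set.uIcc_of_le hr] at hs
    exact hR s hs.1
  have hub : ∀ r ≥ R, x r ≤ x R + π := by
    intro r hr
    by_contra! hlt
    obtain ⟨y, hy, hys⟩ := hper (x R)
    refine hivt r hr y ?_ hys
    rw [Set.uIcc_of_le (by linarith [Real.pi_pos])]
    exact ⟨hy.1.le, by linarith [hy.2]⟩
  have hlb : ∀ r ≥ R, x R - π ≤ x r := by
    intro r hr
    by_contra! hlt
    obtain ⟨y, hy, hys⟩ := hper (x R - π)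
    refine hivt r hr y ?_ hys
    rw [Set.uIcc_of_ge (by linarith [Real.pi_pos])]
    exact ⟨by linarith [hy.1], by linarith [hy.2]⟩
  refine tendsto_of_no_upcrossings dense_univ ?_ ?_ ?_
  · rintro a - b - hab ⟨ha, hb⟩
    refine sin_sq_not_const hab (c := c) fun y hy => ?_
    by_contra hne
    obtain ⟨S, hS⟩ := (h.eventually_ne (Ne.symm hne)).exists_forall_of_atTop
    obtain ⟨r1, hr1, h1⟩ := (frequently_atTop.1 ha) S
    obtain ⟨r2, hr2, h2⟩ := (frequently_atTop.1 hb) S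
    have hmem : y ∈ Set.uIcc (x r1) (x r2) := by
      rw [Set.uIcc_of_le (by linarith)]
      exact ⟨by linarith [hy.1], by linarith [hy.2]⟩
    obtain ⟨s, hs, rfl⟩ := intermediate_value_uIcc (hx.continuousOn (s := Set.uIcc r1 r2)) hmem
    exact hS s (le_trans (le_min hr1 hr2) hs.1) rfl
  · exact ⟨x R + π, eventually_map.2 (by
      filter_upwards [eventually_ge_atTop R] with r hr using hub r hr)⟩
  · exact ⟨x R - π, eventually_map.2 (by
      filter_upwards [eventually_ge_atTop R] with r hr using hlb r hr)⟩

lemma HMSys.x_tendsto {x p : ℝ → ℝ} (h : HMSys x p) : ∃ L, Tendsto x atTop (nhds L) := by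
  obtain ⟨w, hw, -⟩ := h.W_tendsto
  have := (h.g_tendsto.div_const 2).sub hw
  refine tendsto_of_sin_sq h.cont_x (this.congr fun r => ?_)
  unfold HMW
  ring

/-- Potential for the crossing estimate. -/
noncomputable def HMh (y : ℝ) : ℝ := y / 2 - Real.sin (2 * y) / 4

lemma hasDerivAt_HMh (y : ℝ) : HasDerivAt HMh (Real.sin y ^ 2) y := by
  have := ((hasDerivAt_id y).div_const 2).sub
    (((hasDerivAt_id y).const_mul 2).sin.div_const 4)
  refine this.congr_deriv ?_
  simp only [id]
  rw [Real.cos_two_mul, Real.cos_sq']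
  ring

lemma continuous_HMh : Continuous HMh := by unfold HMh; fun_prop

lemma HMh_mono : Monotone HMh :=
  monotone_of_hasDerivAt_nonneg hasDerivAt_HMh (fun y => sq_nonneg _)

lemma HMh_lt {a b : ℝ} (hab : a < b) : HMh a < HMh b := by
  refine lt_of_le_of_ne (HMh_mono hab.le) fun heq => ?_
  refine sin_sq_not_const hab (c := 0) fun y hy => ?_
  have e : HMh =ᶠ[nhds y] fun _ => HMh a := by
    filter_upwards [isOpen_Ioo.mem_nhds hy] with z hz
    exact le_antisymm (heq ▸ HMh_mono hz.2.le) (HMh_mono hz.1.le)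
  exact (hasDerivAt_HMh y).unique ((hasDerivAt_const _ _).congr_of_eventuallyEq e)

/-- If the energy is nonnegative on `(a, b)`, then `W + h(x)` does not increase. -/
lemma HMSys.V_le {x p : ℝ → ℝ} (h : HMSys x p) {a b : ℝ} (ha : 1 ≤ a) (hab : a ≤ b)
    (hW : ∀ r ∈ Set.Ioo a b, 0 ≤ HMW x p r) :
    HMW x p b + HMh (x b) ≤ HMW x p a + HMh (x a) := by
  have hd : ∀ r, HasDerivAt (fun r => HMW x p r + HMh (x r))
      (- (r * p r ^ 2 / (r ^ 2 + 1) ^ 2) + Real.sin (x r) ^ 2 * (p r / (r ^ 2 + 1))) r :=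
    fun r => (h.hasDerivAt_W r).add ((hasDerivAt_HMh (x r)).comp r (h r).1)
  refine antitoneOn_of_hasDerivWithinAt_nonpos (convex_Icc a b)
    (fun r _ => (hd r).continuousAt.continuousWithinAt)
    (fun r _ => (hd r).hasDerivWithinAt) ?_ (Set.left_mem_Icc.2 hab) (Set.right_mem_Icc.2 hab) hab
  intro r hr
  rw [interior_Icc] at hr
  have hr1 : 1 ≤ r := by linarith [hr.1]
  have hw := hW r hr
  unfold HMW at hw
  have key : Real.sin (x r) ^ 2 * p r ≤ r * p r ^ 2 / (r ^ 2 + 1) := by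
    rcases le_or_gt (p r) 0 with hp | hp
    · have h1 : 0 ≤ r * p r ^ 2 / (r ^ 2 + 1) := by positivity
      have h2 : Real.sin (x r) ^ 2 * p r ≤ 0 := mul_nonpos_of_nonneg_of_nonpos (sq_nonneg _) hp
      linarith
    · -- `s = |sin x|`, `p ≥ √2 √(r²+1) s`
      have hs1 := Real.sin_sq_le_one (x r)
      set s := Real.sin (x r) ^ 2 with hs
      have hs0 : 0 ≤ s := sq_nonneg _
      have h1 : s * (2 * (r ^ 2 + 1)) ≤ p r ^ 2 := by
        have : s ≤ p r ^ 2 / (2 * (r ^ 2 + 1)) := by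
          have e : p r ^ 2 / (2 * (r ^ 2 + 1)) = p r ^ 2 / (r ^ 2 + 1) / 2 := by
            rw [mul_comm, div_mul_eq_div_div]
          linarith
        rwa [le_div_iff₀ (by positivity)] at this
      have h2 : s * (r ^ 2 + 1) ≤ r * p r := by
        refine (sq_le_sq₀ (by positivity) (by positivity)).1 ?_
        have e1 : (s * (r ^ 2 + 1)) ^ 2 ≤ s * (r ^ 2 + 1) ^ 2 := by
          have : s ^ 2 ≤ s := by nlinarith
          rw [mul_pow]
          gcongr
        have e2 : s * (r ^ 2 + 1) ^ 2 ≤ r ^ 2 * (s * (2 * (r ^ 2 + 1))) := by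
          have : r ^ 2 + 1 ≤ 2 * r ^ 2 := by nlinarith
          nlinarith [mul_nonneg hs0 (by positivity : 0 ≤ r ^ 2 + 1)]
        have e3 : r ^ 2 * (s * (2 * (r ^ 2 + 1))) ≤ r ^ 2 * p r ^ 2 := by gcongr
        rw [mul_pow r]
        linarith
      rw [le_div_iff₀ (by positivity)]
      nlinarith
  have e : - (r * p r ^ 2 / (r ^ 2 + 1) ^ 2) + Real.sin (x r) ^ 2 * (p r / (r ^ 2 + 1))
      = (Real.sin (x r) ^ 2 * p r - r * p r ^ 2 / (r ^ 2 + 1)) / (r ^ 2 + 1) := by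
    field_simp
    ring
  rw [e]
  exact div_nonpos_of_nonpos_of_nonneg (by linarith) (by positivity)

lemma HMW_ge_neg_sin (x p : ℝ → ℝ) (r : ℝ) : - Real.sin (x r) ^ 2 ≤ HMW x p r := by
  unfold HMW
  have h1 : 0 ≤ p r ^ 2 / (r ^ 2 + 1) / 2 := by positivity
  linarith

/-- Trapping by negative energy. -/
lemma HMSys.trap_neg {x p : ℝ → ℝ} (h : HMSys x p) {m R L : ℝ} (hm : Real.sin m = 0)
    (hR : 0 ≤ R) (hW : HMW x p R < 0) (hx : x R < m) (hL : Tendsto x atTop (nhds L)) :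
    L < m := by
  have hW' : ∀ r ≥ R, HMW x p r ≤ HMW x p R := fun r hr =>
    h.W_anti (Set.mem_Ici.2 hR) (Set.mem_Ici.2 (hR.trans hr)) hr
  have hlt : ∀ r ≥ R, x r < m := by
    intro r hr
    by_contra! hge
    obtain ⟨s, hs, hsm⟩ := intermediate_value_Icc hr h.cont_x.continuousOn
      (⟨hx.le, hge⟩ : m ∈ Set.Icc (x R) (x r))
    have h1 := HMW_ge_neg_sin x p s
    have h2 := hW' s hs.1
    rw [hsm, hm] at h1
    norm_num at h1
    linarith
  have hle : L ≤ m := le_of_tendsto hL (by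
    filter_upwards [eventually_ge_atTop R] with r hr using (hlt r hr).le)
  refine lt_of_le_of_ne hle ?_
  rintro rfl
  have ht : Tendsto (fun r => - Real.sin (x r) ^ 2) atTop (nhds (-Real.sin L ^ 2)) :=
    (((Real.continuous_sin.tendsto L).comp hL).pow 2).neg
  have : -Real.sin L ^ 2 ≤ HMW x p R := le_of_tendsto ht (by
    filter_upwards [eventually_ge_atTop R] with r hr
    exact (HMW_ge_neg_sin x p r).trans (hW' r hr))
  rw [hm] at this
  norm_num at this
  linarith

/-- The open trapping condition. -/
lemma HMSys.trap {x p : ℝ → ℝ} (h : HMSys x p) {m R L : ℝ} (hm : Real.sin m = 0)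
    (hR : 1 ≤ R) (hx : x R < m) (hV : HMW x p R + HMh (x R) < HMh m)
    (hL : Tendsto x atTop (nhds L)) : L < m := by
  by_cases hneg : ∃ r ≥ R, x r < m ∧ HMW x p r < 0
  · obtain ⟨r, hr, hxr, hWr⟩ := hneg
    exact h.trap_neg hm (by linarith) hWr hxr hL
  push Not at hneg
  have hlt : ∀ r ≥ R, x r < m := by
    intro r hr
    by_contra! hge
    set S := {s | s ∈ Set.Icc R r ∧ m ≤ x s} with hS
    have hSc : IsClosed S := isClosed_Icc.inter (isClosed_le continuous_const h.cont_x)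
    have hSne : S.Nonempty := ⟨r, ⟨hr, le_rfl⟩, hge⟩
    have hSb : BddBelow S := ⟨R, fun s hs => hs.1.1⟩
    have hmem := hSc.csInf_mem hSne hSb
    set t := sInf S
    have hbelow : ∀ s ∈ Set.Ioo R t, 0 ≤ HMW x p s := by
      intro s hs
      refine hneg s hs.1.le ?_
      by_contra! hc
      have : t ≤ s := csInf_le hSb ⟨⟨hs.1.le, hs.2.le.trans hmem.1.2⟩, hc⟩
      linarith [hs.2]
    have h1 := h.V_le hR hmem.1.1 hbelow
    have h2 := HMh_mono hmem.2
    obtain ⟨s, hs, hsm⟩ := intermediate_value_Icc hmem.1.1 h.cont_x.continuousOn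
      (⟨hx.le, hmem.2⟩ : m ∈ Set.Icc (x R) (x t))
    have hts : t ≤ s := csInf_le hSb ⟨⟨hs.1, hs.2.trans hmem.1.2⟩, hsm.ge⟩
    have hst : s = t := le_antisymm hs.2 hts
    rw [hst] at hsm
    have h3 := HMW_ge_neg_sin x p t
    rw [hsm, hm] at h3
    norm_num at h3
    linarith
  have hh : HMh L ≤ HMW x p R + HMh (x R) := by
    refine le_of_tendsto ((continuous_HMh.tendsto L).comp hL) ?_
    filter_upwards [eventually_ge_atTop R] with r hr
    have h1 := h.V_le hR hr (fun s hs => hneg s hs.1.le (hlt s hs.1.le))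
    have h2 := hneg r hr (hlt r hr)
    simp only [Function.comp]
    linarith
  by_contra! hc
  linarith [HMh_mono hc]

/-- The vector field of the first-order system. -/
noncomputable def HMv (r : ℝ) (z : ℝ × ℝ) : ℝ × ℝ := (z.2 / (r ^ 2 + 1), Real.sin (2 * z.1))

lemma abs_div_quad_le (y r : ℝ) : |y / (r ^ 2 + 1)| ≤ |y| := by
  rw [abs_div, abs_of_pos (by positivity : 0 < r ^ 2 + 1)]
  exact div_le_self (abs_nonneg _) (by nlinarith [sq_nonneg r])

lemma abs_sin_sub_le (a b : ℝ) : |Real.sin a - Real.sin b| ≤ |a - b| := by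
  have := Real.lipschitzWith_sin.dist_le_mul a b
  simpa [Real.dist_eq] using this

lemma HMv_lip (r : ℝ) : LipschitzWith 2 (HMv r) := by
  refine LipschitzWith.of_dist_le_mul fun z w => ?_
  rw [Prod.dist_eq, max_le_iff, Prod.dist_eq]
  simp only [HMv, Real.dist_eq, NNReal.coe_ofNat]
  constructor
  · rw [← sub_div]
    have h1 := abs_div_quad_le (z.2 - w.2) r
    have h2 := le_max_right |z.1 - w.1| |z.2 - w.2|
    linarith [abs_nonneg (z.2 - w.2)]
  · have h1 := abs_sin_sub_le (2 * z.1) (2 * w.1)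
    rw [← mul_sub, abs_mul, abs_of_pos (by norm_num : (0:ℝ) < 2)] at h1
    have h2 := le_max_left |z.1 - w.1| |z.2 - w.2|
    linarith

lemma exists_on (x0 p0 T : ℝ) (hT : 1 ≤ T) :
    ∃ z : ℝ → ℝ × ℝ, z 0 = (x0, p0) ∧ ∀ t ∈ Set.Ioo (-T) T, HasDerivAt z (HMv t (z t)) t := by
  -- rescaled momentum `q = 2 T p`
  let f : ℝ → ℝ × ℝ → ℝ × ℝ := fun r z =>
    (z.2 / (2 * T) / (r ^ 2 + 1), (2 * T) * Real.sin (2 * z.1))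
  obtain ⟨a, ha⟩ : ∃ a : NNReal, ((a : NNReal) : ℝ) = 2 * T * |p0| + 2 * T ^ 2 :=
    ⟨⟨2 * T * |p0| + 2 * T ^ 2, by positivity⟩, rfl⟩
  obtain ⟨L, hL⟩ : ∃ L : NNReal, ((L : NNReal) : ℝ) = 2 * |p0| + 2 * T :=
    ⟨⟨2 * |p0| + 2 * T, by positivity⟩, rfl⟩
  obtain ⟨K, hK⟩ : ∃ K : NNReal, ((K : NNReal) : ℝ) = 4 * T :=
    ⟨⟨4 * T, by positivity⟩, rfl⟩
  have hT0 : 0 < T := by linarith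
  let t0 : Set.Icc (-T) T := ⟨0, by constructor <;> linarith⟩
  have hPL : IsPicardLindelof f t0 (x0, 2 * T * p0) a 0 L K := by
    constructor
    · intro t _
      refine (LipschitzWith.of_dist_le_mul fun z w => ?_).lipschitzOnWith
      rw [Prod.dist_eq, max_le_iff, Prod.dist_eq]
      simp only [f, Real.dist_eq, hK]
      constructor
      · rw [← sub_div, ← sub_div]
        have h1 := abs_div_quad_le ((z.2 - w.2) / (2 * T)) t
        have h3 : |(z.2 - w.2) / (2 * T)| ≤ |z.2 - w.2| := by
          rw [abs_div, abs_of_pos (by positivity : 0 < 2 * T)]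
          exact div_le_self (abs_nonneg _) (by linarith)
        have h2 := le_max_right |z.1 - w.1| |z.2 - w.2|
        have h4 : 0 ≤ |z.2 - w.2| := abs_nonneg _
        nlinarith
      · have h1 := abs_sin_sub_le (2 * z.1) (2 * w.1)
        rw [← mul_sub, abs_mul, abs_of_pos (by norm_num : (0:ℝ) < 2)] at h1
        have h2 := le_max_left |z.1 - w.1| |z.2 - w.2|
        rw [← mul_sub, abs_mul, abs_of_pos (by positivity : 0 < 2 * T)]
        nlinarith
    · intro z _
      have : Continuous fun t => f t z := by
        simp only [f]
        refine Continuous.prodMk ?_ continuous_const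
        exact continuous_const.div (by fun_prop) (fun r => by positivity)
      exact this.continuousOn
    · intro t _ z hz
      rw [Metric.mem_closedBall, Prod.dist_eq, max_le_iff] at hz
      have hz2 := hz.2
      simp only [Real.dist_eq, ha] at hz2
      rw [Prod.norm_def, max_le_iff]
      simp only [f, hL, Real.norm_eq_abs]
      constructor
      · refine (abs_div_quad_le _ t).trans ?_
        rw [abs_div, abs_of_pos (by positivity : 0 < 2 * T), div_le_iff₀ (by positivity)]
        have h1 : |z.2| ≤ |z.2 - 2 * T * p0| + |2 * T * p0| := by
          have := abs_add_le (z.2 - 2 * T * p0) (2 * T * p0)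
          simpa using this
        rw [abs_mul (2 * T) p0, abs_of_pos (by positivity : 0 < 2 * T)] at h1
        nlinarith
      · rw [abs_mul, abs_of_pos (by positivity : 0 < 2 * T)]
        have := Real.abs_sin_le_one (2 * z.1)
        nlinarith [abs_nonneg p0]
    · simp only [t0, hL, ha]
      simp
      nlinarith
  obtain ⟨y, hy0, hy⟩ := hPL.exists_eq_forall_mem_Icc_hasDerivWithinAt₀
  refine ⟨fun t => ((y t).1, (y t).2 / (2 * T)), ?_, ?_⟩
  · have : y 0 = (x0, 2 * T * p0) := hy0
    simp only [this]
    rw [mul_div_cancel_left₀ _ (by positivity)]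
  · intro t ht
    have h1 := (hy t (Set.Ioo_subset_Icc_self ht)).hasDerivAt (Icc_mem_nhds ht.1 ht.2)
    have h2 := (hasFDerivAt_fst.comp_hasDerivAt t h1).prodMk
      ((hasFDerivAt_snd.comp_hasDerivAt t h1).div_const (2 * T))
    refine h2.congr_deriv ?_
    simp only [f, HMv, ContinuousLinearMap.coe_fst', ContinuousLinearMap.coe_snd']
    rw [mul_div_cancel_left₀ _ (by positivity)]

lemma exists_HMSys (x0 p0 : ℝ) : ∃ x p : ℝ → ℝ, HMSys x p ∧ x 0 = x0 ∧ p 0 = p0 := by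
  have hex : ∀ N : ℕ, ∃ z : ℝ → ℝ × ℝ, z 0 = (x0, p0) ∧
      ∀ t ∈ Set.Ioo (-((N : ℝ) + 1)) ((N : ℝ) + 1), HasDerivAt z (HMv t (z t)) t :=
    fun N => exists_on x0 p0 _ (by linarith [(Nat.cast_nonneg N : (0:ℝ) ≤ N)])
  choose z hz0 hz using hex
  have hagree : ∀ N M : ℕ, N ≤ M → Set.EqOn (z N) (z M) (Set.Ioo (-((N : ℝ) + 1)) ((N : ℝ) + 1)) := by
    intro N M hNM
    have hc : (N : ℝ) ≤ M := by exact_mod_cast hNM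
    have hN : (0:ℝ) ≤ N := Nat.cast_nonneg N
    refine ODE_solution_unique_of_mem_Ioo (v := HMv) (s := fun _ => Set.univ) (K := 2) (t₀ := 0)
      (fun t _ => (HMv_lip t).lipschitzOnWith) ⟨by linarith, by linarith⟩
      (fun t ht => ⟨hz N t ht, trivial⟩)
      (fun t ht => ⟨hz M t ⟨by linarith [ht.1], by linarith [ht.2]⟩, trivial⟩) ?_
    rw [hz0, hz0]
  let y : ℝ → ℝ × ℝ := fun r => z ⌈|r|⌉₊ r
  have hy : ∀ M : ℕ, ∀ r : ℝ, |r| < M → y r = z M r := by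
    intro M r hr
    refine hagree _ _ (Nat.ceil_le.2 hr.le) ?_
    have := Nat.le_ceil |r|
    have h2 := abs_le.1 this
    exact ⟨by linarith [h2.1], by linarith [h2.2]⟩
  have hd : ∀ r, HasDerivAt y (HMv r (y r)) r := by
    intro r
    obtain ⟨M, hM⟩ := exists_nat_gt |r|
    have hev : y =ᶠ[nhds r] z M := by
      filter_upwards [(isOpen_lt continuous_abs continuous_const).mem_nhds hM] with s hs
      exact hy M s hs
    rw [hy M r hM]
    refine HasDerivAt.congr_of_eventuallyEq (hz M r ?_) hev
    have := abs_lt.1 hM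
    exact ⟨by linarith [this.1], by linarith [this.2]⟩
  have hy0 : y 0 = (x0, p0) := by simp only [y]; exact hz0 _
  refine ⟨fun r => (y r).1, fun r => (y r).2, fun r => ⟨?_, ?_⟩, by simp [hy0], by simp [hy0]⟩
  · exact hasFDerivAt_fst.comp_hasDerivAt r (hd r)
  · exact hasFDerivAt_snd.comp_hasDerivAt r (hd r)

lemma HMSys.dist_le {x p x' p' : ℝ → ℝ} (h : HMSys x p) (h' : HMSys x' p') {δ R : ℝ}
    (hR : 0 ≤ R) (hδ : dist (x 0, p 0) (x' 0, p' 0) ≤ δ) :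
    dist (x R, p R) (x' R, p' R) ≤ δ * Real.exp (2 * R) := by
  have d1 : ∀ r, HasDerivAt (fun r => (x r, p r)) (HMv r (x r, p r)) r :=
    fun r => (h r).1.prodMk (h r).2
  have d2 : ∀ r, HasDerivAt (fun r => (x' r, p' r)) (HMv r (x' r, p' r)) r :=
    fun r => (h' r).1.prodMk (h' r).2
  have := dist_le_of_trajectories_ODE (v := HMv) (K := 2) (a := 0) (b := R) HMv_lip
    (fun r _ => (d1 r).continuousAt.continuousWithinAt) (fun r _ => (d1 r).hasDerivWithinAt)
    (fun r _ => (d2 r).continuousAt.continuousWithinAt) (fun r _ => (d2 r).hasDerivWithinAt)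
    hδ R ⟨hR, le_rfl⟩
  simpa using this

theorem stmt7 (n : ℕ) (hn : 1 ≤ n) :
    IsOpen {α : ℝ | 0 < α ∧ ∃ F : ℝ → ℝ, IsHarmonicMapSol F ∧
      F 0 = (n : ℝ) * Real.pi / 2 ∧ deriv F 0 = α ∧
      ∃ L : ℝ, Tendsto F atTop (nhds L) ∧ L < (n : ℝ) * Real.pi} := by
  rw [Metric.isOpen_iff]
  rintro α ⟨hα, F, hF, hF0, hF1, L, hL, hLm⟩
  set m := (n : ℝ) * Real.pi with hmdef
  have hm : Real.sin m = 0 := Real.sin_nat_mul_pi n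
  have h := HMSys.of_sol hF
  set p : ℝ → ℝ := fun r => (r ^ 2 + 1) * deriv F r with hp
  have hp0 : p 0 = α := by simp [hp, hF1]
  -- find a good radius
  have hlim : Tendsto (fun r => HMW F p r + HMh (F r)) atTop
      (nhds (0 / 2 - Real.sin L ^ 2 + HMh L)) :=
    ((h.g_tendsto.div_const 2).sub (((Real.continuous_sin.tendsto L).comp hL).pow 2)).add
      ((continuous_HMh.tendsto L).comp hL)
  have hlt : 0 / 2 - Real.sin L ^ 2 + HMh L < HMh m := by
    have := HMh_lt hLm
    have := sq_nonneg (Real.sin L)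
    linarith
  obtain ⟨R, hR1, hRx, hRV⟩ := ((eventually_ge_atTop (1 : ℝ)).and
    ((hL.eventually (gt_mem_nhds hLm)).and (hlim.eventually (gt_mem_nhds hlt)))).exists
  -- the trapping condition is open
  let U : Set (ℝ × ℝ) := {z | z.1 < m ∧
    z.2 ^ 2 / (R ^ 2 + 1) / 2 - Real.sin z.1 ^ 2 + HMh z.1 < HMh m}
  have hU : IsOpen U := by
    have hc := continuous_HMh
    have h1 : IsOpen {z : ℝ × ℝ | z.1 < m} := isOpen_lt continuous_fst continuous_const
    have h2 : IsOpen {z : ℝ × ℝ |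
        z.2 ^ 2 / (R ^ 2 + 1) / 2 - Real.sin z.1 ^ 2 + HMh z.1 < HMh m} :=
      isOpen_lt (by fun_prop) continuous_const
    exact h1.inter h2
  obtain ⟨η, hη, hball⟩ := Metric.isOpen_iff.1 hU (F R, p R) ⟨hRx, hRV⟩
  refine ⟨min α (η * Real.exp (-(2 * R))), by positivity, ?_⟩
  intro β hβ
  rw [Metric.mem_ball, lt_min_iff, Real.dist_eq] at hβ
  have hβ0 : 0 < β := by
    have := (abs_lt.1 hβ.1).1
    linarith
  obtain ⟨x, q, hs, hx0, hq0⟩ := exists_HMSys (m / 2) β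
  obtain ⟨L', hL'⟩ := hs.x_tendsto
  refine ⟨hβ0, x, hs.to_sol, by rw [hx0], ?_, L', hL', ?_⟩
  · rw [hs.deriv_eq]
    simp [hq0]
  have hd : dist (x 0, q 0) (F 0, p 0) ≤ |β - α| := by
    rw [hx0, hq0, hF0, hp0, Prod.dist_eq]
    simp [Real.dist_eq]
  have hd2 := hs.dist_le h (R := R) (by linarith) hd
  have hd3 : |β - α| * Real.exp (2 * R) < η := by
    calc |β - α| * Real.exp (2 * R) < η * Real.exp (-(2 * R)) * Real.exp (2 * R) := by
          gcongr
          exact hβ.2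
      _ = η := by rw [mul_assoc, ← Real.exp_add]; simp
  obtain ⟨hu1, hu2⟩ := hball (Metric.mem_ball.2 (hd2.trans_lt hd3))
  exact hs.trap hm hR1 hu1 hu2 hL'
end

section
/- Fix an integer n ≥ 1. There exists α₁ > 0 such that for every α > α₁ the following holds: if F : ℝ → ℝ is a C² solution of the harmonic map ODE with F(0) = nπ/2 and F'(0) = α, then lim_{r→+∞} F(r) exists and lim_{r→+∞} F(r) > nπ. -/
open Real Filter MeasureTheory

lemma decr_aux {u u' : ℝ → ℝ} {a b : ℝ} (hab : a ≤ b)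
    (hu : ∀ s ∈ Set.Icc a b, HasDerivAt u (u' s) s) (hn : ∀ s ∈ Set.Icc a b, u' s ≤ 0) :
    u b ≤ u a := by
  have h : AntitoneOn u (Set.Icc a b) := by
    apply antitoneOn_of_deriv_nonpos (convex_Icc a b)
    · exact fun s hs => (hu s hs).continuousAt.continuousWithinAt
    · intro s hs
      exact (hu s (interior_subset hs)).differentiableAt.differentiableWithinAt
    · intro s hs
      rw [(hu s (interior_subset hs)).deriv]
      exact hn s (interior_subset hs)
  exact h (Set.left_mem_Icc.2 hab) (Set.right_mem_Icc.2 hab) hab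

/-- primitive of `sin ^ 2` -/
noncomputable def PP (x : ℝ) : ℝ := x / 2 - Real.sin (2 * x) / 4

lemma PP_hasDeriv (x : ℝ) : HasDerivAt PP (Real.sin x ^ 2) x := by
  have h : HasDerivAt (fun x : ℝ => x / 2 - Real.sin (2 * x) / 4)
      (1 / 2 - (Real.cos (2 * x) * (2 * 1)) / 4) x :=
    ((hasDerivAt_id' x).div_const 2).sub ((((hasDerivAt_id' x).const_mul 2).sin).div_const 4)
  have e : Real.sin x ^ 2 = 1 / 2 - (Real.cos (2 * x) * (2 * 1)) / 4 := by
    rw [Real.cos_two_mul]; nlinarith [Real.sin_sq_add_cos_sq x]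
  rw [e]; exact h

lemma PP_strictMono : StrictMono PP := by
  intro a b hab
  have e : Real.sin (2 * b) - Real.sin (2 * a) = 2 * (Real.sin (b - a) * Real.cos (a + b)) := by
    rw [Real.sin_sub_sin, show (2 * b - 2 * a) / 2 = b - a by ring,
      show (2 * b + 2 * a) / 2 = a + b by ring]; ring
  have h1 : Real.sin (b - a) * Real.cos (a + b) < b - a := by
    have h2 : |Real.sin (b - a)| < |b - a| := Real.abs_sin_lt_abs (by linarith [sub_pos.2 hab] : b - a ≠ 0)
    rw [abs_of_pos (sub_pos.2 hab)] at h2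
    calc _ ≤ |Real.sin (b - a) * Real.cos (a + b)| := le_abs_self _
      _ = |Real.sin (b - a)| * |Real.cos (a + b)| := abs_mul _ _
      _ ≤ |Real.sin (b - a)| * 1 := by gcongr; exact Real.abs_cos_le_one _
      _ < _ := by linarith
  unfold PP
  linarith

lemma tendsto_of_PP {f : ℝ → ℝ} {p : ℝ} (h : Tendsto (fun s => PP (f s)) atTop (nhds p)) :
    ∃ L, Tendsto f atTop (nhds L) := by
  have hc : Continuous PP :=
    continuous_iff_continuousAt.2 fun x => (PP_hasDeriv x).continuousAt
  obtain ⟨x, hx⟩ : ∃ x, PP x = p := by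
    have h1 : PP (2 * p - 1) ≤ p := by
      unfold PP; linarith [Real.neg_one_le_sin (2 * (2 * p - 1))]
    have h2 : p ≤ PP (2 * p + 1) := by
      unfold PP; linarith [Real.sin_le_one (2 * (2 * p + 1))]
    have := intermediate_value_Icc (by linarith : 2 * p - 1 ≤ 2 * p + 1) hc.continuousOn
    obtain ⟨x, -, hx⟩ := this ⟨h1, h2⟩
    exact ⟨x, hx⟩
  refine ⟨x, ?_⟩
  rw [tendsto_order]
  subst hx
  constructor
  · intro a ha
    filter_upwards [h.eventually_const_lt (PP_strictMono ha)] with s hs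
    exact PP_strictMono.lt_iff_lt.1 hs
  · intro a ha
    filter_upwards [h.eventually_lt_const (PP_strictMono ha)] with s hs
    exact PP_strictMono.lt_iff_lt.1 hs

lemma tanh_bound {s : ℝ} (hs : 2 ≤ s) : 3 / 4 ≤ Real.tanh s ∧ Real.tanh s ≤ 1 := by
  have hc := Real.cosh_pos s
  rw [Real.tanh_eq_sinh_div_cosh]
  constructor
  · rw [le_div_iff₀ hc, Real.sinh_eq, Real.cosh_eq]
    have h1 : 3 ≤ Real.exp s := by linarith [Real.add_one_le_exp s]
    have h2 : Real.exp (-s) * Real.exp s = 1 := by rw [← Real.exp_add]; simp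
    have h3 := Real.exp_pos (-s)
    nlinarith
  · rw [div_le_one hc]; exact (Real.sinh_lt_cosh s).le

/-- energy -/
noncomputable def EE (f g : ℝ → ℝ) (s : ℝ) : ℝ := g s ^ 2 / 2 - Real.sin (f s) ^ 2

lemma EE_hasDeriv {f g : ℝ → ℝ} (hf : ∀ s, HasDerivAt f (g s) s)
    (hg : ∀ s, HasDerivAt g (-Real.tanh s * g s + Real.sin (2 * f s)) s) (s : ℝ) :
    HasDerivAt (EE f g) (-Real.tanh s * g s ^ 2) s := by
  have h := (((hg s).pow 2).div_const 2).sub (((hf s).sin).pow 2)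
  refine (h.congr_deriv ?_)
  rw [Real.sin_two_mul]; simp; ring

lemma EE_anti {f g : ℝ → ℝ} (hf : ∀ s, HasDerivAt f (g s) s)
    (hg : ∀ s, HasDerivAt g (-Real.tanh s * g s + Real.sin (2 * f s)) s) {a b : ℝ}
    (ha : 2 ≤ a) (hab : a ≤ b) : EE f g b ≤ EE f g a := by
  refine decr_aux hab (fun s _ => EE_hasDeriv hf hg s) fun s hs => ?_
  have := (tanh_bound (ha.trans hs.1)).1
  nlinarith [sq_nonneg (g s)]

lemma diss {T g S : ℝ} (hT : 3 / 4 ≤ T) (hS : S ^ 2 ≤ 1) (hE : 0 ≤ g ^ 2 / 2 - S ^ 2) :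
    |S ^ 2 * g| ≤ T * g ^ 2 := by
  have h1 : S ^ 2 ≤ 3 / 4 * |g| := by
    refine (sq_le_sq₀ (by positivity) (by positivity)).1 ?_
    rw [mul_pow, sq_abs]
    nlinarith [sq_nonneg S, sq_nonneg g]
  rw [abs_mul, abs_of_nonneg (sq_nonneg S), ← sq_abs g]
  nlinarith [abs_nonneg g]

lemma EP_anti {f g : ℝ → ℝ} (hf : ∀ s, HasDerivAt f (g s) s)
    (hg : ∀ s, HasDerivAt g (-Real.tanh s * g s + Real.sin (2 * f s)) s) {a b : ℝ}
    (ha : 2 ≤ a) (hab : a ≤ b) (hb : 0 ≤ EE f g b) :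
    |PP (f b) - PP (f a)| ≤ EE f g a - EE f g b := by
  have hP : ∀ s, HasDerivAt (fun s => PP (f s)) (Real.sin (f s) ^ 2 * g s) s :=
    fun s => (PP_hasDeriv (f s)).comp s (hf s)
  have key : ∀ s ∈ Set.Icc a b, |Real.sin (f s) ^ 2 * g s| ≤ Real.tanh s * g s ^ 2 := by
    intro s hs
    have h2 := EE_anti hf hg (ha.trans hs.1) hs.2
    exact diss (tanh_bound (ha.trans hs.1)).1 (Real.sin_sq_le_one _) (hb.trans h2)
  have h1 := decr_aux hab (fun s _ => (EE_hasDeriv hf hg s).add (hP s))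
    (fun s hs => by linarith [(abs_le.1 (key s hs)).2])
  have h2 := decr_aux hab (fun s _ => (EE_hasDeriv hf hg s).sub (hP s))
    (fun s hs => by linarith [(abs_le.1 (key s hs)).1])
  simp only [Pi.add_apply, Pi.sub_apply] at h1 h2
  rw [abs_le]; constructor <;> linarith

lemma lim_of_antitoneOn {u : ℝ → ℝ} {m : ℝ} (h : ∀ a b, 2 ≤ a → a ≤ b → u b ≤ u a)
    (hm : ∀ a, 2 ≤ a → m ≤ u a) : ∃ l, Tendsto u atTop (nhds l) := by
  have hanti : Antitone (fun s => u (max 2 s)) := fun a b hab =>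
    h _ _ (le_max_left _ _) (max_le_max_left _ hab)
  have hb : BddBelow (Set.range (fun s => u (max 2 s))) :=
    ⟨m, by rintro _ ⟨s, rfl⟩; exact hm _ (le_max_left _ _)⟩
  refine ⟨_, (tendsto_atTop_ciInf hanti hb).congr' ?_⟩
  filter_upwards [eventually_ge_atTop 2] with s hs
  rw [max_eq_right hs]

lemma caseA {f g : ℝ → ℝ} (hf : ∀ s, HasDerivAt f (g s) s)
    (hg : ∀ s, HasDerivAt g (-Real.tanh s * g s + Real.sin (2 * f s)) s)
    (hE : ∀ s, 2 ≤ s → 0 ≤ EE f g s) : ∃ L, Tendsto f atTop (nhds L) := by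
  obtain ⟨l, hl⟩ := lim_of_antitoneOn (u := EE f g) (m := 0)
    (fun a b ha hab => EE_anti hf hg ha hab) hE
  have hEP := fun a b (ha : 2 ≤ a) (hab : a ≤ b) =>
    abs_le.1 (EP_anti hf hg ha hab (hE b (ha.trans hab)))
  obtain ⟨l', hl'⟩ := lim_of_antitoneOn (u := fun s => EE f g s + PP (f s))
    (m := PP (f 2) - EE f g 2)
    (fun a b ha hab => by linarith [(hEP a b ha hab).2])
    (fun a ha => by linarith [(hEP 2 a le_rfl ha).1, hE a ha])
  apply tendsto_of_PP (p := l' - l)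
  exact (hl'.sub hl).congr fun s => by ring

noncomputable def VV (f g : ℝ → ℝ) (s : ℝ) : ℝ :=
  g s ^ 2 / 2 + Real.cos (f s) ^ 2 - Real.sin (f s) * Real.cos (f s) * g s / 2

lemma VV_hasDeriv {f g : ℝ → ℝ} (hf : ∀ s, HasDerivAt f (g s) s)
    (hg : ∀ s, HasDerivAt g (-Real.tanh s * g s + Real.sin (2 * f s)) s) (s : ℝ) :
    HasDerivAt (VV f g) (-Real.tanh s * g s ^ 2
      - (Real.cos (f s) ^ 2 - Real.sin (f s) ^ 2) * g s ^ 2 / 2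
      + Real.tanh s * (Real.sin (f s) * Real.cos (f s)) * g s / 2
      - Real.sin (f s) ^ 2 * Real.cos (f s) ^ 2) s := by
  have h := ((((hg s).pow 2).div_const 2).add (((hf s).cos).pow 2)).sub
    (((((hf s).sin).mul ((hf s).cos)).mul (hg s)).div_const 2)
  refine (h.congr_deriv ?_)
  rw [Real.sin_two_mul]; simp; ring

lemma alg1 {T g S C : ℝ} (h1 : 3 / 4 ≤ T) (h2 : T ≤ 1) (h : S ^ 2 + C ^ 2 = 1) :
    -T * g ^ 2 - (C ^ 2 - S ^ 2) * g ^ 2 / 2 + T * (S * C) * g / 2 - S ^ 2 * C ^ 2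
      ≤ - (g ^ 2 / 8) - S ^ 2 * C ^ 2 / 2 := by
  have h3 : (S * C) * g * T ≤ (S * C) ^ 2 + g ^ 2 / 4 := by
    have : T ^ 2 * g ^ 2 ≤ 1 * g ^ 2 := by gcongr; nlinarith
    nlinarith [sq_nonneg (S * C - T * g / 2)]
  have h4 : -g ^ 2 ≤ (C ^ 2 - S ^ 2) * g ^ 2 := by nlinarith [mul_nonneg (sq_nonneg C) (sq_nonneg g)]
  have h5 : 3 / 4 * g ^ 2 ≤ T * g ^ 2 := by gcongr
  nlinarith

lemma alg2 {g S C : ℝ} (h : S ^ 2 + C ^ 2 = 1) :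
    C ^ 2 / 2 ≤ g ^ 2 / 2 + C ^ 2 - S * C * g / 2 ∧
      g ^ 2 / 2 + C ^ 2 - S * C * g / 2 ≤ g ^ 2 + 4 * C ^ 2 := by
  have hS : (S * C) ^ 2 ≤ C ^ 2 := by
    rw [mul_pow]; nlinarith [sq_nonneg C, sq_nonneg (C ^ 2)]
  constructor
  · nlinarith [sq_nonneg (S * C - g)]
  · nlinarith [sq_nonneg (S * C + g)]

lemma caseB {f g : ℝ → ℝ} (hf : ∀ s, HasDerivAt f (g s) s)
    (hg : ∀ s, HasDerivAt g (-Real.tanh s * g s + Real.sin (2 * f s)) s)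
    {t : ℝ} (ht : 2 ≤ t) (hE : EE f g t < 0) : ∃ L, Tendsto f atTop (nhds L) := by
  obtain ⟨σ, hσ⟩ : ∃ σ, σ = -EE f g t := ⟨_, rfl⟩
  have hσ0 : 0 < σ := by linarith
  have hS : ∀ s, t ≤ s → σ ≤ Real.sin (f s) ^ 2 := by
    intro s hs
    have := EE_anti hf hg ht hs
    unfold EE at this hσ
    nlinarith [sq_nonneg (g s)]
  have hσ1 : σ ≤ 1 := (hS t le_rfl).trans (Real.sin_sq_le_one _)
  have hdec : ∀ s, t ≤ s → VV f g s * Real.exp (σ / 8 * s) ≤ VV f g t * Real.exp (σ / 8 * t) := by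
    intro b hb
    refine decr_aux hb (fun s _ => (VV_hasDeriv hf hg s).mul
      (((hasDerivAt_id' s).const_mul (σ / 8)).exp)) ?_
    intro s hs
    have hT := tanh_bound (ht.trans hs.1)
    have hsc := Real.sin_sq_add_cos_sq (f s)
    have a1 := alg1 (g := g s) hT.1 hT.2 hsc
    have a2 := (alg2 (g := g s) hsc).2
    have a3 := hS s hs.1
    have a4 : σ * Real.cos (f s) ^ 2 ≤ Real.sin (f s) ^ 2 * Real.cos (f s) ^ 2 := by gcongr
    have a5 : σ * g s ^ 2 ≤ 1 * g s ^ 2 := by gcongr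
    have a6 : σ * VV f g s ≤ σ * (g s ^ 2 + 4 * Real.cos (f s) ^ 2) := by
      unfold VV; gcongr
    have ep := Real.exp_pos (σ / 8 * s)
    rw [mul_one, mul_comm (Real.exp _) (σ / 8), ← mul_assoc (VV f g s), ← add_mul]
    apply mul_nonpos_of_nonpos_of_nonneg _ ep.le
    linarith
  have hcos : Tendsto (fun s => Real.cos (f s) ^ 2) atTop (nhds 0) := by
    have hexp : Tendsto (fun s => 2 * (VV f g t * Real.exp (σ / 8 * t)) * Real.exp (-(σ / 8 * s)))
        atTop (nhds 0) := by
      have h1 : Tendsto (fun s : ℝ => σ / 8 * s) atTop atTop :=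
        tendsto_id.const_mul_atTop (by positivity)
      simpa using (Real.tendsto_exp_neg_atTop_nhds_zero.comp h1).const_mul
        (2 * (VV f g t * Real.exp (σ / 8 * t)))
    refine tendsto_of_tendsto_of_tendsto_of_le_of_le' tendsto_const_nhds hexp
      (Eventually.of_forall fun s => sq_nonneg _) ?_
    filter_upwards [eventually_ge_atTop t] with s hs
    have a1 := hdec s hs
    have a2 := (alg2 (g := g s) (Real.sin_sq_add_cos_sq (f s))).1
    have a3 : Real.cos (f s) ^ 2 ≤ 2 * VV f g s := by unfold VV; linarith
    have ep := Real.exp_pos (-(σ / 8 * s))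
    have a4 : VV f g s = VV f g s * Real.exp (σ / 8 * s) * Real.exp (-(σ / 8 * s)) := by
      rw [mul_assoc, ← Real.exp_add]; simp
    have a5 := mul_le_mul_of_nonneg_right a1 ep.le
    linarith
  -- confinement
  have hcont : Continuous f := continuous_iff_continuousAt.2 fun s => (hf s).continuousAt
  have hne : ∀ s, t ≤ s → ∀ k : ℤ, f s ≠ k * π := by
    intro s hs k hk
    have := hS s hs
    rw [hk, Real.sin_int_mul_pi] at this
    norm_num at this; linarith
  obtain ⟨k, hk⟩ : ∃ k : ℤ, k = ⌊f t / π⌋ := ⟨_, rfl⟩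
  have hk1 : k * π ≤ f t := by
    rw [← le_div_iff₀ Real.pi_pos, hk]; exact Int.floor_le _
  have hk2 : f t ≤ ((k + 1 : ℤ) : ℝ) * π := by
    rw [← div_le_iff₀ Real.pi_pos, hk]; push_cast; exact (Int.lt_floor_add_one _).le
  have hlo : ∀ s, t ≤ s → k * π < f s := by
    intro s hs
    by_contra hcon
    push Not at hcon
    obtain ⟨x, hx, hx'⟩ := intermediate_value_Icc' hs hcont.continuousOn ⟨hcon, hk1⟩
    exact hne x hx.1 k hx'
  have hhi : ∀ s, t ≤ s → f s < ((k + 1 : ℤ) : ℝ) * π := by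
    intro s hs
    by_contra hcon
    push Not at hcon
    obtain ⟨x, hx, hx'⟩ := intermediate_value_Icc hs hcont.continuousOn ⟨hk2, hcon⟩
    exact hne x hx.1 _ hx'
  have hsin2 : ∀ s, Real.sin (f s - (k * π + π / 2)) ^ 2 = Real.cos (f s) ^ 2 := by
    intro s
    rw [show f s - (k * π + π / 2) = (f s - k * π) - π / 2 by ring, Real.sin_sub_pi_div_two,
      neg_sq, Real.cos_sub_int_mul_pi, mul_pow, ← zpow_natCast, zpow_comm]
    simp
  have hsin : Tendsto (fun s => Real.sin (f s - (k * π + π / 2))) atTop (nhds 0) := by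
    have h1 : Tendsto (fun s => √(Real.cos (f s) ^ 2)) atTop (nhds 0) := by
      simpa [Function.comp_def] using (Real.continuous_sqrt.tendsto 0).comp hcos
    rw [tendsto_zero_iff_abs_tendsto_zero]
    refine h1.congr fun s => ?_
    rw [← hsin2, Real.sqrt_sq_eq_abs]; rfl
  refine ⟨k * π + π / 2 + Real.arcsin 0, ?_⟩
  refine (((Real.continuous_arcsin.tendsto 0).comp hsin).const_add (k * π + π / 2)).congr' ?_
  filter_upwards [eventually_ge_atTop t] with s hs
  have h1 := hlo s hs
  have h2 := hhi s hs
  push_cast at h2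
  simp only [Function.comp]
  rw [Real.arcsin_sin (by linarith) (by linarith)]
  ring

lemma lim_exists {f g : ℝ → ℝ} (hf : ∀ s, HasDerivAt f (g s) s)
    (hg : ∀ s, HasDerivAt g (-Real.tanh s * g s + Real.sin (2 * f s)) s) :
    ∃ L, Tendsto f atTop (nhds L) := by
  by_cases h : ∀ s, 2 ≤ s → 0 ≤ EE f g s
  · exact caseA hf hg h
  · push Not at h
    obtain ⟨t, ht, hE⟩ := h
    exact caseB hf hg ht hE

lemma lower {f g : ℝ → ℝ} (hf : ∀ s, HasDerivAt f (g s) s)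
    (hg : ∀ s, HasDerivAt g (-Real.tanh s * g s + Real.sin (2 * f s)) s) {a : ℝ} (ha : 2 ≤ a)
    (m : ℕ) (hE : EE f g a ≤ 2) (hfa : m * π + 9 / 2 < f a) {s : ℝ} (hs : a ≤ s) :
    m * π ≤ f s := by
  by_contra hcon
  push Not at hcon
  have hcont : Continuous f := continuous_iff_continuousAt.2 fun s => (hf s).continuousAt
  obtain ⟨x, hx, hx'⟩ := intermediate_value_Icc' hs hcont.continuousOn
    (show m * π ∈ Set.Icc (f s) (f a) from ⟨hcon.le, by linarith⟩)
  have hEx : 0 ≤ EE f g x := by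
    unfold EE; rw [hx', Real.sin_nat_mul_pi]; nlinarith [sq_nonneg (g x)]
  have h1 := (abs_le.1 (EP_anti hf hg ha hx.1 hEx)).1
  have h2 : PP (f x) = m * π / 2 := by
    unfold PP
    have := Real.sin_nat_mul_pi (2 * m)
    push_cast at this
    rw [hx', ← mul_assoc, this]; ring
  have h3 : f a / 2 - 1 / 4 ≤ PP (f a) := by
    unfold PP; linarith [Real.sin_le_one (2 * f a)]
  linarith

theorem stmt8 (n : ℕ) (hn : 1 ≤ n) :
    ∃ α₁ : ℝ, 0 < α₁ ∧ ∀ α : ℝ, α₁ < α →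
      ∀ F : ℝ → ℝ, IsHarmonicMapSol F → F 0 = (n : ℝ) * Real.pi / 2 → deriv F 0 = α →
        ∃ L : ℝ, Tendsto F atTop (nhds L) ∧ (n : ℝ) * Real.pi < L := by
  have hpi := Real.pi_pos
  refine ⟨2 * ((n + 1 : ℕ) * π) + 10, by positivity, ?_⟩
  rintro α hα F ⟨hF, hode⟩ hF0 hF1
  have hnpi : 0 ≤ ((n + 1 : ℕ) : ℝ) * π := by positivity
  have hα10 : 10 < α := by linarith
  have dF : ∀ r, HasDerivAt F (deriv F r) r :=
    fun r => (hF.differentiable (by norm_num) r).hasDerivAt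
  have hF' : ContDiff ℝ 1 (deriv F) := by
    have : ContDiff ℝ (1 + 1) F := by simpa [one_add_one_eq_two] using hF
    exact (contDiff_succ_iff_deriv.1 this).2.2
  have ddF : ∀ r, HasDerivAt (deriv F) (deriv (deriv F) r) r :=
    fun r => (hF'.differentiable (by norm_num) r).hasDerivAt
  have hode2 : ∀ r, (r ^ 2 + 1) * deriv (deriv F) r + 2 * r * deriv F r = Real.sin (2 * F r) := by
    intro r
    have h1 : r ^ 2 + 1 ≠ 0 := by positivity
    have := hode r
    field_simp at this
    linarith
  have dW : ∀ r, HasDerivAt (fun r => (r ^ 2 + 1) * deriv F r) (Real.sin (2 * F r)) r := by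
    intro r
    have h := (((hasDerivAt_id' r).pow 2).add_const 1).mul (ddF r)
    refine h.congr_deriv ?_
    rw [← hode2]; simp; ring
  have W1 : ∀ r, 0 ≤ r → α - r ≤ (r ^ 2 + 1) * deriv F r := by
    intro b hb
    have := decr_aux hb (fun s _ => ((dW s).neg.sub (hasDerivAt_id' s)))
      (fun s _ => by linarith [Real.neg_one_le_sin (2 * F s)])
    simp [hF1] at this
    linarith
  have W2 : ∀ r, 0 ≤ r → (r ^ 2 + 1) * deriv F r ≤ α + r := by
    intro b hb
    have := decr_aux hb (fun s _ => ((dW s).sub (hasDerivAt_id' s)))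
      (fun s _ => by linarith [Real.sin_le_one (2 * F s)])
    simp [hF1] at this
    linarith
  have hF_1 : F 0 + (α - 1) / 2 ≤ F 1 := by
    have := decr_aux zero_le_one
      (fun s _ => (((hasDerivAt_id' s).const_mul ((α - 1) / 2)).sub (dF s)))
      (fun s hs => by
        have h1 := W1 s hs.1
        have h2 : α - 1 ≤ (s ^ 2 + 1) * deriv F s := by linarith [hs.2]
        have h3 : s ^ 2 ≤ 1 := by nlinarith [hs.1, hs.2]
        have h4 : 0 ≤ deriv F s := by
          by_contra hc; push Not at hc; nlinarith [sq_nonneg s]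
        nlinarith)
    simp at this
    linarith
  have hF_α : F 1 ≤ F α := by
    have := decr_aux (by linarith : (1 : ℝ) ≤ α) (fun s _ => (dF s).neg)
      (fun s hs => by
        have h1 := W1 s (by linarith [hs.1])
        have h2 : 0 ≤ (s ^ 2 + 1) * deriv F s := by linarith [hs.2]
        have := nonneg_of_mul_nonneg_right h2 (by positivity)
        linarith)
    simp at this
    linarith
  -- change of variables
  have hf : ∀ s, HasDerivAt (fun s => F (Real.sinh s)) (Real.cosh s * deriv F (Real.sinh s)) s := by
    intro s
    exact ((dF _).comp s (Real.hasDerivAt_sinh s)).congr_deriv (by ring)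
  have hg : ∀ s, HasDerivAt (fun s => Real.cosh s * deriv F (Real.sinh s))
      (-Real.tanh s * (Real.cosh s * deriv F (Real.sinh s)) + Real.sin (2 * F (Real.sinh s))) s := by
    intro s
    have h := (Real.hasDerivAt_cosh s).mul ((ddF _).comp s (Real.hasDerivAt_sinh s))
    refine h.congr_deriv ?_
    have hc := (Real.cosh_pos s).ne'
    rw [← hode2, Real.tanh_eq_sinh_div_cosh, ← Real.cosh_sq]
    simp only [Function.comp]
    field_simp
    ring
  have hs1 : 2 ≤ Real.arsinh α := by
    rw [← Real.sinh_le_sinh, Real.sinh_arsinh, Real.sinh_eq]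
    have h1 : Real.exp 2 = Real.exp 1 * Real.exp 1 := by rw [← Real.exp_add]; norm_num
    have := Real.exp_one_lt_d9
    have := Real.exp_pos 1
    have := Real.exp_pos (-2)
    nlinarith
  have hE : EE (fun s => F (Real.sinh s)) (fun s => Real.cosh s * deriv F (Real.sinh s))
      (Real.arsinh α) ≤ 2 := by
    unfold EE
    simp only [Real.sinh_arsinh]
    rw [mul_pow, Real.cosh_sq, Real.sinh_arsinh]
    have h1 := W1 α (by linarith)
    have h2 := W2 α (by linarith)
    have h0 : 0 ≤ deriv F α := by
      have h3 : 0 ≤ (α ^ 2 + 1) * deriv F α := by linarith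
      exact nonneg_of_mul_nonneg_right h3 (by positivity)
    have h3 : α * deriv F α ≤ 2 := by
      have : 0 ≤ deriv F α := h0
      have : α * (α * deriv F α) ≤ α * 2 := by nlinarith
      exact le_of_mul_le_mul_left this (by linarith)
    have h4 : (α ^ 2 + 1) * deriv F α * deriv F α ≤ (α + α) * deriv F α := by gcongr
    nlinarith [sq_nonneg (Real.sin (F α))]
  have hlow := fun s => lower hf hg hs1 (n + 1) hE (by
    simp only [Real.sinh_arsinh]
    have : 0 ≤ (n : ℝ) * π := by positivity
    linarith) (s := s)
  obtain ⟨L, hL⟩ := lim_exists hf hg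
  refine ⟨L, ?_, ?_⟩
  · have hat : Tendsto Real.arsinh atTop atTop := Real.sinhOrderIso.symm.tendsto_atTop
    exact (hL.comp hat).congr fun r => by simp
  · have : ((n + 1 : ℕ) : ℝ) * π ≤ L :=
      ge_of_tendsto hL (by filter_upwards [eventually_ge_atTop (Real.arsinh α)] with s hs using hlow s hs)
    push_cast at this
    linarith
end

section
/- Fix an integer n ≥ 1. If F₁ and F₂ are C² solutions of the harmonic map ODE with lim_{r→-∞} F_j(r) = 0 and lim_{r→+∞} F_j(r) = nπ for j = 1, 2, then F₁ = F₂ on all of ℝ. -/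
open Real Filter MeasureTheory

lemma aux_tanh_lt {a b : ℝ} (h : a < b) : Real.tanh a < Real.tanh b := by
  rw [Real.tanh_eq_sinh_div_cosh, Real.tanh_eq_sinh_div_cosh,
    div_lt_div_iff₀ (Real.cosh_pos a) (Real.cosh_pos b)]
  have : 0 < Real.sinh (b - a) := Real.sinh_pos_iff.2 (by linarith)
  rw [Real.sinh_sub] at this
  linarith

lemma aux_anti {s : Set ℝ} (hs : Convex ℝ s) {g g' : ℝ → ℝ}
    (h : ∀ x ∈ s, HasDerivAt g (g' x) x) (h0 : ∀ x ∈ s, g' x ≤ 0) : AntitoneOn g s :=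
  antitoneOn_of_hasDerivWithinAt_nonpos hs (fun x hx => (h x hx).continuousAt.continuousWithinAt)
    (fun x hx => (h x (interior_subset hx)).hasDerivWithinAt)
    (fun x hx => h0 x (interior_subset hx))

lemma aux_mono {s : Set ℝ} (hs : Convex ℝ s) {g g' : ℝ → ℝ}
    (h : ∀ x ∈ s, HasDerivAt g (g' x) x) (h0 : ∀ x ∈ s, 0 ≤ g' x) : MonotoneOn g s :=
  monotoneOn_of_hasDerivWithinAt_nonneg hs (fun x hx => (h x hx).continuousAt.continuousWithinAt)
    (fun x hx => (h x (interior_subset hx)).hasDerivWithinAt)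
    (fun x hx => h0 x (interior_subset hx))

/-- the equation in the variable `x`, `r = sinh x` -/
def AuxSol (f p : ℝ → ℝ) : Prop :=
  (∀ x, HasDerivAt f (p x) x) ∧
    ∀ x, HasDerivAt p (Real.sin (2 * f x) - Real.tanh x * p x) x

lemma aux_transform {F : ℝ → ℝ} (h : IsHarmonicMapSol F) :
    AuxSol (fun x => F (Real.sinh x)) (fun x => deriv F (Real.sinh x) * Real.cosh x) := by
  obtain ⟨hc, he⟩ := h
  have hd : Differentiable ℝ F := hc.differentiable (by norm_num)
  have hd2 : Differentiable ℝ (deriv F) := by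
    have : ContDiff ℝ (1 + 1) F := by
      convert hc using 1
      norm_num
    exact (contDiff_succ_iff_deriv.1 this).2.2.differentiable (by norm_num)
  refine ⟨fun x => ?_, fun x => ?_⟩
  · exact (hd (Real.sinh x)).hasDerivAt.comp x (Real.hasDerivAt_sinh x)
  · have h1 := ((hd2 (Real.sinh x)).hasDerivAt.comp x (Real.hasDerivAt_sinh x)).mul
      (Real.hasDerivAt_cosh x)
    refine h1.congr_deriv ?_
    have h2 := he (Real.sinh x)
    have hcp := Real.cosh_pos x
    have h3 : Real.sinh x ^ 2 + 1 = Real.cosh x ^ 2 := by rw [Real.cosh_sq]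
    rw [h3] at h2
    rw [Real.tanh_eq_sinh_div_cosh]
    simp only [Function.comp]
    field_simp at h2 ⊢
    linear_combination h2

lemma aux_energy {f p : ℝ → ℝ} (h : AuxSol f p) (x : ℝ) :
    HasDerivAt (fun x => p x ^ 2 / 2 - Real.sin (f x) ^ 2) (-(Real.tanh x * p x ^ 2)) x := by
  have h1 := (((h.2 x).pow 2).div_const 2).sub (((h.1 x).sin).pow 2)
  refine h1.congr_deriv ?_
  rw [Real.sin_two_mul]
  push_cast
  ring

lemma aux_tanh_nonneg {x : ℝ} (h : 0 ≤ x) : 0 ≤ Real.tanh x := by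
  rw [Real.tanh_eq_sinh_div_cosh]
  exact div_nonneg (Real.sinh_nonneg_iff.2 h) (Real.cosh_pos x).le

lemma aux_tanh_nonpos {x : ℝ} (h : x ≤ 0) : Real.tanh x ≤ 0 := by
  rw [Real.tanh_eq_sinh_div_cosh]
  exact div_nonpos_of_nonpos_of_nonneg (Real.sinh_nonpos_iff.2 h) (Real.cosh_pos x).le

lemma aux_energy_anti {f p : ℝ → ℝ} (h : AuxSol f p) :
    AntitoneOn (fun x => p x ^ 2 / 2 - Real.sin (f x) ^ 2) (Set.Ici 0) :=
  aux_anti (convex_Ici 0) (fun x _ => aux_energy h x) (fun x hx => by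
    have := mul_nonneg (aux_tanh_nonneg hx) (sq_nonneg (p x))
    linarith)

lemma aux_energy_mono {f p : ℝ → ℝ} (h : AuxSol f p) :
    MonotoneOn (fun x => p x ^ 2 / 2 - Real.sin (f x) ^ 2) (Set.Iic 0) :=
  aux_mono (convex_Iic 0) (fun x _ => aux_energy h x) (fun x hx => by
    have := mul_nonneg (neg_nonneg.2 (aux_tanh_nonpos hx)) (sq_nonneg (p x))
    linarith)

lemma aux_p_bdd {f p : ℝ → ℝ} (h : AuxSol f p) : ∃ C : ℝ, 0 < C ∧ ∀ x, |p x| ≤ C := by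
  refine ⟨p 0 ^ 2 + 3, by positivity, fun x => ?_⟩
  have hE : p x ^ 2 / 2 - Real.sin (f x) ^ 2 ≤ p 0 ^ 2 / 2 - Real.sin (f 0) ^ 2 := by
    rcases le_total 0 x with hx | hx
    · exact aux_energy_anti h (Set.mem_Ici.2 le_rfl) hx hx
    · exact aux_energy_mono h hx (Set.mem_Iic.2 le_rfl) hx
  have h1 := Real.sin_sq_le_one (f x)
  have h2 := sq_nonneg (Real.sin (f 0))
  apply abs_le_of_sq_le_sq _ (by positivity)
  nlinarith [sq_nonneg (p 0), sq_nonneg (p 0 ^ 2)]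

lemma aux_p_tendsto {f p : ℝ → ℝ} (h : AuxSol f p) {l : Filter ℝ} {c : ℝ}
    (hl : ∀ a : ℝ, Tendsto (fun x => x + a) l l)
    (hf : Tendsto f l (nhds c)) : Tendsto p l (nhds 0) := by
  obtain ⟨C, hC, hp⟩ := aux_p_bdd h
  have hlip : ∀ x y, |p y - p x| ≤ (1 + C) * |y - x| := by
    intro x y
    have := Convex.norm_image_sub_le_of_norm_hasDerivWithin_le (f := p)
      (f' := fun x => Real.sin (2 * f x) - Real.tanh x * p x) (C := 1 + C) (s := Set.univ)
      (fun x _ => (h.2 x).hasDerivWithinAt) (fun x _ => ?_) convex_univ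
      (Set.mem_univ x) (Set.mem_univ y)
    · simpa [Real.norm_eq_abs] using this
    · rw [Real.norm_eq_abs]
      refine (abs_sub _ _).trans ?_
      rw [abs_mul]
      have h1 := Real.abs_sin_le_one (2 * f x)
      have h2 := (Real.abs_tanh_lt_one x).le
      have h3 := hp x
      have := mul_le_mul h2 h3 (abs_nonneg _) zero_le_one
      linarith
  rw [Metric.tendsto_nhds]
  intro ε hε
  set d : ℝ := ε / (2 * (1 + C)) with hd
  have hdp : 0 < d := by positivity
  have hdiff : Tendsto (fun x => f (x + d) - f x) l (nhds 0) := by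
    simpa using (hf.comp (hl d)).sub hf
  have hev := (Metric.tendsto_nhds.1 hdiff) (ε / 2 * d) (by positivity)
  filter_upwards [hev] with x hx
  rw [Real.dist_eq, sub_zero] at hx ⊢
  obtain ⟨ξ, hξ, hξe⟩ := exists_hasDerivAt_eq_slope f p (show x < x + d by linarith)
    (fun y _ => (h.1 y).continuousAt.continuousWithinAt) (fun y _ => h.1 y)
  have e1 : f (x + d) - f x = p ξ * d := by
    rw [hξe, add_sub_cancel_left, div_mul_cancel₀ _ hdp.ne']
  rw [e1, abs_mul, abs_of_pos hdp] at hx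
  have h1 : |p ξ| < ε / 2 := lt_of_mul_lt_mul_right hx hdp.le
  have h2 := hlip ξ x
  have h3 : |x - ξ| ≤ d := by
    rw [abs_le]; constructor <;> linarith [hξ.1, hξ.2]
  have h4 : (1 + C) * |x - ξ| ≤ (1 + C) * d := by gcongr
  have h5 : (1 + C) * d = ε / 2 := by rw [hd]; field_simp
  have h6 : |p x| ≤ |p x - p ξ| + |p ξ| := by
    simpa using abs_add_le (p x - p ξ) (p ξ)
  linarith

lemma aux_tt (a : ℝ) : Tendsto (fun x : ℝ => x + a) atTop atTop :=
  tendsto_atTop_add_const_right _ _ tendsto_id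

lemma aux_tb (a : ℝ) : Tendsto (fun x : ℝ => x + a) atBot atBot :=
  tendsto_atBot_add_const_right _ _ tendsto_id

lemma aux_E_nonneg {f p : ℝ → ℝ} (h : AuxSol f p) {n : ℕ}
    (hb : Tendsto f atBot (nhds 0)) (ht : Tendsto f atTop (nhds ((n : ℝ) * Real.pi))) (x : ℝ) :
    0 ≤ p x ^ 2 / 2 - Real.sin (f x) ^ 2 := by
  have ht' : Tendsto (fun x => p x ^ 2 / 2 - Real.sin (f x) ^ 2) atTop (nhds 0) := by
    have := (((aux_p_tendsto h aux_tt ht).pow 2).div_const 2).sub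
      (((Real.continuous_sin.tendsto _).comp ht).pow 2)
    simpa [Function.comp_def] using this
  have hb' : Tendsto (fun x => p x ^ 2 / 2 - Real.sin (f x) ^ 2) atBot (nhds 0) := by
    have := (((aux_p_tendsto h aux_tb hb).pow 2).div_const 2).sub
      (((Real.continuous_sin.tendsto _).comp hb).pow 2)
    simpa [Function.comp_def] using this
  rcases le_total 0 x with hx | hx
  · refine le_of_tendsto ht' ?_
    filter_upwards [eventually_ge_atTop x] with y hy
    exact aux_energy_anti h hx (Set.mem_Ici.2 (hx.trans hy)) hy
  · refine le_of_tendsto hb' ?_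
    filter_upwards [eventually_le_atBot x] with y hy
    exact aux_energy_mono h (Set.mem_Iic.2 (hy.trans hx)) hx hy

lemma aux_p_ne {f p : ℝ → ℝ} (h : AuxSol f p) {n : ℕ} (hn : 1 ≤ n)
    (hb : Tendsto f atBot (nhds 0)) (ht : Tendsto f atTop (nhds ((n : ℝ) * Real.pi))) (x : ℝ) :
    p x ≠ 0 := by
  intro hx
  have hs : Real.sin (f x) ^ 2 = 0 := by
    have := aux_E_nonneg h hb ht x
    rw [hx] at this
    nlinarith [sq_nonneg (Real.sin (f x))]
  have hQ : ∀ y, HasDerivAt (fun y => p y ^ 2 + Real.sin (f y) ^ 2)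
      (6 * Real.sin (f y) * Real.cos (f y) * p y - 2 * Real.tanh y * p y ^ 2) y := by
    intro y
    refine (((h.2 y).pow 2).add (((h.1 y).sin).pow 2)).congr_deriv ?_
    rw [Real.sin_two_mul]
    push_cast
    ring
  have hbd : ∀ y, |6 * Real.sin (f y) * Real.cos (f y) * p y - 2 * Real.tanh y * p y ^ 2| ≤
      5 * (p y ^ 2 + Real.sin (f y) ^ 2) := by
    intro y
    have hc1 := Real.cos_sq_le_one (f y)
    obtain ⟨t1, t2⟩ := abs_lt.1 (Real.abs_tanh_lt_one y)
    have a1 : |Real.sin (f y) * Real.cos (f y) * p y| ≤ (p y ^ 2 + Real.sin (f y) ^ 2) / 2 := by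
      rw [abs_le]
      constructor
      · nlinarith [sq_nonneg (Real.sin (f y) + Real.cos (f y) * p y),
          mul_le_mul_of_nonneg_right hc1 (sq_nonneg (p y))]
      · nlinarith [sq_nonneg (Real.sin (f y) - Real.cos (f y) * p y),
          mul_le_mul_of_nonneg_right hc1 (sq_nonneg (p y))]
    obtain ⟨b1, b2⟩ := abs_le.1 a1
    rw [abs_le]
    constructor
    · nlinarith [sq_nonneg (p y), sq_nonneg (Real.sin (f y)),
        mul_le_mul_of_nonneg_right t2.le (sq_nonneg (p y))]
    · nlinarith [sq_nonneg (p y), sq_nonneg (Real.sin (f y)),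
        mul_le_mul_of_nonneg_right t1.le (sq_nonneg (p y))]
  have hexp : ∀ k y : ℝ, HasDerivAt (fun y => Real.exp (k * y)) (Real.exp (k * y) * k) y := by
    intro k y
    simpa using ((hasDerivAt_id y).const_mul k).exp
  have hA : Antitone (fun y => (p y ^ 2 + Real.sin (f y) ^ 2) * Real.exp (-5 * y)) := by
    refine antitone_of_hasDerivAt_nonpos (fun y => (hQ y).mul (hexp (-5) y)) (fun y => ?_)
    have := (abs_le.1 (hbd y)).2
    have he := Real.exp_pos (-5 * y)
    simp only [Pi.zero_apply]
    nlinarith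
  have hM : Monotone (fun y => (p y ^ 2 + Real.sin (f y) ^ 2) * Real.exp (5 * y)) := by
    refine monotone_of_hasDerivAt_nonneg (fun y => (hQ y).mul (hexp 5 y)) (fun y => ?_)
    have := (abs_le.1 (hbd y)).1
    have he := Real.exp_pos (5 * y)
    simp only [Pi.zero_apply]
    nlinarith
  have hp0 : ∀ y, p y = 0 := by
    intro y
    have hle : p y ^ 2 + Real.sin (f y) ^ 2 ≤ 0 := by
      rcases le_total x y with hy | hy
      · have := hA hy
        simp only [hx, hs] at this
        have he := Real.exp_pos (-5 * y)
        by_contra! hc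
        nlinarith [mul_pos hc he]
      · have := hM hy
        simp only [hx, hs] at this
        have he := Real.exp_pos (5 * y)
        by_contra! hc
        nlinarith [mul_pos hc he]
    have : p y ^ 2 = 0 := by nlinarith [sq_nonneg (p y), sq_nonneg (Real.sin (f y))]
    simpa using this
  have hconst : ∀ y, f y = f 0 := fun y =>
    is_const_of_deriv_eq_zero (fun z => (h.1 z).differentiableAt)
      (fun z => by rw [(h.1 z).deriv, hp0]) y 0
  have e : f = fun _ => f 0 := funext hconst
  rw [e] at hb ht
  have e1 := tendsto_nhds_unique hb tendsto_const_nhds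
  have e2 := tendsto_nhds_unique ht tendsto_const_nhds
  have : (0:ℝ) < n * Real.pi := by
    have : (0:ℝ) < n := by exact_mod_cast hn
    positivity
  linarith

lemma aux_p_pos {f p : ℝ → ℝ} (h : AuxSol f p) {n : ℕ} (hn : 1 ≤ n)
    (hb : Tendsto f atBot (nhds 0)) (ht : Tendsto f atTop (nhds ((n : ℝ) * Real.pi))) (x : ℝ) :
    0 < p x := by
  have hne := aux_p_ne h hn hb ht
  by_contra! hx
  have hpc : Continuous p := continuous_iff_continuousAt.2 fun y => (h.2 y).continuousAt
  have hall : ∀ y, p y ≤ 0 := by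
    intro y
    by_contra! hy
    obtain ⟨z, hz⟩ := mem_range_of_exists_le_of_exists_ge hpc ⟨x, hx⟩ ⟨y, hy.le⟩
    exact hne z hz
  have hanti : Antitone f := antitone_of_hasDerivAt_nonpos h.1 hall
  have h1 : f 0 ≤ 0 := by
    refine ge_of_tendsto hb ?_
    filter_upwards [eventually_le_atBot 0] with y hy using hanti hy
  have h2 : n * Real.pi ≤ f 0 := by
    refine le_of_tendsto ht ?_
    filter_upwards [eventually_ge_atTop 0] with y hy using hanti hy
  have : (0:ℝ) < n * Real.pi := by
    have : (0:ℝ) < n := by exact_mod_cast hn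
    positivity
  linarith

lemma aux_inverse {f p : ℝ → ℝ} (h : AuxSol f p) {n : ℕ} (hn : 1 ≤ n)
    (hb : Tendsto f atBot (nhds 0)) (ht : Tendsto f atTop (nhds ((n : ℝ) * Real.pi))) :
    ∃ X : ℝ → ℝ, (∀ u ∈ Set.Ioo 0 (n * Real.pi), f (X u) = u) ∧
      (∀ x, f x ∈ Set.Ioo 0 (n * Real.pi) ∧ X (f x) = x) ∧
      (∀ u ∈ Set.Ioo 0 (n * Real.pi), HasDerivAt X (p (X u))⁻¹ u) ∧
      Tendsto X (nhdsWithin 0 (Set.Ioi 0)) atBot ∧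
      Tendsto X (nhdsWithin (n * Real.pi) (Set.Iio (n * Real.pi))) atTop := by
  have hp := aux_p_pos h hn hb ht
  have hfc : Continuous f := continuous_iff_continuousAt.2 fun y => (h.1 y).continuousAt
  have hmono : StrictMono f := strictMono_of_deriv_pos fun x => by
    rw [(h.1 x).deriv]; exact hp x
  have hnp : (0:ℝ) < n * Real.pi := by
    have : (0:ℝ) < n := by exact_mod_cast hn
    positivity
  have hmem : ∀ x, f x ∈ Set.Ioo 0 (n * Real.pi) := by
    intro x
    constructor
    · exact (hmono.monotone.le_of_tendsto hb (x - 1)).trans_lt (hmono (by linarith))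
    · exact (hmono (by linarith : x < x + 1)).trans_le (hmono.monotone.ge_of_tendsto ht (x + 1))
  have hsurj : ∀ u ∈ Set.Ioo 0 (n * Real.pi), ∃ x, f x = u := by
    intro u hu
    obtain ⟨a, ha⟩ := (hb.eventually (gt_mem_nhds hu.1)).exists
    obtain ⟨b, hb'⟩ := (ht.eventually (lt_mem_nhds hu.2)).exists
    exact mem_range_of_exists_le_of_exists_ge hfc ⟨a, ha.le⟩ ⟨b, hb'.le⟩
  have hinv : ∀ u ∈ Set.Ioo 0 (n * Real.pi), f (Function.invFun f u) = u := by
    intro u hu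
    exact Function.invFun_eq (hsurj u hu)
  have hX : ∀ x, Function.invFun f (f x) = x :=
    fun x => Function.leftInverse_invFun hmono.injective x
  refine ⟨Function.invFun f, hinv, fun x => ⟨hmem x, hX x⟩, ?_, ?_, ?_⟩
  · intro u hu
    have hnh : Set.Ioo 0 (n * Real.pi) ∈ nhds u := Ioo_mem_nhds hu.1 hu.2
    have hsm : StrictMonoOn (Function.invFun f) (Set.Ioo 0 (n * Real.pi)) := by
      intro a ha b hb hab
      rw [← hmono.lt_iff_lt, hinv a ha, hinv b hb]
      exact hab
    have hc : ContinuousAt (Function.invFun f) u := by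
      refine hsm.continuousAt_of_image_mem_nhds hnh ?_
      have : Function.invFun f '' Set.Ioo 0 (n * Real.pi) = Set.univ := by
        refine Set.eq_univ_of_forall fun x => ⟨f x, hmem x, hX x⟩
      rw [this]
      exact univ_mem
    exact HasDerivAt.of_local_left_inverse hc (h.1 _) (hp _).ne'
      (by filter_upwards [hnh] with y hy using hinv y hy)
  · rw [tendsto_atBot]
    intro M
    filter_upwards [Ioo_mem_nhdsGT (hmem M).1] with u hu
    rw [← hmono.le_iff_le, hinv u ⟨hu.1, hu.2.trans (hmem M).2⟩]
    exact hu.2.le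
  · rw [tendsto_atTop]
    intro M
    filter_upwards [Ioo_mem_nhdsLT (hmem M).2] with u hu
    rw [← hmono.le_iff_le, hinv u ⟨(hmem M).1.trans hu.1, hu.2⟩]
    exact hu.1.le

lemma aux_tanh_prod (a b : ℝ) : 0 ≤ (a - b) * (Real.tanh a - Real.tanh b) := by
  rcases lt_trichotomy a b with h | h | h
  · have := aux_tanh_lt h
    nlinarith
  · simp [h]
  · have := aux_tanh_lt h
    nlinarith

lemma aux_tanh_prod_pos {a b : ℝ} (h : a ≠ b) : 0 < (a - b) * (Real.tanh a - Real.tanh b) := by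
  rcases lt_or_gt_of_ne h with h | h
  · have := aux_tanh_lt h
    nlinarith
  · have := aux_tanh_lt h
    nlinarith

/-- Sign propagation for `m' + a m ≤ 0`. -/
lemma aux_sign {L : ℝ} {a m m' : ℝ → ℝ} (ha : ContinuousOn a (Set.Ioo 0 L))
    (hm : ∀ u ∈ Set.Ioo 0 L, HasDerivAt m (m' u) u)
    (hle : ∀ u ∈ Set.Ioo 0 L, m' u + a u * m u ≤ 0) :
    ∃ w : ℝ → ℝ, (∀ u, 0 < w u) ∧ AntitoneOn (fun u => w u * m u) (Set.Ioo 0 L) := by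
  refine ⟨fun u => Real.exp (∫ s in (L / 2)..u, a s), fun u => Real.exp_pos _, ?_⟩
  have hA : ∀ u ∈ Set.Ioo 0 L, HasDerivAt (fun u => ∫ s in (L / 2)..u, a s) (a u) u := by
    intro u hu
    have hmid : L / 2 ∈ Set.Ioo 0 L := by
      have := hu.1.trans hu.2
      constructor <;> linarith
    refine intervalIntegral.integral_hasDerivAt_right ?_ ?_ ?_
    · refine ContinuousOn.intervalIntegrable (ha.mono ?_)
      exact Set.OrdConnected.uIcc_subset Set.ordConnected_Ioo hmid hu
    · exact ha.stronglyMeasurableAtFilter isOpen_Ioo u hu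
    · exact ha.continuousAt (Ioo_mem_nhds hu.1 hu.2)
  refine aux_anti (convex_Ioo 0 L) (fun u hu => ((hA u hu).exp).mul (hm u hu)) ?_
  intro u hu
  have := hle u hu
  have he := Real.exp_pos (∫ s in (L / 2)..u, a s)
  nlinarith

theorem stmt9 (n : ℕ) (hn : 1 ≤ n) (F₁ F₂ : ℝ → ℝ)
    (h1 : IsHarmonicMapSol F₁) (h2 : IsHarmonicMapSol F₂)
    (hb1 : Tendsto F₁ atBot (nhds 0))
    (ht1 : Tendsto F₁ atTop (nhds ((n : ℝ) * Real.pi)))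
    (hb2 : Tendsto F₂ atBot (nhds 0))
    (ht2 : Tendsto F₂ atTop (nhds ((n : ℝ) * Real.pi))) :
    F₁ = F₂ := by
  have hst : Tendsto Real.sinh atTop atTop := Real.sinhOrderIso.tendsto_atTop
  have hsb : Tendsto Real.sinh atBot atBot := Real.sinhOrderIso.tendsto_atBot
  have k1 := aux_transform h1
  have k2 := aux_transform h2
  have kb1 : Tendsto (fun x => F₁ (Real.sinh x)) atBot (nhds 0) := hb1.comp hsb
  have kb2 : Tendsto (fun x => F₂ (Real.sinh x)) atBot (nhds 0) := hb2.comp hsb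
  have kt1 : Tendsto (fun x => F₁ (Real.sinh x)) atTop (nhds (n * Real.pi)) := ht1.comp hst
  have kt2 : Tendsto (fun x => F₂ (Real.sinh x)) atTop (nhds (n * Real.pi)) := ht2.comp hst
  suffices H : ∀ x, F₁ (Real.sinh x) = F₂ (Real.sinh x) by
    funext r
    simpa using H (Real.arsinh r)
  generalize (fun x => deriv F₁ (Real.sinh x) * Real.cosh x) = p1 at k1
  generalize (fun x => deriv F₂ (Real.sinh x) * Real.cosh x) = p2 at k2
  set f1 := fun x => F₁ (Real.sinh x) with hf1
  set f2 := fun x => F₂ (Real.sinh x) with hf2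
  change ∀ x, f1 x = f2 x
  clear_value f1 f2
  have P1 := aux_p_pos k1 hn kb1 kt1
  have P2 := aux_p_pos k2 hn kb2 kt2
  obtain ⟨X1, i1, j1, d1, lb1, lt1⟩ := aux_inverse k1 hn kb1 kt1
  obtain ⟨X2, i2, j2, d2, lb2, lt2⟩ := aux_inverse k2 hn kb2 kt2
  have hnp : (0:ℝ) < n * Real.pi := by
    have : (0:ℝ) < n := by exact_mod_cast hn
    positivity
  set L : ℝ := n * Real.pi with hL
  suffices H : ∀ u ∈ Set.Ioo 0 L, X1 u = X2 u by
    intro x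
    have e1 := H (f1 x) (j1 x).1
    rw [(j1 x).2] at e1
    have e2 := i2 (f1 x) (j1 x).1
    rw [← e1] at e2
    exact e2.symm
  set d : ℝ → ℝ := fun u => p1 (X1 u) - p2 (X2 u) with hd
  set T : ℝ → ℝ := fun u => Real.tanh (X1 u) - Real.tanh (X2 u) with hT
  set a : ℝ → ℝ := fun u => Real.sin (2 * u) / (p1 (X1 u) * p2 (X2 u)) with ha
  have c1 : ∀ u ∈ Set.Ioo 0 L, HasDerivAt (fun u => p1 (X1 u))
      ((Real.sin (2 * u) - Real.tanh (X1 u) * p1 (X1 u)) * (p1 (X1 u))⁻¹) u := by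
    intro u hu
    have := (k1.2 (X1 u)).comp u (d1 u hu)
    rwa [i1 u hu] at this
  have c2 : ∀ u ∈ Set.Ioo 0 L, HasDerivAt (fun u => p2 (X2 u))
      ((Real.sin (2 * u) - Real.tanh (X2 u) * p2 (X2 u)) * (p2 (X2 u))⁻¹) u := by
    intro u hu
    have := (k2.2 (X2 u)).comp u (d2 u hu)
    rwa [i2 u hu] at this
  have dd : ∀ u ∈ Set.Ioo 0 L, HasDerivAt d (-(a u * d u) - T u) u := by
    intro u hu
    refine ((c1 u hu).sub (c2 u hu)).congr_deriv ?_
    have q1 := (P1 (X1 u)).ne'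
    have q2 := (P2 (X2 u)).ne'
    simp only [ha, hd, hT]
    field_simp
    ring
  have dm : ∀ u ∈ Set.Ioo 0 L, HasDerivAt (fun u => (X1 u - X2 u) * d u)
      (-(d u ^ 2 / (p1 (X1 u) * p2 (X2 u))) - a u * ((X1 u - X2 u) * d u)
        - (X1 u - X2 u) * T u) u := by
    intro u hu
    refine (((d1 u hu).sub (d2 u hu)).mul (dd u hu)).congr_deriv ?_
    have q1 := (P1 (X1 u)).ne'
    have q2 := (P2 (X2 u)).ne'
    simp only [ha, hd, hT, Pi.sub_apply]
    field_simp
    ring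
  have hac : ContinuousOn a (Set.Ioo 0 L) := by
    refine ContinuousOn.div (by fun_prop) ?_ ?_
    · exact fun u hu => ((c1 u hu).continuousAt.mul (c2 u hu).continuousAt).continuousWithinAt
    · exact fun u hu => (mul_pos (P1 _) (P2 _)).ne'
  obtain ⟨w, hw, hwm⟩ := aux_sign hac dm (fun u hu => by
    have e1 : 0 ≤ d u ^ 2 / (p1 (X1 u) * p2 (X2 u)) :=
      div_nonneg (sq_nonneg _) (mul_pos (P1 _) (P2 _)).le
    have e2 := aux_tanh_prod (X1 u) (X2 u)
    simp only [hT]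
    linarith)
  have dsq : ∀ u ∈ Set.Ioo 0 L, HasDerivAt (fun u => d u ^ 2)
      (-2 * (a u * d u ^ 2) - 2 * (d u * T u)) u := by
    intro u hu
    refine ((dd u hu).pow 2).congr_deriv ?_
    push_cast
    ring
  have hdb : Tendsto (fun u => d u ^ 2) (nhdsWithin 0 (Set.Ioi 0)) (nhds 0) := by
    have := (((aux_p_tendsto k1 aux_tb kb1).comp lb1).sub
      ((aux_p_tendsto k2 aux_tb kb2).comp lb2)).pow 2
    simpa [Function.comp_def] using this
  have hdt : Tendsto (fun u => d u ^ 2) (nhdsWithin L (Set.Iio L)) (nhds 0) := by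
    have := (((aux_p_tendsto k1 aux_tt kt1).comp lt1).sub
      ((aux_p_tendsto k2 aux_tt kt2).comp lt2)).pow 2
    simpa [Function.comp_def] using this
  -- relation between the signs of `(X1 - X2) d` and `d T`
  have hsgn : ∀ u, 0 ≤ ((X1 u - X2 u) * d u) * (d u * T u) := by
    intro u
    have := mul_nonneg (aux_tanh_prod (X1 u) (X2 u)) (sq_nonneg (d u))
    simp only [hT]
    linarith
  have hLπ : Real.pi ≤ L := by
    have : (1:ℝ) ≤ n := by exact_mod_cast hn
    rw [hL]
    nlinarith [Real.pi_pos]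
  have hnoneg : ∀ v ∈ Set.Ioo 0 L, 0 ≤ (X1 v - X2 v) * d v := by
    intro v hv
    by_contra! hneg
    have hneg' : ∀ u ∈ Set.Ioo 0 L, v ≤ u → (X1 u - X2 u) * d u < 0 := by
      intro u hu hvu
      have e := hwm hv hu hvu
      simp only at e
      by_contra! hc
      have := mul_nonneg (hw u).le hc
      have := mul_neg_of_pos_of_neg (hw v) hneg
      linarith
    set c := max v (L - Real.pi / 2) with hc
    have hcL : c < L := max_lt hv.2 (by linarith [Real.pi_pos])
    have hc0 : 0 < c := hv.1.trans_le (le_max_left _ _)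
    have hmono : MonotoneOn (fun u => d u ^ 2) (Set.Ioo c L) := by
      refine aux_mono (convex_Ioo c L) (fun u hu => dsq u ⟨hc0.trans hu.1, hu.2⟩) ?_
      intro u hu
      have hu' : u ∈ Set.Ioo 0 L := ⟨hc0.trans hu.1, hu.2⟩
      have n1 := hneg' u hu' ((le_max_left _ _).trans hu.1.le)
      have n2 : L - Real.pi / 2 < u := (le_max_right _ _).trans_lt hu.1
      have n3 : Real.sin (2 * u) ≤ 0 := by
        have : Real.sin (2 * u) = Real.sin (2 * u - n * (2 * Real.pi)) :=
          (Real.sin_sub_nat_mul_two_pi _ _).symm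
        rw [this]
        have hu2 := hu.2
        apply Real.sin_nonpos_of_nonpos_of_neg_pi_le <;> rw [hL] at * <;> linarith
      have n4 : a u ≤ 0 :=
        div_nonpos_of_nonpos_of_nonneg n3 (mul_pos (P1 _) (P2 _)).le
      have n5 : d u * T u ≤ 0 := by
        by_contra! hh
        have := hsgn u
        nlinarith [mul_neg_of_neg_of_pos n1 hh]
      have n6 := mul_nonneg (neg_nonneg.2 n4) (sq_nonneg (d u))
      linarith
    set e := (c + L) / 2 with he
    have he1 : e ∈ Set.Ioo c L := by constructor <;> linarith
    have : d e ^ 2 ≤ 0 := by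
      refine ge_of_tendsto hdt ?_
      filter_upwards [Ioo_mem_nhdsLT he1.2] with u hu
      exact hmono he1 ⟨he1.1.trans hu.1, hu.2⟩ hu.1.le
    have hde : d e = 0 := by
      have : d e ^ 2 = 0 := le_antisymm this (sq_nonneg _)
      simpa using this
    have := hneg' e ⟨hc0.trans he1.1, he1.2⟩ ((le_max_left _ _).trans he1.1.le)
    rw [hde] at this
    simp at this
  have hnopos : ∀ v ∈ Set.Ioo 0 L, (X1 v - X2 v) * d v ≤ 0 := by
    intro v hv
    by_contra! hneg
    have hneg' : ∀ u ∈ Set.Ioo 0 L, u ≤ v → 0 < (X1 u - X2 u) * d u := by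
      intro u hu hvu
      have e := hwm hu hv hvu
      simp only at e
      by_contra! hc
      have := mul_nonneg (hw u).le (neg_nonneg.2 hc)
      have := mul_pos (hw v) hneg
      linarith
    set c := min v (Real.pi / 2) with hc
    have hc0 : 0 < c := lt_min hv.1 (by linarith [Real.pi_pos])
    have hcL : c < L := (min_le_left _ _).trans_lt hv.2
    have hanti : AntitoneOn (fun u => d u ^ 2) (Set.Ioo 0 c) := by
      refine aux_anti (convex_Ioo 0 c) (fun u hu => dsq u ⟨hu.1, hu.2.trans hcL⟩) ?_
      intro u hu
      have hu' : u ∈ Set.Ioo 0 L := ⟨hu.1, hu.2.trans hcL⟩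
      have n1 := hneg' u hu' (hu.2.le.trans (min_le_left _ _))
      have n2 : u < Real.pi / 2 := hu.2.trans_le (min_le_right _ _)
      have n3 : 0 ≤ Real.sin (2 * u) :=
        Real.sin_nonneg_of_nonneg_of_le_pi (by linarith [hu.1]) (by linarith)
      have n4 : 0 ≤ a u := div_nonneg n3 (mul_pos (P1 _) (P2 _)).le
      have n5 : 0 ≤ d u * T u := by
        by_contra! hh
        have := hsgn u
        nlinarith [mul_neg_of_pos_of_neg n1 hh]
      have n6 := mul_nonneg n4 (sq_nonneg (d u))
      linarith
    set e := c / 2 with he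
    have he1 : e ∈ Set.Ioo 0 c := by constructor <;> linarith
    have : d e ^ 2 ≤ 0 := by
      refine ge_of_tendsto hdb ?_
      filter_upwards [Ioo_mem_nhdsGT he1.1] with u hu
      exact hanti ⟨hu.1, hu.2.trans he1.2⟩ he1 hu.2.le
    have hde : d e = 0 := by
      have : d e ^ 2 = 0 := le_antisymm this (sq_nonneg _)
      simpa using this
    have := hneg' e ⟨he1.1, he1.2.trans hcL⟩ (he1.2.le.trans (min_le_left _ _))
    rw [hde] at this
    simp at this
  intro u hu
  by_contra hne
  have hz : ∀ v ∈ Set.Ioo 0 L, (X1 v - X2 v) * d v = 0 :=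
    fun v hv => le_antisymm (hnopos v hv) (hnoneg v hv)
  have hder0 : HasDerivAt (fun u => (X1 u - X2 u) * d u) 0 u := by
    refine (hasDerivAt_const u (0:ℝ)).congr_of_eventuallyEq ?_
    filter_upwards [Ioo_mem_nhds hu.1 hu.2] with v hv using hz v hv
  have e := hder0.unique (dm u hu)
  rw [hz u hu] at e
  have e1 : 0 ≤ d u ^ 2 / (p1 (X1 u) * p2 (X2 u)) :=
    div_nonneg (sq_nonneg _) (mul_pos (P1 _) (P2 _)).le
  have e2 := aux_tanh_prod_pos hne
  simp only [hT] at e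
  linarith
end

section
/- Let d ≥ 2 be an integer and define V_d(r) = (d(d-4)/4) · r²/(r²+1)² + (d/2) · 1/(r²+1) for r ∈ ℝ. Suppose f : ℝ → ℝ is a C² function satisfying -f''(r) + V_d(r) f(r) = 0 for all r ∈ ℝ, and suppose there is a constant C > 0 such that |f(r)| ≤ C (1+|r|)^{-(d-2)/2} for all r ∈ ℝ. Then f is identically zero. (That is, the Schrödinger operator -d²/dr² + V_d on the line has no zero-energy resonance.) -/
open Real Filter MeasureTheory

theorem mono_aux (g : ℝ → ℝ) (h : Monotone g) (h1 : Tendsto g atTop (nhds 0))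
    (h2 : Tendsto g atBot (nhds 0)) (x : ℝ) : g x = 0 :=
  le_antisymm (h.ge_of_tendsto h1 x) (h.le_of_tendsto h2 x)

theorem stmt10 (d : ℕ) (hd : 2 ≤ d) (f : ℝ → ℝ) (hf : ContDiff ℝ 2 f)
    (hode : ∀ r : ℝ, -(deriv (deriv f) r) +
      ((d : ℝ) * ((d : ℝ) - 4) / 4 * (r ^ 2 / (r ^ 2 + 1) ^ 2)
        + (d : ℝ) / 2 * (1 / (r ^ 2 + 1))) * f r = 0)
    (C : ℝ) (hC : 0 < C)
    (hdecay : ∀ r : ℝ, |f r| ≤ C * (1 + |r|) ^ (-(((d : ℝ) - 2) / 2))) :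
    f = fun _ => 0 := by
  have hd' : (2 : ℝ) ≤ d := by exact_mod_cast hd
  have hpos : ∀ r : ℝ, 0 < r ^ 2 + 1 := fun r => by positivity
  obtain ⟨φ, hφ⟩ : ∃ φ : ℝ → ℝ, φ = fun r => (r ^ 2 + 1) ^ ((d : ℝ) / 4) := ⟨_, rfl⟩
  obtain ⟨p, hp⟩ : ∃ p : ℝ → ℝ, p = fun r => (d : ℝ) / 2 * r / (r ^ 2 + 1) := ⟨_, rfl⟩
  have φpos : ∀ r, 0 < φ r := fun r => by rw [hφ]; exact rpow_pos_of_pos (hpos r) _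
  have hsq : ∀ r : ℝ, HasDerivAt (fun r : ℝ => r ^ 2 + 1) (2 * r) r := fun r => by
    simpa using (hasDerivAt_pow 2 r).add_const (1 : ℝ)
  have dφ : ∀ r, HasDerivAt φ (p r * φ r) r := fun r => by
    have h := (hsq r).rpow_const (p := (d : ℝ) / 4) (Or.inl (hpos r).ne')
    rw [hφ, hp]
    convert h using 1
    rw [rpow_sub_one (hpos r).ne']
    have := (hpos r).ne'
    field_simp
    ring
  have dp : ∀ r, HasDerivAt p ((d : ℝ) / 2 * (1 - r ^ 2) / (r ^ 2 + 1) ^ 2) r := fun r => by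
    have h := ((hasDerivAt_id r).const_mul ((d : ℝ) / 2)).div (hsq r) (hpos r).ne'
    rw [hp]
    refine HasDerivAt.congr_deriv h ?_
    simp only [id]
    ring
  have df : ∀ r, HasDerivAt f (deriv f r) r := fun r =>
    (hf.differentiable (by norm_num) r).hasDerivAt
  have ddf : ∀ r, HasDerivAt (deriv f) (deriv (deriv f) r) r := fun r => by
    have h : ContDiff ℝ 1 (deriv f) := by
      have : ContDiff ℝ (1 + 1) f := by simpa [one_add_one_eq_two] using hf
      exact (contDiff_succ_iff_deriv.1 this).2.2
    exact (h.differentiable (by norm_num) r).hasDerivAt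
  have dW : ∀ r, HasDerivAt (fun r => φ r * (deriv f r - p r * f r)) 0 r := fun r => by
    have h := (dφ r).mul ((ddf r).sub ((dp r).mul (df r)))
    refine HasDerivAt.congr_deriv h ?_
    have h1 : deriv (deriv f) r = _ := (neg_add_eq_zero.1 (hode r))
    simp only [Pi.sub_apply, Pi.mul_apply]
    rw [h1, hp]
    have := (hpos r).ne'
    field_simp
    ring
  obtain ⟨c, hc⟩ : ∃ c, ∀ r, φ r * (deriv f r - p r * f r) = c :=
    ⟨_, fun r => is_const_of_deriv_eq_zero (fun r => (dW r).differentiableAt)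
      (fun r => (dW r).deriv) r 0⟩
  have dg : ∀ r, HasDerivAt (fun r => f r / φ r) (c / φ r ^ 2) r := fun r => by
    have h := (df r).div (dφ r) (φpos r).ne'
    refine HasDerivAt.congr_deriv h ?_
    rw [← hc r]; ring
  have bound : ∀ r, |f r / φ r| ≤ C / φ r := fun r => by
    rw [abs_div, abs_of_pos (φpos r)]
    refine div_le_div_of_nonneg_right ((hdecay r).trans ?_) (φpos r).le
    exact mul_le_of_le_one_right hC.le (rpow_le_one_of_one_le_of_nonpos
      (by linarith [abs_nonneg r]) (by linarith))
  have lim : ∀ l : Filter ℝ, Tendsto (fun r : ℝ => r ^ 2) l atTop →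
      Tendsto (fun r => f r / φ r) l (nhds 0) := fun l hl => by
    refine squeeze_zero_norm bound ?_
    refine Tendsto.const_div_atTop ?_ C
    rw [hφ]
    exact (tendsto_rpow_atTop (by linarith)).comp (tendsto_atTop_add_const_right _ 1 hl)
  have h1 := lim atTop (tendsto_pow_atTop (by norm_num))
  have h2 := lim atBot (by
    have := (tendsto_pow_atTop (α := ℝ) (n := 2) (by norm_num)).comp tendsto_neg_atBot_atTop
    refine this.congr fun x => ?_
    simp)
  have key : ∀ r, f r / φ r = 0 := by
    rcases le_total 0 c with h | h
    · refine mono_aux _ (monotone_of_deriv_nonneg (fun r => (dg r).differentiableAt) fun r => ?_)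
        h1 h2
      rw [(dg r).deriv]; positivity
    · intro r
      refine neg_eq_zero.1 (mono_aux (fun r => -(f r / φ r)) (Antitone.neg
        (antitone_of_deriv_nonpos (fun r => (dg r).differentiableAt) fun r => ?_))
        (by simpa using h1.neg) (by simpa using h2.neg) r)
      rw [(dg r).deriv]; exact div_nonpos_of_nonpos_of_nonneg h (by positivity)
  funext r
  exact (div_eq_zero_iff.1 (key r)).resolve_right (φpos r).ne'
end

section
/- Fix an integer n ≥ 0 and let Q : ℝ → ℝ be a C² solution of the harmonic map ODE with lim_{r→-∞} Q(r) = 0 and lim_{r→+∞} Q(r) = nπ. Define V(r) = (r²+1)^{-2} + 2(r²+1)^{-1}(cos(2Q(r)) - 1). Then for every smooth compactly supported function h : ℝ → ℝ, ∫_ℝ ( |h'(r)|² + (2(r²+1)^{-1} + V(r)) |h(r)|² ) dr ≥ ∫_ℝ |h(r)|² (r²+1)^{-2} dr. -/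
open Real Filter MeasureTheory

/-- The potential obtained by linearizing about the degree-`n` harmonic map `Q`. -/
noncomputable def Vpot (Q : ℝ → ℝ) (r : ℝ) : ℝ :=
  1 / (r ^ 2 + 1) ^ 2 + 2 / (r ^ 2 + 1) * (Real.cos (2 * Q r) - 1)

lemma aux_key (Q h s s' : ℝ → ℝ) (hQc : Continuous Q) (hs : ∀ r, HasDerivAt s (s' r) r)
    (hs' : Continuous s')
    (hle : ∀ r, s' r + s r ^ 2 ≤ 2 * Real.cos (2 * Q r) / (r ^ 2 + 1))
    (hsm : ContDiff ℝ (⊤ : ℕ∞) h) (hsupp : HasCompactSupport h) :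
    ∫ r : ℝ, (h r) ^ 2 / (r ^ 2 + 1) ^ 2 ≤
      ∫ r : ℝ, ((deriv h r) ^ 2 + (2 / (r ^ 2 + 1) + Vpot Q r) * (h r) ^ 2) := by
  have hp : ∀ r : ℝ, r ^ 2 + 1 ≠ 0 := fun r => by positivity
  have hp2 : ∀ r : ℝ, (r ^ 2 + 1) ^ 2 ≠ 0 := fun r => by positivity
  have hd : Differentiable ℝ h := hsm.differentiable (by simp)
  have hc : Continuous h := hd.continuous
  have hdc : Continuous (deriv h) := hsm.continuous_deriv (by simp)
  have hsc : Continuous s := continuous_iff_continuousAt.2 fun r => (hs r).continuousAt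
  have hds : HasCompactSupport (deriv h) := hsupp.deriv
  have iA : Integrable (fun r : ℝ => (h r) ^ 2 / (r ^ 2 + 1) ^ 2) := by
    apply Continuous.integrable_of_hasCompactSupport
    · fun_prop (disch := assumption)
    · have : (fun r : ℝ => (h r) ^ 2 / (r ^ 2 + 1) ^ 2) =
        (fun r => h r / (r ^ 2 + 1) ^ 2) * h := by
        ext r; simp only [Pi.mul_apply]; ring
      rw [this]; exact hsupp.mul_left
  have ig : Integrable (fun r : ℝ => s r * h r ^ 2) := by
    apply Continuous.integrable_of_hasCompactSupport
    · fun_prop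
    · have : (fun r : ℝ => s r * h r ^ 2) = (fun r => s r * h r) * h := by
        ext r; simp only [Pi.mul_apply]; ring
      rw [this]; exact hsupp.mul_left
  have ig' : Integrable (fun r : ℝ => s' r * h r ^ 2 + s r * (2 * h r * deriv h r)) := by
    apply Continuous.integrable_of_hasCompactSupport
    · fun_prop
    · have : (fun r : ℝ => s' r * h r ^ 2 + s r * (2 * h r * deriv h r)) =
        (fun r => s' r * h r + s r * (2 * deriv h r)) * h := by
        ext r; simp only [Pi.mul_apply]; ring
      rw [this]; exact hsupp.mul_left
  have iB : Integrable (fun r : ℝ =>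
      ((deriv h r) ^ 2 + (2 / (r ^ 2 + 1) + Vpot Q r) * (h r) ^ 2)) := by
    apply Continuous.integrable_of_hasCompactSupport
    · unfold Vpot
      fun_prop (disch := assumption)
    · have : (fun r : ℝ => ((deriv h r) ^ 2 + (2 / (r ^ 2 + 1) + Vpot Q r) * (h r) ^ 2)) =
        (deriv h) * (deriv h) + (fun r => (2 / (r ^ 2 + 1) + Vpot Q r) * h r) * h := by
        ext r; simp only [Pi.mul_apply, Pi.add_apply]; ring
      rw [this]; exact hds.mul_left.add hsupp.mul_left
  have h0 : ∫ r : ℝ, (s' r * h r ^ 2 + s r * (2 * h r * deriv h r)) = 0 := by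
    apply integral_eq_zero_of_hasDerivAt_of_integrable _ ig' ig
    intro r
    have := (hs r).mul ((hd r).hasDerivAt.pow 2)
    refine HasDerivAt.congr_deriv this ?_
    simp
  have e : ∫ r : ℝ, (h r) ^ 2 / (r ^ 2 + 1) ^ 2 = ∫ r : ℝ, ((h r) ^ 2 / (r ^ 2 + 1) ^ 2 +
      (s' r * h r ^ 2 + s r * (2 * h r * deriv h r))) := by
    rw [integral_add iA ig', h0, add_zero]
  rw [e]
  apply integral_mono (iA.add ig') iB
  intro r
  have h1 := mul_le_mul_of_nonneg_right (hle r) (sq_nonneg (h r))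
  have h2 : (2 / (r ^ 2 + 1) + Vpot Q r) * (h r) ^ 2 =
      2 * Real.cos (2 * Q r) / (r ^ 2 + 1) * h r ^ 2 + (h r) ^ 2 / (r ^ 2 + 1) ^ 2 := by
    unfold Vpot; ring
  simp only [Pi.add_apply]
  rw [h2]
  nlinarith [sq_nonneg (deriv h r - s r * h r)]

lemma aux_unique (Q w : ℝ → ℝ) (hQ : ∀ r, HasDerivAt Q (w r / (r ^ 2 + 1)) r)
    (hw : ∀ r, HasDerivAt w (Real.sin (2 * Q r)) r) (r0 : ℝ) (h0 : w r0 = 0)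
    (h1 : Real.sin (Q r0) = 0) : ∀ r, Q r = Q r0 := by
  have key := ODE_solution_unique_univ (K := 2) (t₀ := r0)
    (v := fun r (y : ℝ × ℝ) => (y.2 / (r ^ 2 + 1), Real.sin (2 * y.1)))
    (s := fun _ => Set.univ) (f := fun r => (Q r, w r)) (g := fun _ => (Q r0, 0)) ?_ ?_ ?_ ?_
  · intro r
    exact congrArg Prod.fst (congrFun key r)
  · intro t
    apply LipschitzWith.lipschitzOnWith
    apply LipschitzWith.of_dist_le_mul
    intro x y
    have a1 : |x.1 - y.1| ≤ dist x y := by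
      rw [Prod.dist_eq]; exact le_max_left _ _
    have a2 : |x.2 - y.2| ≤ dist x y := by
      rw [Prod.dist_eq]; exact le_max_right _ _
    rw [Prod.dist_eq (x := (x.2 / (t ^ 2 + 1), Real.sin (2 * x.1)))]
    simp only [Real.dist_eq, NNReal.coe_ofNat]
    apply max_le
    · rw [← sub_div, abs_div, abs_of_pos (show (0 : ℝ) < t ^ 2 + 1 by positivity)]
      have := div_le_self (abs_nonneg (x.2 - y.2)) (show (1 : ℝ) ≤ t ^ 2 + 1 by nlinarith [sq_nonneg t])
      linarith [abs_nonneg (x.2 - y.2)]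
    · have := Real.lipschitzWith_sin.dist_le_mul (2 * x.1) (2 * y.1)
      simp only [Real.dist_eq, NNReal.coe_one, one_mul] at this
      rw [← mul_sub, abs_mul, abs_two] at this
      linarith
  · intro t
    exact ⟨(hQ t).prodMk (hw t), trivial⟩
  · intro t
    refine ⟨?_, trivial⟩
    have : Real.sin (2 * Q r0) = 0 := by rw [Real.sin_two_mul, h1]; ring
    simp only [this, zero_div]
    exact hasDerivAt_const t _
  · simp [h0]

theorem stmt11 (n : ℕ) (Q : ℝ → ℝ) (hQ : IsHarmonicMapSol Q)
    (hQb : Tendsto Q atBot (nhds 0))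
    (hQt : Tendsto Q atTop (nhds ((n : ℝ) * Real.pi)))
    (h : ℝ → ℝ) (hsm : ContDiff ℝ (⊤ : ℕ∞) h) (hsupp : HasCompactSupport h) :
    ∫ r : ℝ, (h r) ^ 2 / (r ^ 2 + 1) ^ 2 ≤
      ∫ r : ℝ, ((deriv h r) ^ 2 + (2 / (r ^ 2 + 1) + Vpot Q r) * (h r) ^ 2) := by
  obtain ⟨hC, hode⟩ := hQ
  have hp : ∀ r : ℝ, r ^ 2 + 1 ≠ 0 := fun r => by positivity
  have hQd : Differentiable ℝ Q := hC.differentiable (by simp)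
  have hQc : Continuous Q := hQd.continuous
  have hQ'd : Differentiable ℝ (deriv Q) := by
    have : ContDiff ℝ (1 + 1) Q := by simpa [one_add_one_eq_two] using hC
    exact (contDiff_succ_iff_deriv.1 this).2.2.differentiable (by simp)
  obtain ⟨w, hw⟩ : ∃ w : ℝ → ℝ, w = fun r => (r ^ 2 + 1) * deriv Q r := ⟨_, rfl⟩
  have hQw : ∀ r, HasDerivAt Q (w r / (r ^ 2 + 1)) r := by
    intro r
    have : w r / (r ^ 2 + 1) = deriv Q r := by rw [hw]; field_simp [hp r]
    rw [this]; exact (hQd r).hasDerivAt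
  have hpd : ∀ r : ℝ, HasDerivAt (fun r : ℝ => r ^ 2 + 1) (2 * r) r := by
    intro r
    simpa using ((hasDerivAt_id r).pow 2).add_const (1 : ℝ)
  have hwd : ∀ r, HasDerivAt w (Real.sin (2 * Q r)) r := by
    intro r
    have := (hpd r).mul (hQ'd r).hasDerivAt
    rw [hw]
    refine HasDerivAt.congr_deriv this ?_
    have := hode r
    field_simp [hp r] at this
    linarith
  have hwc : Continuous w := continuous_iff_continuousAt.2 fun r => (hwd r).continuousAt
  obtain ⟨E, hE⟩ : ∃ E : ℝ → ℝ, E = fun r => w r ^ 2 / (2 * (r ^ 2 + 1)) - Real.sin (Q r) ^ 2 :=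
    ⟨_, rfl⟩
  have hEd : ∀ r, HasDerivAt E (-(w r ^ 2 * r / (r ^ 2 + 1) ^ 2)) r := by
    intro r
    have := (((hwd r).pow 2).div ((hpd r).const_mul 2) (by positivity)).sub
      ((hQw r).sin.pow 2)
    rw [hE]
    refine HasDerivAt.congr_deriv this ?_
    rw [Real.sin_two_mul]
    simp only [Pi.pow_apply]
    field_simp [hp r]
    norm_num
    ring
  have hEge : ∀ r, -Real.sin (Q r) ^ 2 ≤ E r := by
    intro r
    have : 0 ≤ w r ^ 2 / (2 * (r ^ 2 + 1)) := by positivity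
    rw [hE]; simp only; linarith
  have hEc : Continuous E := continuous_iff_continuousAt.2 fun r => (hEd r).continuousAt
  have hanti : AntitoneOn E (Set.Ici 0) := by
    apply antitoneOn_of_deriv_nonpos (convex_Ici 0) hEc.continuousOn
      (fun r _ => (hEd r).differentiableAt.differentiableWithinAt)
    intro r hr
    rw [interior_Ici] at hr
    have hr : 0 < r := hr
    rw [(hEd r).deriv]
    have : 0 ≤ w r ^ 2 * r / (r ^ 2 + 1) ^ 2 := by positivity
    linarith
  have hmono : MonotoneOn E (Set.Iic 0) := by
    apply monotoneOn_of_deriv_nonneg (convex_Iic 0) hEc.continuousOn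
      (fun r _ => (hEd r).differentiableAt.differentiableWithinAt)
    intro r hr
    rw [interior_Iic] at hr
    have hr : 0 < -r := by have : r < 0 := hr; linarith
    rw [(hEd r).deriv]
    have : 0 ≤ w r ^ 2 * (-r) / (r ^ 2 + 1) ^ 2 := by positivity
    have e : w r ^ 2 * (-r) / (r ^ 2 + 1) ^ 2 = -(w r ^ 2 * r / (r ^ 2 + 1) ^ 2) := by ring
    linarith
  have hEnn : ∀ r, 0 ≤ E r := by
    intro r
    rcases le_total 0 r with hr | hr
    · have t : Tendsto (fun x => -Real.sin (Q x) ^ 2) atTop (nhds 0) := by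
        have := (((Real.continuous_sin.tendsto _).comp hQt).pow 2).neg
        simpa [Real.sin_nat_mul_pi] using this
      apply le_of_tendsto t
      filter_upwards [eventually_ge_atTop r] with x hx
      exact (hEge x).trans (hanti hr (hr.trans hx) hx)
    · have t : Tendsto (fun x => -Real.sin (Q x) ^ 2) atBot (nhds 0) := by
        have := (((Real.continuous_sin.tendsto _).comp hQb).pow 2).neg
        simpa using this
      apply le_of_tendsto t
      filter_upwards [eventually_le_atBot r] with x hx
      exact (hEge x).trans (hmono (hx.trans hr) hr hx)
  by_cases hz : ∃ r0, w r0 = 0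
  · obtain ⟨r0, h0⟩ := hz
    have h1 : Real.sin (Q r0) = 0 := by
      have := hEnn r0
      rw [hE] at this
      simp only [h0] at this
      have : Real.sin (Q r0) ^ 2 = 0 := by
        apply le_antisymm _ (sq_nonneg _)
        norm_num at this
        simp [this]
      simpa using this
    have hconst := aux_unique Q w hQw hwd r0 h0 h1
    apply aux_key Q h (fun _ => 0) (fun _ => 0) hQc (fun r => hasDerivAt_const r _)
      continuous_const _ hsm hsupp
    intro r
    have : Real.cos (2 * Q r) = 1 := by
      rw [Real.cos_two_mul, Real.cos_sq', hconst r, h1]; norm_num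
    rw [this]
    norm_num
    positivity
  · push Not at hz
    have hz2 : ∀ r, w r ^ 2 ≠ 0 := fun r => pow_ne_zero 2 (hz r)
    apply aux_key Q h (fun r => Real.sin (2 * Q r) / w r)
      (fun r => 2 * Real.cos (2 * Q r) / (r ^ 2 + 1) - Real.sin (2 * Q r) ^ 2 / w r ^ 2) hQc
      _ _ _ hsm hsupp
    · intro r
      have := (((hQw r).const_mul 2).sin).div (hwd r) (hz r)
      refine HasDerivAt.congr_deriv this ?_
      have := hz r
      field_simp [hp r]
    · fun_prop (disch := assumption)
    · intro r
      simp only [div_pow]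
      linarith
end

section
/- Fix an integer n ≥ 0 and let Q : ℝ → ℝ be a C² solution of the harmonic map ODE with lim_{r→-∞} Q(r) = 0 and lim_{r→+∞} Q(r) = nπ. Define V(r) = (r²+1)^{-2} + 2(r²+1)^{-1}(cos(2Q(r)) - 1). Then there exist constants c > 0 and C > 0 such that for every smooth compactly supported function f : ℝ → ℝ, c ∫_ℝ |f'(r)|² (r²+1)² dr ≤ ∫_ℝ ( |f'(r)|² + V(r) |f(r)|² ) (r²+1)² dr ≤ C ∫_ℝ |f'(r)|² (r²+1)² dr. -/
open Real Filter MeasureTheory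

/-- Abstract coercivity from a Riccati solution. -/
lemma aux_abstract (G b : ℝ → ℝ) (K : ℝ) (hK : 0 ≤ K) (hG : Continuous G)
    (hG1 : ∀ r, G r ≤ 1) (hGK : ∀ r, -K ≤ G r)
    (hb : ∀ r, HasDerivAt b (G r - 1 - (b r) ^ 2 / (r ^ 2 + 1) ^ 2) r)
    (f : ℝ → ℝ) (hf : ContDiff ℝ (⊤ : ℕ∞) f) (hs : HasCompactSupport f) :
    (1 / (1 + K) * ∫ r : ℝ, (deriv f r) ^ 2 * (r ^ 2 + 1) ^ 2) ≤
        (∫ r : ℝ, ((deriv f r) ^ 2 * (r ^ 2 + 1) ^ 2 + G r * (f r) ^ 2)) ∧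
      (∫ r : ℝ, ((deriv f r) ^ 2 * (r ^ 2 + 1) ^ 2 + G r * (f r) ^ 2)) ≤
        5 * ∫ r : ℝ, (deriv f r) ^ 2 * (r ^ 2 + 1) ^ 2 := by
  have hp : ∀ r : ℝ, r ^ 2 + 1 ≠ 0 := fun r => by positivity
  have hfc : Continuous f := hf.continuous
  have hf'c : Continuous (deriv f) := hf.continuous_deriv (by simp)
  have hfd : ∀ r, HasDerivAt f (deriv f r) r := fun r =>
    (hf.differentiable (by simp) r).hasDerivAt
  have hbc : Continuous b := continuous_iff_continuousAt.2 fun r => (hb r).continuousAt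
  have hs' : HasCompactSupport (deriv f) := hs.deriv
  -- integrability of everything of the form g * f or g * f'
  have I1 : ∀ g : ℝ → ℝ, Continuous g → Integrable (fun r => g r * f r) := fun g hg =>
    (hg.mul hfc).integrable_of_hasCompactSupport hs.mul_left
  have I2 : ∀ g : ℝ → ℝ, Continuous g → Integrable (fun r => g r * deriv f r) := fun g hg =>
    (hg.mul hf'c).integrable_of_hasCompactSupport hs'.mul_left
  have IA : Integrable (fun r => (deriv f r) ^ 2 * (r ^ 2 + 1) ^ 2) := by
    refine (I2 (fun r => deriv f r * (r ^ 2 + 1) ^ 2) (by fun_prop)).congr ?_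
    exact Eventually.of_forall fun r => by ring
  have IB : Integrable (fun r => G r * (f r) ^ 2) := by
    refine (I1 (fun r => G r * f r) (by fun_prop)).congr ?_
    exact Eventually.of_forall fun r => by ring
  have IF : Integrable (fun r => (f r) ^ 2) := by
    refine (I1 (fun r => f r) (by fun_prop)).congr ?_
    exact Eventually.of_forall fun r => by ring
  have Z : ∀ g g' : ℝ → ℝ, Continuous g' → (∀ r, HasDerivAt g (g' r) r) →
      Integrable (fun r => g' r * (f r) ^ 2 + g r * (2 * f r * deriv f r)) ∧
      ∫ r, (g' r * (f r) ^ 2 + g r * (2 * f r * deriv f r)) = 0 := by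
    intro g g' hg' hg
    have hgc : Continuous g := continuous_iff_continuousAt.2 fun r => (hg r).continuousAt
    have i : Integrable (fun r => g' r * (f r) ^ 2 + g r * (2 * f r * deriv f r)) := by
      refine (((I1 (fun r => g' r * f r) (by fun_prop)).add
        (I2 (fun r => g r * (2 * f r)) (by fun_prop)))).congr ?_
      exact Eventually.of_forall fun r => by simp only [Pi.add_apply]; ring
    refine ⟨i, integral_eq_zero_of_hasDerivAt_of_integrable (f := fun r => g r * (f r) ^ 2)
      ?_ i ?_⟩
    · intro r
      have h := (hg r).mul ((hfd r).pow 2)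
      refine h.congr_deriv ?_
      simp
    · refine (I1 (fun r => g r * f r) (by fun_prop)).congr ?_
      exact Eventually.of_forall fun r => by ring
  obtain ⟨ib, zb⟩ := Z b _ (by
    refine (hG.sub continuous_const).sub ((hbc.pow 2).div (by fun_prop) ?_)
    intro r; positivity) hb
  obtain ⟨ir, zr⟩ := Z (fun r => r) (fun _ => 1) continuous_const (fun r => hasDerivAt_id r)
  set A := ∫ r : ℝ, (deriv f r) ^ 2 * (r ^ 2 + 1) ^ 2 with hA
  set B := ∫ r : ℝ, G r * (f r) ^ 2 with hB
  set F := ∫ r : ℝ, (f r) ^ 2 with hF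
  have hE : (∫ r : ℝ, ((deriv f r) ^ 2 * (r ^ 2 + 1) ^ 2 + G r * (f r) ^ 2)) = A + B :=
    integral_add IA IB
  have e1 : F ≤ A + B := by
    rw [← hE]
    have : F = ∫ r, ((f r) ^ 2 + ((G r - 1 - (b r) ^ 2 / (r ^ 2 + 1) ^ 2) * (f r) ^ 2
        + b r * (2 * f r * deriv f r))) := by
      rw [integral_add IF ib, zb, add_zero]
    rw [this]
    refine integral_mono (IF.add ib) (IA.add IB) fun r => ?_
    have h := sq_nonneg ((r ^ 2 + 1) * deriv f r - b r * f r / (r ^ 2 + 1))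
    have h2 : ((r ^ 2 + 1) * deriv f r - b r * f r / (r ^ 2 + 1)) ^ 2
      = (deriv f r) ^ 2 * (r ^ 2 + 1) ^ 2 - b r * (2 * f r * deriv f r)
        + (b r) ^ 2 / (r ^ 2 + 1) ^ 2 * (f r) ^ 2 := by
      have := hp r
      field_simp
      ring
    rw [h2] at h
    simp only
    linarith
  have e2 : F ≤ 4 * A := by
    have h4 : 0 ≤ 4 * A - F + 2 * ∫ r, (1 * (f r) ^ 2 + r * (2 * f r * deriv f r)) := by
      rw [ ← integral_const_mul 4, ← integral_const_mul 2,
        ← integral_sub (IA.const_mul 4) IF,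
        ← integral_add (f := fun a => 4 * (deriv f a ^ 2 * (a ^ 2 + 1) ^ 2) - f a ^ 2)
          ((IA.const_mul 4).sub IF) (ir.const_mul 2)]
      refine integral_nonneg fun r => ?_
      simp only [Pi.zero_apply]
      nlinarith [sq_nonneg (f r + 2 * r * deriv f r), sq_nonneg (deriv f r),
        mul_nonneg (sq_nonneg (deriv f r)) (by positivity : (0:ℝ) ≤ r ^ 4 + r ^ 2 + 1)]
    rw [zr] at h4
    linarith
  have e3 : B ≤ F := by
    refine integral_mono IB IF fun r => ?_
    simp only
    nlinarith [sq_nonneg (f r), hG1 r]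
  have e4 : -K * F ≤ B := by
    rw [hF, ← integral_const_mul]
    refine integral_mono (IF.const_mul _) IB fun r => ?_
    simp only
    nlinarith [sq_nonneg (f r), hGK r]
  rw [hE]
  refine ⟨?_, by linarith⟩
  rw [one_div, inv_mul_le_iff₀ (by linarith)]
  nlinarith

/-- nonnegativity of the pendulum energy. -/
lemma aux_W (Q q : ℝ → ℝ) (hd : ∀ r, HasDerivAt Q (q r) r)
    (hq : ∀ r, HasDerivAt q ((sin (2 * Q r) - 2 * r * q r) / (r ^ 2 + 1)) r)
    (hl : Tendsto (fun r => sin (Q r)) atTop (nhds 0)) (r : ℝ) (hr : 0 ≤ r) :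
    2 * sin (Q r) ^ 2 ≤ (r ^ 2 + 1) * q r ^ 2 := by
  have hW : ∀ r, HasDerivAt (fun r => (r ^ 2 + 1) * q r ^ 2 - 2 * sin (Q r) ^ 2)
      (-2 * r * q r ^ 2) r := by
    intro r
    have h := ((((hasDerivAt_id r).pow 2).add_const 1).mul ((hq r).pow 2)).sub
      (((hd r).sin.pow 2).const_mul 2)
    refine h.congr_deriv ?_
    have hp : r ^ 2 + 1 ≠ 0 := by positivity
    simp only [id, Pi.pow_apply, Nat.cast_ofNat, sin_two_mul]
    field_simp
    ring
  have anti : AntitoneOn (fun r => (r ^ 2 + 1) * q r ^ 2 - 2 * sin (Q r) ^ 2) (Set.Ici 0) := by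
    refine antitoneOn_of_hasDerivWithinAt_nonpos (convex_Ici 0)
      (fun x _ => (hW x).continuousAt.continuousWithinAt)
      (fun x _ => (hW x).hasDerivWithinAt) ?_
    intro x hx
    rw [interior_Ici] at hx
    have : (0:ℝ) < x := hx
    nlinarith [mul_nonneg this.le (sq_nonneg (q x))]
  have ht : Tendsto (fun r => -2 * sin (Q r) ^ 2) atTop (nhds 0) := by
    simpa using (hl.pow 2).const_mul (-2)
  have : 0 ≤ (r ^ 2 + 1) * q r ^ 2 - 2 * sin (Q r) ^ 2 := by
    refine le_of_tendsto ht ?_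
    filter_upwards [eventually_ge_atTop r] with s hs
    have h := anti (Set.mem_Ici.2 hr) (Set.mem_Ici.2 (hr.trans hs)) hs
    simp only at h
    have : 0 ≤ (s ^ 2 + 1) * q s ^ 2 := by positivity
    linarith
  linarith

lemma aux_reflect (Q q : ℝ → ℝ) (hd : ∀ r, HasDerivAt Q (q r) r)
    (hq : ∀ r, HasDerivAt q ((sin (2 * Q r) - 2 * r * q r) / (r ^ 2 + 1)) r) :
    (∀ r, HasDerivAt (fun r => -Q (-r)) (q (-r)) r) ∧
    (∀ r, HasDerivAt (fun r => q (-r))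
      ((sin (2 * -Q (-r)) - 2 * r * q (-r)) / (r ^ 2 + 1)) r) := by
  constructor
  · intro r
    have h := ((hd (-r)).comp r (hasDerivAt_neg r)).neg
    refine h.congr_deriv ?_
    ring
  · intro r
    have h := ((hq (-r)).comp r (hasDerivAt_neg r))
    refine h.congr_deriv ?_
    rw [mul_neg 2 (Q (-r)), sin_neg, neg_sq]
    ring

/-- decay at the right end. -/
lemma aux_decay (m : ℕ) (Q q : ℝ → ℝ) (hd : ∀ r, HasDerivAt Q (q r) r)
    (hq : ∀ r, HasDerivAt q ((sin (2 * Q r) - 2 * r * q r) / (r ^ 2 + 1)) r)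
    (hpos : ∀ r, 0 < q r)
    (hl : Tendsto Q atTop (nhds (m * π))) :
    ∃ K, ∀ r, 0 ≤ r → (r ^ 2 + 1) * sin (Q r) ^ 2 ≤ K := by
  have hsin : Tendsto (fun r => sin (Q r)) atTop (nhds 0) := by
    have := (continuous_sin.tendsto (m * π)).comp hl
    simpa [sin_nat_mul_pi, Function.comp_def] using this
  have hW := aux_W Q q hd hq hsin
  have hmono : Monotone Q := monotone_of_hasDerivAt_nonneg hd fun r => (hpos r).le
  have hle : ∀ r, Q r ≤ m * π := fun r => hmono.ge_of_tendsto hl r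
  have hev : ∀ᶠ r in atTop, m * π - π / 4 < Q r :=
    hl.eventually (lt_mem_nhds (by linarith [pi_pos]))
  obtain ⟨R, hR⟩ := (hev.and (eventually_ge_atTop 0)).exists
  have hDd : ∀ r, HasDerivAt (fun r => (r ^ 2 + 1) * sin (Q r) ^ 2)
      (2 * r * sin (Q r) ^ 2 + (r ^ 2 + 1) * (2 * sin (Q r) * cos (Q r) * q r)) r := by
    intro r
    have h := (((hasDerivAt_id r).pow 2).add_const 1).mul ((hd r).sin.pow 2)
    refine h.congr_deriv ?_
    simp only [id, Pi.pow_apply, Nat.cast_ofNat]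
    ring
  have hDc : Continuous (fun r => (r ^ 2 + 1) * sin (Q r) ^ 2) :=
    continuous_iff_continuousAt.2 fun r => (hDd r).continuousAt
  have anti : AntitoneOn (fun r => (r ^ 2 + 1) * sin (Q r) ^ 2) (Set.Ici R) := by
    refine antitoneOn_of_hasDerivWithinAt_nonpos (convex_Ici R)
      hDc.continuousOn (fun x _ => (hDd x).hasDerivWithinAt) ?_
    intro r hr
    rw [interior_Ici] at hr
    have hr0 : 0 < r := lt_of_le_of_lt hR.2 hr
    have h1 : m * π - π / 4 < Q r := lt_of_lt_of_le hR.1 (hmono (le_of_lt hr))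
    have h2 := hle r
    have hw := hW r hr0.le
    have hq0 := hpos r
    obtain ⟨d, hdd⟩ : ∃ d, d = m * π - Q r := ⟨_, rfl⟩
    have hs2 : sin (Q r) * cos (Q r) = -(sin d * cos d) := by
      have e : sin (2 * Q r) = - sin (2 * d) := by
        rw [show 2 * Q r = -(2 * d) + m * (2 * π) by rw [hdd]; ring, sin_add_nat_mul_two_pi,
          sin_neg]
      rw [sin_two_mul, sin_two_mul] at e
      linarith
    have hs1 : sin (Q r) ^ 2 = sin d ^ 2 := by
      have e : cos (2 * Q r) = cos (2 * d) := by
        rw [show 2 * Q r = -(2 * d) + m * (2 * π) by rw [hdd]; ring, cos_add_nat_mul_two_pi,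
          cos_neg]
      rw [cos_two_mul, cos_two_mul] at e
      nlinarith [sin_sq_add_cos_sq d, sin_sq_add_cos_sq (Q r)]
    have d0 : 0 ≤ d := by linarith
    have d1 : d ≤ π / 4 := by linarith
    have s0 : 0 ≤ sin d := sin_nonneg_of_nonneg_of_le_pi d0 (by linarith [pi_pos])
    have c0 : 0 ≤ cos d := cos_nonneg_of_neg_pi_div_two_le_of_le (by linarith [pi_pos])
      (by linarith [pi_pos])
    have c1 : 1 ≤ 2 * cos d ^ 2 := by
      have : 0 ≤ cos (2 * d) := cos_nonneg_of_neg_pi_div_two_le_of_le (by linarith [pi_pos])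
        (by linarith [pi_pos])
      rw [cos_two_mul] at this
      linarith
    rw [hs1] at hw
    have key : r * sin d ≤ (r ^ 2 + 1) * cos d * q r := by
      refine le_of_sq_le_sq ?_ (by positivity)
      calc (r * sin d) ^ 2 ≤ (r ^ 2 + 1) * sin d ^ 2 := by nlinarith [sq_nonneg (sin d)]
        _ ≤ (r ^ 2 + 1) * ((2 * cos d ^ 2) * sin d ^ 2) := by
          gcongr
          nlinarith [sq_nonneg (sin d)]
        _ = (r ^ 2 + 1) * (cos d ^ 2 * (2 * sin d ^ 2)) := by ring
        _ ≤ (r ^ 2 + 1) * (cos d ^ 2 * ((r ^ 2 + 1) * q r ^ 2)) := by gcongr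
        _ = _ := by ring
    have : 2 * r * sin (Q r) ^ 2 + (r ^ 2 + 1) * (2 * sin (Q r) * cos (Q r) * q r)
      = 2 * sin d * (r * sin d - (r ^ 2 + 1) * cos d * q r) := by
      rw [hs1, show 2 * sin (Q r) * cos (Q r) * q r = 2 * (sin (Q r) * cos (Q r)) * q r by ring,
        hs2]
      ring
    rw [this]
    exact mul_nonpos_of_nonneg_of_nonpos (by positivity) (by linarith)
  obtain ⟨K, hK⟩ := (isCompact_Icc (a := (0:ℝ)) (b := R)).bddAbove_image hDc.continuousOn
  refine ⟨K, fun r hr => ?_⟩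
  have hK' : ∀ x, 0 ≤ x → x ≤ R → (x ^ 2 + 1) * sin (Q x) ^ 2 ≤ K := fun x h0 h1 =>
    hK ⟨x, ⟨h0, h1⟩, rfl⟩
  rcases le_total r R with h | h
  · exact hK' r hr h
  · exact (anti (Set.mem_Ici.2 le_rfl) (Set.mem_Ici.2 h) h).trans (hK' R hR.2 le_rfl)

/-- uniqueness: a solution resting at a zero of the sine is constant. -/
lemma aux_unique_s13 (Q q : ℝ → ℝ) (hd : ∀ r, HasDerivAt Q (q r) r)
    (hq : ∀ r, HasDerivAt q ((sin (2 * Q r) - 2 * r * q r) / (r ^ 2 + 1)) r)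
    (r₀ : ℝ) (h0 : q r₀ = 0) (h1 : sin (Q r₀) = 0) : ∀ r, Q r = Q r₀ := by
  set Y : ℝ → ℝ := fun r => q r ^ 2 + (Q r - Q r₀) ^ 2 with hY
  set Y' : ℝ → ℝ := fun r => 2 * q r * ((sin (2 * Q r) - 2 * r * q r) / (r ^ 2 + 1))
    + 2 * (Q r - Q r₀) * q r with hY'
  have hYd : ∀ r, HasDerivAt Y (Y' r) r := by
    intro r
    have h := ((hq r).pow 2).add (((hd r).sub_const (Q r₀)).pow 2)
    refine h.congr_deriv ?_
    simp [hY']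
  have hsn : ∀ r, |sin (2 * Q r)| ≤ 2 * |Q r - Q r₀| := by
    intro r
    have e : sin (2 * (Q r - Q r₀)) = sin (2 * Q r) := by
      have c1 : cos (2 * Q r₀) = 1 := by rw [cos_two_mul, cos_sq', h1]; norm_num
      have s1 : sin (2 * Q r₀) = 0 := by rw [sin_two_mul, h1]; ring
      rw [mul_sub, sin_sub, c1, s1]; ring
    rw [← e]
    refine (abs_sin_le_abs).trans ?_
    rw [abs_mul]; norm_num
  have hbd : ∀ r, |Y' r| ≤ 5 * Y r := by
    intro r
    have hp : (0:ℝ) < r ^ 2 + 1 := by positivity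
    have b1 : |(sin (2 * Q r) - 2 * r * q r) / (r ^ 2 + 1)| ≤ 2 * |Q r - Q r₀| + |q r| := by
      rw [abs_div, abs_of_pos hp, div_le_iff₀ hp]
      have t1 : |sin (2 * Q r) - 2 * r * q r| ≤ |sin (2 * Q r)| + |2 * r * q r| := abs_sub _ _
      have t2 : |2 * r * q r| ≤ (r ^ 2 + 1) * |q r| := by
        rw [abs_mul]
        refine mul_le_mul_of_nonneg_right ?_ (abs_nonneg _)
        rw [abs_le]; constructor <;> nlinarith [sq_nonneg (r - 1), sq_nonneg (r + 1)]
      have t3 := hsn r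
      nlinarith [mul_nonneg (sq_nonneg r) (abs_nonneg (Q r - Q r₀))]
    have : |Y' r| ≤ 2 * |q r| * (2 * |Q r - Q r₀| + |q r|) + 2 * |Q r - Q r₀| * |q r| := by
      refine (abs_add_le _ _).trans ?_
      rw [abs_mul, abs_mul, abs_mul, abs_mul, abs_two]
      gcongr
    refine this.trans ?_
    simp only [hY]
    rw [← sq_abs (q r), ← sq_abs (Q r - Q r₀)]
    nlinarith [sq_nonneg (|q r| - |Q r - Q r₀|), sq_nonneg (|Q r - Q r₀|)]
  have hY0 : Y r₀ = 0 := by simp [hY, h0]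
  have hm1 : Antitone (fun r => Y r * exp (-5 * r)) := by
    refine antitone_of_hasDerivAt_nonpos
      (fun r => (hYd r).mul (((hasDerivAt_id r).const_mul (-5)).exp)) fun r => ?_
    have := (abs_le.1 (hbd r)).2
    simp only [id]
    change _ ≤ (0:ℝ)
    nlinarith [exp_pos (-5 * r)]
  have hm2 : Monotone (fun r => Y r * exp (5 * r)) := by
    refine monotone_of_hasDerivAt_nonneg
      (fun r => (hYd r).mul (((hasDerivAt_id r).const_mul 5).exp)) fun r => ?_
    have := (abs_le.1 (hbd r)).1
    simp only [id]
    change (0:ℝ) ≤ _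
    nlinarith [exp_pos (5 * r)]
  intro r
  have hYr : Y r ≤ 0 := by
    rcases le_total r r₀ with h | h
    · have := hm2 h
      simp only [hY0, zero_mul] at this
      exact nonpos_of_mul_nonpos_left this (exp_pos _)
    · have := hm1 h
      simp only [hY0, zero_mul] at this
      exact nonpos_of_mul_nonpos_left this (exp_pos _)
  have : (Q r - Q r₀) ^ 2 ≤ 0 := by
    simp only [hY] at hYr
    linarith [sq_nonneg (q r)]
  have := pow_eq_zero_iff (two_ne_zero) |>.1 (le_antisymm this (sq_nonneg _))
  linarith

/-- The Riccati function and the bound on the potential. -/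
lemma aux_main (n : ℕ) (Q : ℝ → ℝ) (hQ : IsHarmonicMapSol Q)
    (hQb : Tendsto Q atBot (nhds 0))
    (hQt : Tendsto Q atTop (nhds ((n : ℝ) * π))) :
    ∃ (K : ℝ) (b : ℝ → ℝ), (∀ r, (r ^ 2 + 1) * sin (Q r) ^ 2 ≤ K) ∧
      ∀ r, HasDerivAt b (2 * (r ^ 2 + 1) * (cos (2 * Q r) - 1)
        - (b r) ^ 2 / (r ^ 2 + 1) ^ 2) r := by
  obtain ⟨hC, hode⟩ := hQ
  set q := deriv Q with hqdef
  have hd : ∀ r, HasDerivAt Q (q r) r := fun r =>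
    (hC.differentiable (by norm_num) r).hasDerivAt
  have hq : ∀ r, HasDerivAt q ((sin (2 * Q r) - 2 * r * q r) / (r ^ 2 + 1)) r := by
    intro r
    have h1 : ContDiff ℝ 1 q := by
      have : ContDiff ℝ (1 + 1) Q := by simpa [one_add_one_eq_two] using hC
      exact (contDiff_succ_iff_deriv.1 this).2.2
    have h2 := (h1.differentiable (by norm_num) r).hasDerivAt
    refine h2.congr_deriv ?_
    have h3 := hode r
    have hp : r ^ 2 + 1 ≠ 0 := by positivity
    rw [sub_div, mul_div_right_comm]
    linarith
  obtain ⟨hd', hq'⟩ := aux_reflect Q q hd hq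
  have hQb' : Tendsto (fun r => -Q (-r)) atTop (nhds (((0:ℕ) : ℝ) * π)) := by
    simpa using (hQb.comp tendsto_neg_atTop_atBot).neg
  have hst : ∀ (m : ℕ) (P : ℝ → ℝ), Tendsto P atTop (nhds ((m:ℝ) * π)) →
      Tendsto (fun r => sin (P r)) atTop (nhds 0) := by
    intro m P h
    have := (continuous_sin.tendsto (m * π)).comp h
    simpa [sin_nat_mul_pi, Function.comp_def] using this
  have hW : ∀ r, 2 * sin (Q r) ^ 2 ≤ (r ^ 2 + 1) * q r ^ 2 := by
    intro r
    rcases le_total 0 r with h | h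
    · exact aux_W Q q hd hq (hst n Q hQt) r h
    · simpa using aux_W _ _ hd' hq' (hst 0 _ hQb') (-r) (by linarith)
  by_cases hz : ∃ r₀, q r₀ = 0
  · obtain ⟨r₀, h0⟩ := hz
    have h1 : sin (Q r₀) = 0 := by
      have := hW r₀
      rw [h0] at this
      have : sin (Q r₀) ^ 2 ≤ 0 := by linarith
      exact pow_eq_zero_iff (two_ne_zero) |>.1 (le_antisymm this (sq_nonneg _))
    have hc := aux_unique_s13 Q q hd hq r₀ h0 h1
    refine ⟨0, fun _ => 0, fun r => by rw [hc r, h1]; simp, fun r => ?_⟩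
    have c1 : cos (2 * Q r) = 1 := by rw [hc r, cos_two_mul, cos_sq', h1]; norm_num
    rw [c1]
    simpa using hasDerivAt_const r (0:ℝ)
  · push Not at hz
    have hqc : Continuous q := continuous_iff_continuousAt.2 fun r => (hq r).continuousAt
    have hpos : ∀ r, 0 < q r := by
      by_contra! hcon
      obtain ⟨a, ha⟩ := hcon
      have hneg : ∀ r, q r < 0 := by
        intro r
        by_contra! hr
        obtain ⟨x, hx⟩ := mem_range_of_exists_le_of_exists_ge hqc ⟨a, ha⟩ ⟨r, hr⟩
        exact hz x hx
      have han : StrictAnti Q := strictAnti_of_hasDerivAt_neg hd hneg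
      have l1 : Q 0 ≤ 0 := ge_of_tendsto hQb (by
        filter_upwards [eventually_le_atBot 0] with s hs using han.antitone hs)
      have l2 : (n:ℝ) * π ≤ Q 1 := han.antitone.le_of_tendsto hQt 1
      have l3 : Q 1 < Q 0 := han one_pos
      have : 0 ≤ (n:ℝ) * π := by positivity
      linarith
    obtain ⟨K1, hK1⟩ := aux_decay n Q q hd hq hpos hQt
    obtain ⟨K2, hK2⟩ := aux_decay 0 _ _ hd' hq' (fun r => hpos (-r)) hQb'
    refine ⟨max K1 K2, fun r => -2 * r * (r ^ 2 + 1) + (r ^ 2 + 1) * sin (2 * Q r) / q r,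
      ?_, ?_⟩
    · intro r
      rcases le_total 0 r with h | h
      · exact (hK1 r h).trans (le_max_left _ _)
      · have := hK2 (-r) (by linarith)
        simp at this
        exact this.trans (le_max_right _ _)
    · intro r
      have hp := ((hasDerivAt_id r).pow 2).add_const 1
      have h := (((hasDerivAt_id r).const_mul (-2)).mul hp).add
        ((hp.mul ((hd r).const_mul 2).sin).div (hq r) (hz r))
      refine h.congr_deriv ?_
      have hp' : r ^ 2 + 1 ≠ 0 := by positivity
      have hq0 := hz r
      simp only [id, Pi.pow_apply, Nat.cast_ofNat, Pi.mul_apply]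
      field_simp
      ring

theorem stmt13 (n : ℕ) (Q : ℝ → ℝ) (hQ : IsHarmonicMapSol Q)
    (hQb : Tendsto Q atBot (nhds 0))
    (hQt : Tendsto Q atTop (nhds ((n : ℝ) * Real.pi))) :
    ∃ c : ℝ, 0 < c ∧ ∃ C : ℝ, 0 < C ∧
      ∀ f : ℝ → ℝ, ContDiff ℝ (⊤ : ℕ∞) f → HasCompactSupport f →
        (c * ∫ r : ℝ, (deriv f r) ^ 2 * (r ^ 2 + 1) ^ 2) ≤
          (∫ r : ℝ, ((deriv f r) ^ 2 + Vpot Q r * (f r) ^ 2) * (r ^ 2 + 1) ^ 2) ∧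
        (∫ r : ℝ, ((deriv f r) ^ 2 + Vpot Q r * (f r) ^ 2) * (r ^ 2 + 1) ^ 2) ≤
          C * ∫ r : ℝ, (deriv f r) ^ 2 * (r ^ 2 + 1) ^ 2 := by
  obtain ⟨K, b, hK, hb⟩ := aux_main n Q hQ hQb hQt
  have hQc : Continuous Q := hQ.1.continuous
  have hK0 : 0 ≤ K := le_trans (by positivity) (hK 0)
  refine ⟨1 / (1 + 4 * K), by positivity, 5, by norm_num, fun f hf hs => ?_⟩
  have hcs : ∀ r, cos (2 * Q r) - 1 = -2 * sin (Q r) ^ 2 := by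
    intro r
    rw [cos_two_mul, cos_sq']
    ring
  have h := aux_abstract (fun r => 1 + 2 * (r ^ 2 + 1) * (cos (2 * Q r) - 1)) b (4 * K)
    (by linarith) (by fun_prop)
    (fun r => by
      have : 0 ≤ (r ^ 2 + 1) * sin (Q r) ^ 2 := by positivity
      simp only [hcs r]
      linarith)
    (fun r => by
      have := hK r
      simp only [hcs r]
      linarith)
    (fun r => by
      refine (hb r).congr_deriv ?_
      ring) f hf hs
  have e : (fun r : ℝ => ((deriv f r) ^ 2 + Vpot Q r * (f r) ^ 2) * (r ^ 2 + 1) ^ 2)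
      = fun r => (deriv f r) ^ 2 * (r ^ 2 + 1) ^ 2
        + (1 + 2 * (r ^ 2 + 1) * (cos (2 * Q r) - 1)) * (f r) ^ 2 := by
    funext r
    have hp : r ^ 2 + 1 ≠ 0 := by positivity
    unfold Vpot
    field_simp
  rw [e]
  exact h
end
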